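/- If Γ is a graph of girth at least 5 on 29 vertices with 72 edges, then (δ(Γ), Δ(Γ)) = (4,6) and Γ has an embedded S_{6,[4,4,4,4,3,3]} star; that is, Γ has a vertex of degree 6 with four neighbours of degree at least 5 and two neighbours of degree at least 4. -/

import Mathlib

open SimpleGraph

/-- `Γ` has girth at least 5: every cycle has length at least 5. -/
def GirthAtLeast5 {V : Type*} (G : SimpleGraph V) : Prop :=
  ∀ ⦃u : V⦄ (w : G.Walk u u), w.IsCycle → 5 ≤ w.length

/-- `G` has an embedded `S_{D,[e 0, …, e (D-1)]}` star: a vertex `x` of degree `D`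
whose `D` neighbours can be enumerated as `y 0, …, y (D-1)` with
`deg (y i) ≥ e i + 1` for each `i`. -/
def HasEmbeddedStar {V : Type*} [Fintype V] (G : SimpleGraph V) [DecidableRel G.Adj]
    (D : ℕ) (e : Fin D → ℕ) : Prop :=
  ∃ (x : V) (y : Fin D → V), G.degree x = D ∧ Function.Injective y ∧
    (∀ i, G.Adj x (y i)) ∧ ∀ i, e i + 1 ≤ G.degree (y i)

section
noncomputable section
namespace Eng
def force {α : Type} (x : Nat) (k : Nat → α) : α :=
  Nat.rec (motive := fun _ => α) (k (nat_lit 0)) (fun n _ => k n) (Nat.add x (nat_lit 1))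
def hforce {α : Type} (x : Nat) (k : Nat → α) : α :=
  force (Nat.xor x (Nat.mod x (nat_lit 2305843009213693951))) k
def ite' {α : Type} (b : Bool) (t e : α) : α := Bool.rec (motive := fun _ => α) e t b
def row (M v : Nat) : Nat := Nat.land (Nat.shiftRight M (Nat.shiftLeft v (nat_lit 5))) (nat_lit 4294967295)
def col (COL M v : Nat) : Nat := Nat.land (Nat.shiftRight M v) COL
def clear (P K : Nat) : Nat := Nat.xor P (Nat.land P K)

/-- add the edge v w -/
def addE {α : Type} (COL v w E P T : Nat) (k : Nat → Nat → Nat → α) : α :=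
  force (Nat.shiftLeft v (nat_lit 5)) fun v32 =>
  force (Nat.shiftLeft w (nat_lit 5)) fun w32 =>
  force (Nat.shiftLeft (nat_lit 1) v) fun bv =>
  force (Nat.shiftLeft (nat_lit 1) w) fun bw =>
  force (Nat.lor (row E v) bv) fun nv =>
  force (Nat.lor (row E w) bw) fun nw =>
  (fun sv sw =>
  hforce (Nat.lor E (Nat.lor (Nat.shiftLeft bw v32) (Nat.shiftLeft bv w32))) fun E' =>
  force (Nat.lor (Nat.lor (Nat.mul sv nw) (Nat.mul sw nv))
     (Nat.lor
       (Nat.lor (Nat.shiftLeft (row T v) w32) (Nat.shiftLeft (row T w) v32))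
       (Nat.lor (Nat.shiftLeft (col COL T v) w) (Nat.shiftLeft (col COL T w) v)))) fun K =>
  hforce (Nat.lor T (Nat.lor (Nat.lor (Nat.shiftLeft sv w) (Nat.shiftLeft nv w32)) (Nat.lor (Nat.shiftLeft sw v) (Nat.shiftLeft nw v32)))) fun T' =>
  hforce (Nat.lor (clear P K) E') fun P' => k E' P' T') (Nat.lor (col COL E v) (Nat.shiftLeft (nat_lit 1) v32)) (Nat.lor (col COL E w) (Nat.shiftLeft (nat_lit 1) w32))

/-- popcount r ≥ u -/
def popGe (u r : Nat) : Bool :=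
  Nat.rec (motive := fun _ => Nat → Bool) (fun _ => true)
    (fun _ ih r => ite' (Nat.beq r (nat_lit 0)) false (force (Nat.land r (Nat.sub r (nat_lit 1))) ih)) u r

/-- if degree of t has reached U_t, clear rest of row and column -/
def satur {α : Type} (COL UC E P t : Nat) (k : Nat → α) : α :=
  force (row E t) fun r =>
  ite' (popGe (Nat.shiftRight (row UC t) (nat_lit 29)) r)
    (force (Nat.lor (Nat.shiftLeft (Nat.xor (row P t) r) (Nat.shiftLeft t (nat_lit 5))) (Nat.shiftLeft (col COL (Nat.xor P E) t) t)) fun K =>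
      hforce (clear P K) k)
    (k P)

def cnt (COL P : Nat) (fs : List (Nat × Nat × Nat)) : Nat :=
  List.rec (motive := fun _ => Nat → Nat) (fun a => a)
    (fun f _ ih a => Prod.rec (motive := fun _ => Nat) (fun s p => Prod.rec (motive := fun _ => Nat) (fun F k =>
       force (Nat.add a (Nat.land (Nat.shiftRight (Nat.add (Nat.land (Nat.shiftRight P s) F) F) k) COL)) ih) p) f) fs (Nat.land P (nat_lit 2305843009213693951))

/-- deficit sum -/
def deficit (COL c TH : Nat) : Nat :=
  force (Nat.sub TH c) fun t =>
  Nat.mod (Nat.land t (Nat.mul (col COL t (nat_lit 5)) (nat_lit 31))) (nat_lit 4294967295)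

def check (COL c : Nat) (cs : List (Nat × Nat × Nat)) : Bool :=
  List.rec (motive := fun _ => Bool) true (fun h _ ih =>
    Prod.rec (motive := fun _ => Bool) (fun _ q => Prod.rec (motive := fun _ => Bool) (fun TH b => ite' (Nat.ble (deficit COL c TH) b) ih false) q) h) cs

/-! heuristics (no soundness needed) -/
def popl (M1 M2 M4 M6 P : Nat) : Nat :=
  (fun a => (fun b => (fun c => (fun d => Nat.land (Nat.add d (Nat.shiftRight d (nat_lit 16))) M6)
    (Nat.add c (Nat.shiftRight c (nat_lit 8))))
    (Nat.land (Nat.add b (Nat.shiftRight b (nat_lit 4))) M4))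
    (Nat.add (Nat.land a M2) (Nat.land (Nat.shiftRight a (nat_lit 2)) M2)))
    (Nat.sub P (Nat.land (Nat.shiftRight P (nat_lit 1)) M1))

def findMin (COL TAB X : Nat) : Nat :=
  Nat.rec (motive := fun _ => Nat → Nat) (fun _ => nat_lit 99)
    (fun _ ih X => (fun h =>
      ite' (Nat.beq h (nat_lit 0)) (force (Nat.add X (Nat.succ COL)) ih)
       (Nat.land (Nat.shiftRight TAB (Nat.mul (nat_lit 6) (Nat.mod (Nat.xor h (Nat.land h (Nat.sub h (nat_lit 1)))) (nat_lit 59)))) (nat_lit 63)))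
       (Nat.land (Nat.shiftRight X (nat_lit 10)) COL))
    (nat_lit 60) X

structure Heur where
  KOFF : Nat
  MX : Nat
  M1 : Nat
  M2 : Nat
  M4 : Nat
  M6 : Nat
  TAB : Nat
  prio : List Nat

def choose (COL P c O : Nat) (h : Heur) : Nat :=
  Heur.rec (motive := fun _ => Nat) (fun KOFF MX M1 M2 M4 M6 TAB prio =>
  List.rec (motive := fun _ => Nat)
    (force (Nat.sub (Nat.add KOFF (Nat.mul (Nat.land (Nat.shiftRight (Nat.add O MX) (nat_lit 31)) COL) (nat_lit 64)))
        (Nat.add (popl M1 M2 M4 M6 P) c)) fun X => findMin COL TAB X)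
    (fun v _ ih => ite' (Nat.beq (row O v) (nat_lit 0)) ih v) prio) h

def pos (b : Nat) : Nat := Nat.land (Nat.shiftRight (nat_lit 1927099591673202653400830979024622892061803801320520572166761615360) (Nat.mul (nat_lit 6) (Nat.mod b (nat_lit 37)))) (nat_lit 63)
def low (r : Nat) : Nat := pos (Nat.xor r (Nat.land r (Nat.sub r (nat_lit 1))))
def bit (r x : Nat) : Bool := Nat.beq (Nat.land (Nat.shiftRight r x) (nat_lit 1)) (nat_lit 1)

/-- delta swap -/
def dswap (m d x : Nat) : Nat :=
  (fun t => Nat.xor x (Nat.xor t (Nat.shiftLeft t d))) (Nat.land (Nat.xor x (Nat.shiftRight x d)) m)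

structure Sw where
  a : Nat
  k : Nat
  d : Nat
  m : Nat
  c : Nat
  r : Nat

def swInv (d c r M : Nat) : Bool :=
  force (dswap c d M) fun a => Nat.beq (dswap r (Nat.shiftLeft d (nat_lit 5)) a) M

/-- close R under valid swaps -/
def blocks (v E P rv : Nat) (sws : List Sw) (R : Nat) : Nat :=
  List.rec (motive := fun _ => Nat → Nat) (fun R => R)
    (fun h _ ih R => Sw.rec (motive := fun _ => Nat) (fun _ _ d m c r =>
      ite' (Nat.beq (Nat.land (Nat.xor rv (Nat.shiftRight rv d)) m) (nat_lit 0))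
        (force (Nat.shiftLeft (nat_lit 1) v) fun bv =>
         ite' (Nat.beq (dswap m d bv) bv)
          (ite' (swInv d c r E) (ite' (swInv d c r P) (force (Nat.lor R (dswap m d R)) ih) (ih R)) (ih R)) (ih R))
        (ih R)) h) sws R

/-- twins of w among candidate set r (not containing w) -/
def twins (COL E P UC w r R : Nat) : Nat :=
  Nat.rec (motive := fun _ => Nat → Nat → Nat) (fun _ R => R)
   (fun _ ih r R => ite' (Nat.beq r (nat_lit 0)) R
     (force (low r) fun x => force (Nat.land r (Nat.sub r (nat_lit 1))) fun r' =>
       ite' (Nat.beq (row P x) (row P w)) (ite' (Nat.beq (row E x) (row E w)) (ite' (Nat.beq (row UC x) (row UC w))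
        (ite' (Nat.beq (col COL P x) (col COL P w)) (ite' (Nat.beq (col COL E x) (col COL E w))
        (force (Nat.lor R (Nat.shiftLeft (nat_lit 1) x)) fun R => ih r' R) (ih r' R)) (ih r' R)) (ih r' R)) (ih r' R)) (ih r' R)))
   (nat_lit 6) r R

/-- remove v-x for x in R -/
def remV (v R Q : Nat) : Nat :=
  Nat.rec (motive := fun _ => Nat → Nat → Nat) (fun _ Q => Q)
   (fun _ ih R Q => ite' (Nat.beq R (nat_lit 0)) Q
     (force (low R) fun x => force (Nat.land R (Nat.sub R (nat_lit 1))) fun R' =>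
      ite' (bit R x) (hforce (clear Q (Nat.lor (Nat.shiftLeft (Nat.shiftLeft (nat_lit 1) x) (Nat.shiftLeft v (nat_lit 5)))
          (Nat.shiftLeft (Nat.shiftLeft (nat_lit 1) v) (Nat.shiftLeft x (nat_lit 5))))) fun Q => ih R' Q) Q))
   (nat_lit 30) R Q

def pick {α : Type} (o : Nat) (fl : List (Nat × List Sw)) (k : Nat → List Sw → α) : α :=
  List.rec (motive := fun _ => α) (k (nat_lit 0) [])
    (fun h _ ih => Prod.rec (motive := fun _ => α) (fun m s => ite' (Nat.beq (Nat.land o m) (nat_lit 0)) ih (k m s)) h) fl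

def run (COL UC NM : Nat) (H : Heur) (fs : List (Nat × Nat × Nat)) (cs : List (Nat × Nat × Nat)) (fl : List (Nat × List Sw))
   (fuel E P T c : Nat) : Bool :=
  Nat.rec (motive := fun _ => Nat → Nat → Nat → Nat → Bool) (fun _ _ _ _ => false)
    (fun _ rec E P T c =>
      force (Nat.xor P E) fun O =>
      force (choose COL P c O H) fun v =>
      ite' (Nat.ble (nat_lit 2) v) (ite' (Nat.ble v NM) (
      force (row O v) fun o =>
      pick o fl fun m sws =>
        force (Nat.land o m) fun om =>
        Nat.rec (motive := fun _ => Nat → Bool) (fun _ => false)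
          (fun _ loop Q =>
            force (Nat.land (row Q v) om) fun r =>
            ite' (Nat.beq r (nat_lit 0))
              (force (cnt COL Q fs) fun c => ite' (check COL c cs) (rec E Q T c) true)
              (force (low r) fun w =>
                ite' (bit r w)
                (ite' (addE COL v w E Q T fun E' P' T' =>
                    satur COL UC E' P' v fun P' => satur COL UC E' P' w fun P' =>
                    force (cnt COL P' fs) fun c => ite' (check COL c cs) (rec E' P' T' c) true)
                  (force (twins COL E P UC w (Nat.land r (Nat.sub r (nat_lit 1))) (Nat.shiftLeft (nat_lit 1) w)) fun R =>
                   force (blocks v E P (row P v) sws R) fun R => force (remV v R Q) loop)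
                  false) false))
          (nat_lit 7) P) false) false)
    fuel E P T c
end Eng
end
end

section
namespace Eng
open Finset

theorem force_eq {α : Type} (x : ℕ) (k : ℕ → α) : force x k = k x := rfl
theorem hforce_eq {α : Type} (x : ℕ) (k : ℕ → α) : hforce x k = k (x ^^^ (x % 2305843009213693951)) := rfl
theorem ite'_eq {α : Type} (b : Bool) (t e : α) : ite' b t e = if b = true then t else e := by
  cases b <;> rfl
theorem row_eq (M v : ℕ) : row M v = (M >>> (v <<< 5)) &&& 4294967295 := rfl
theorem col_eq (C M v : ℕ) : col C M v = (M >>> v) &&& C := rfl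
theorem clear_eq (P K : ℕ) : clear P K = P ^^^ (P &&& K) := rfl

/-- matrix entry -/
def B (M i j : ℕ) : Bool := M.testBit (32 * i + j)

theorem testBit_mask32 (j : ℕ) : Nat.testBit 4294967295 j = decide (j < 32) := by
  have : (4294967295 : ℕ) = 2 ^ 32 - 1 := by norm_num
  rw [this, Nat.testBit_two_pow_sub_one]

theorem row_bit (M v j : ℕ) : (row M v).testBit j = (B M v j && decide (j < 32)) := by
  rw [row_eq, Nat.testBit_and, testBit_mask32, Nat.testBit_shiftRight, B, Nat.shiftLeft_eq]
  congr 2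
  ring

theorem row_lt (M v : ℕ) : row M v < 2 ^ 32 := by
  rw [row_eq]
  exact lt_of_le_of_lt Nat.and_le_right (by norm_num)

theorem row_div (M v : ℕ) : row M v = M / 2 ^ (32 * v) % 2 ^ 32 := by
  rw [row_eq, Nat.shiftRight_eq_div_pow, Nat.shiftLeft_eq]
  have : (4294967295 : ℕ) = 2 ^ 32 - 1 := by norm_num
  rw [this, Nat.and_two_pow_sub_one_eq_mod]
  congr 3
  ring

theorem clear_bit (P K q : ℕ) : (clear P K).testBit q = (P.testBit q && !K.testBit q) := by
  rw [clear_eq, Nat.testBit_xor, Nat.testBit_and]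
  cases P.testBit q <;> cases K.testBit q <;> rfl

theorem clear_B (P K i j : ℕ) : B (clear P K) i j = (B P i j && !B K i j) := clear_bit _ _ _

theorem junk_B (x i j : ℕ) (hi : 2 ≤ i) : B (x ^^^ (x % 2305843009213693951)) i j = B x i j := by
  unfold B
  rw [Nat.testBit_xor]
  have h : (x % 2305843009213693951).testBit (32 * i + j) = false := by
    apply Nat.testBit_lt_two_pow
    calc x % 2305843009213693951 < 2305843009213693951 := Nat.mod_lt _ (by norm_num)
      _ ≤ 2 ^ 64 := by norm_num
      _ ≤ 2 ^ (32 * i + j) := Nat.pow_le_pow_right (by norm_num) (by omega)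
  rw [h, Bool.xor_false]

theorem lor_B (x y i j : ℕ) : B (Nat.lor x y) i j = (B x i j || B y i j) := Nat.testBit_or _ _ _
/-- column selector -/
def colOf : ℕ → ℕ
  | 0 => 0
  | k + 1 => colOf k + (if 2 ≤ k then 2 ^ (32 * k) else 0)

theorem colOf_lt (k : ℕ) : colOf k < 2 ^ (32 * k) := by
  induction k with
  | zero => simp [colOf]
  | succ k ih =>
    rw [colOf]
    have : (2:ℕ) ^ (32 * (k + 1)) = 2 ^ (32 * k) * 2 ^ 32 := by ring
    rw [this]
    have : (2:ℕ)^32 = 4294967296 := by norm_num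
    rw [this]
    split_ifs <;> omega

theorem colOf_bit (n q : ℕ) : (colOf n).testBit q = (decide (q % 32 = 0 ∧ 2 ≤ q / 32 ∧ q / 32 < n)) := by
  induction n with
  | zero => simp [colOf]
  | succ k ih =>
    rw [colOf]
    have hlt := colOf_lt k
    split_ifs with h
    · by_cases hq : q < 32 * k
      · have e : colOf k + 2 ^ (32 * k) = 2 ^ (32*k) * 1 + colOf k := by ring
        rw [e, Nat.testBit_two_pow_mul_add _ hlt, if_pos hq, ih]
        simp only [decide_eq_decide]
        omega
      · have e : colOf k + 2 ^ (32 * k) = 2 ^ (32*k) * 1 + colOf k := by ring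
        rw [e, Nat.testBit_two_pow_mul_add _ hlt, if_neg hq]
        rw [Bool.eq_iff_iff]
        simp only [Nat.testBit_one_eq_true_iff_self_eq_zero, decide_eq_true_eq]
        omega
    · rw [add_zero, ih]
      simp only [decide_eq_decide]
      omega
end Eng
end

section
namespace Eng
open Finset

theorem junk_B' (x i j : ℕ) (hi : 2 ≤ i) : B (Nat.xor x (Nat.mod x (nat_lit 2305843009213693951))) i j = B x i j :=
  junk_B x i j hi

theorem shl_bit (x s q : ℕ) : (Nat.shiftLeft x s).testBit q = (decide (s ≤ q) && x.testBit (q - s)) :=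
  Nat.testBit_shiftLeft x

theorem shl5 (v : ℕ) : Nat.shiftLeft v (nat_lit 5) = 32 * v := by
  have : Nat.shiftLeft v (nat_lit 5) = v <<< 5 := rfl
  rw [this, Nat.shiftLeft_eq]; ring

theorem one_bit (v j : ℕ) : (Nat.shiftLeft (nat_lit 1) v).testBit j = decide (j = v) := by
  have : Nat.shiftLeft (nat_lit 1) v = 2 ^ v := by
    have : Nat.shiftLeft (nat_lit 1) v = 1 <<< v := rfl
    rw [this, Nat.one_shiftLeft]
  rw [this, Nat.testBit_two_pow]
  simp only [decide_eq_decide]; exact eq_comm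

theorem one_lt {v : ℕ} (h : v < 32) : Nat.shiftLeft (nat_lit 1) v < 2 ^ 32 := by
  have : Nat.shiftLeft (nat_lit 1) v = 2 ^ v := by
    have : Nat.shiftLeft (nat_lit 1) v = 1 <<< v := rfl
    rw [this, Nat.one_shiftLeft]
  rw [this]
  exact Nat.pow_lt_pow_right (by norm_num) h

theorem lane_B {x w i j : ℕ} (hx : x < 2 ^ 32) (hj : j < 32) :
    B (Nat.shiftLeft x (32 * w)) i j = (decide (i = w) && x.testBit j) := by
  rw [B, shl_bit]
  by_cases h : i = w
  · subst h; simp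
  · rw [decide_eq_false h, Bool.false_and]
    by_cases h2 : 32 * w ≤ 32 * i + j
    · have : x.testBit (32 * i + j - 32 * w) = false := by
        apply Nat.testBit_lt_two_pow
        refine lt_of_lt_of_le hx (Nat.pow_le_pow_right (by norm_num) ?_)
        omega
      rw [this, Bool.and_false]
    · rw [decide_eq_false h2, Bool.false_and]

theorem col_bit (n M v q : ℕ) : (col (colOf n) M v).testBit q =
    (M.testBit (q + v) && decide (q % 32 = 0 ∧ 2 ≤ q / 32 ∧ q / 32 < n)) := by
  rw [col_eq, Nat.testBit_and, colOf_bit, Nat.testBit_shiftRight, add_comm]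

def Lan (s : ℕ) : Prop := ∀ q, s.testBit q = true → q % 32 = 0

theorem Lan_col (n M v : ℕ) : Lan (col (colOf n) M v) := by
  intro q h
  rw [col_bit, Bool.and_eq_true, decide_eq_true_eq] at h
  exact h.2.1

theorem Lan_colOf (n : ℕ) : Lan (colOf n) := by
  intro q h
  rw [colOf_bit, decide_eq_true_eq] at h
  exact h.1

theorem Lan_one (v : ℕ) : Lan (Nat.shiftLeft (nat_lit 1) (32 * v)) := by
  intro q h
  rw [one_bit, decide_eq_true_eq] at h
  omega

theorem Lan_lor {a b : ℕ} (ha : Lan a) (hb : Lan b) : Lan (Nat.lor a b) := by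
  intro q h
  have : (Nat.lor a b).testBit q = (a.testBit q || b.testBit q) := Nat.testBit_or _ _ _
  rw [this, Bool.or_eq_true] at h
  exact h.elim (ha q) (hb q)

theorem lan_shift_B {s w i j : ℕ} (hs : Lan s) (hw : w < 32) (hj : j < 32) :
    B (Nat.shiftLeft s w) i j = (decide (j = w) && s.testBit (32 * i)) := by
  rw [B, shl_bit]
  by_cases h : j = w
  · subst h; simp
  · rw [decide_eq_false h, Bool.false_and]
    by_cases h2 : w ≤ 32 * i + j
    · have : s.testBit (32 * i + j - w) = false := by
        by_contra hc
        have := hs _ (by simpa using hc)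
        omega
      rw [this, Bool.and_false]
    · rw [decide_eq_false h2, Bool.false_and]

theorem mul_B {s r : ℕ} (hs : Lan s) (hr : r < 2 ^ 32) {j : ℕ} (hj : j < 32) (i : ℕ) :
    B (Nat.mul s r) i j = (s.testBit (32 * i) && r.testBit j) := by
  induction i generalizing s with
  | zero =>
    have h1 : s % 2 ^ 32 = (s.testBit 0).toNat := by
      apply Nat.eq_of_testBit_eq
      intro q
      rw [Nat.testBit_mod_two_pow, Nat.testBit_bool_toNat]
      by_cases h0 : q = 0
      · subst h0; simp
      · rw [decide_eq_false h0, Bool.false_and]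
        by_cases hq : q < 32
        · have : s.testBit q = false := by
            by_contra hc
            have := hs q (by simpa using hc)
            omega
          rw [this]; simp
        · simp [hq]
    have h2 : s * r = 2 ^ 32 * (s / 2 ^ 32 * r) + (s.testBit 0).toNat * r := by
      conv_lhs => rw [← Nat.div_add_mod s (2 ^ 32), h1]
      ring
    have hm : Nat.mul s r = s * r := rfl
    rw [B, hm, h2, Nat.testBit_two_pow_mul_add _ (by cases s.testBit 0 <;> simp <;> omega), if_pos (by omega)]
    cases h : s.testBit 0 <;> simp [h]
  | succ i ih =>
    have h1 : s % 2 ^ 32 ≤ 1 := by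
      have : s % 2 ^ 32 = (s.testBit 0).toNat := by
        apply Nat.eq_of_testBit_eq
        intro q
        rw [Nat.testBit_mod_two_pow, Nat.testBit_bool_toNat]
        by_cases h0 : q = 0
        · subst h0; simp
        · rw [decide_eq_false h0, Bool.false_and]
          by_cases hq : q < 32
          · have : s.testBit q = false := by
              by_contra hc
              have := hs q (by simpa using hc)
              omega
            rw [this]; simp
          · simp [hq]
      rw [this]; exact Bool.toNat_le _
    have h2 : s * r = 2 ^ 32 * (s / 2 ^ 32 * r) + (s % 2 ^ 32) * r := by
      conv_lhs => rw [← Nat.div_add_mod s (2 ^ 32)]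
      ring
    have hm : Nat.mul s r = s * r := rfl
    have hl : Lan (s / 2 ^ 32) := by
      intro q hq
      rw [Nat.testBit_div_two_pow] at hq
      have := hs _ hq
      omega
    have h3 : (s % 2 ^ 32) * r < 2 ^ 32 := lt_of_le_of_lt (by nlinarith) hr
    have := ih hl
    rw [B] at this ⊢
    rw [hm, h2, Nat.testBit_two_pow_mul_add _ h3, if_neg (by omega)]
    have e : 32 * (i + 1) + j - 32 = 32 * i + j := by omega
    rw [e]
    have h4 : Nat.mul (s / 2 ^ 32) r = s / 2 ^ 32 * r := rfl
    rw [← h4, this, Nat.testBit_div_two_pow]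
    congr 2
    

theorem addE_spec {α : Type} {n v w : ℕ} (E P T : ℕ) (hv : 2 ≤ v) (hvn : v < n) (hw : 2 ≤ w) (hwn : w < n) (hn : n ≤ 26)
    (k : ℕ → ℕ → ℕ → α) :
    ∃ E' P' T', addE (colOf n) v w E P T k = k E' P' T' ∧
      (∀ i j, 2 ≤ i → j < 32 → (B E' i j = true ↔ (B E i j = true ∨ (i = v ∧ j = w) ∨ (i = w ∧ j = v)))) ∧
      (∀ i j, 2 ≤ i → i < n → j < 32 → (B P' i j = true ↔ (B E' i j = true ∨ (B P i j = true ∧ ¬ (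
          ((B E i v = true ∨ i = v) ∧ (B E w j = true ∨ j = w)) ∨
          ((B E i w = true ∨ i = w) ∧ (B E v j = true ∨ j = v)) ∨
          (i = w ∧ B T v j = true) ∨ (i = v ∧ B T w j = true) ∨
          (j = w ∧ B T i v = true) ∨ (j = v ∧ B T i w = true)))))) ∧
      (∀ i j, 2 ≤ i → i < n → j < 32 → (B T' i j = true ↔ (B T i j = true ∨
          (j = w ∧ (B E i v = true ∨ i = v)) ∨ (i = w ∧ (B E v j = true ∨ j = v)) ∨
          (j = v ∧ (B E i w = true ∨ i = w)) ∨ (i = v ∧ (B E w j = true ∨ j = w))))) := by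
  have hv32 : v < 32 := by omega
  have hw32 : w < 32 := by omega
  have lor_lt : ∀ {a b : ℕ}, a < 2 ^ 32 → b < 2 ^ 32 → Nat.lor a b < 2 ^ 32 := fun ha hb => Nat.or_lt_two_pow ha hb
  have lorb : ∀ a b q : ℕ, (Nat.lor a b).testBit q = (a.testBit q || b.testBit q) := fun a b q => Nat.testBit_or _ _ _
  refine ⟨_, _, _, rfl, ?_, ?_, ?_⟩
  · intro i j hi hj
    rw [junk_B' _ _ _ hi, shl5, shl5, lor_B, lor_B, lane_B (one_lt hw32) hj, lane_B (one_lt hv32) hj, one_bit, one_bit]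
    simp only [Bool.or_eq_true, Bool.and_eq_true, decide_eq_true_eq]
  · intro i j hi hin hj
    rw [junk_B' _ _ _ hi, lor_B, clear_B]
    simp only [shl5]
    rw [lor_B, lor_B, lor_B, lor_B, lor_B]
    have L1 : Lan (Nat.lor (col (colOf n) E v) (Nat.shiftLeft (nat_lit 1) (32 * v))) := Lan_lor (Lan_col _ _ _) (Lan_one _)
    have L2 : Lan (Nat.lor (col (colOf n) E w) (Nat.shiftLeft (nat_lit 1) (32 * w))) := Lan_lor (Lan_col _ _ _) (Lan_one _)
    rw [mul_B L1 (lor_lt (row_lt _ _) (one_lt hw32)) hj, mul_B L2 (lor_lt (row_lt _ _) (one_lt hv32)) hj,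
      lane_B (row_lt _ _) hj, lane_B (row_lt _ _) hj, lan_shift_B (Lan_col _ _ _) hw32 hj, lan_shift_B (Lan_col _ _ _) hv32 hj]
    simp only [lorb, col_bit, one_bit, row_bit]
    have e1 : 32 * i % 32 = 0 := by omega
    have e2 : 32 * i / 32 = i := by omega
    have e3 : ∀ t, (32 * i = 32 * t) = (i = t) := fun t => by simp
    simp only [e1, e2, e3, hi, hin, hj, decide_true, Bool.and_true, true_and, and_self]
    change (_ || _) = true ↔ _
    simp only [Bool.or_eq_true, Bool.and_eq_true, decide_eq_true_eq, Bool.not_eq_true', Bool.or_eq_false_iff, ← Bool.not_eq_true, B, or_assoc]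
    exact or_comm
  · intro i j hi hin hj
    rw [junk_B' _ _ _ hi, shl5, shl5, lor_B, lor_B, lor_B, lor_B]
    have L1 : Lan (Nat.lor (col (colOf n) E v) (Nat.shiftLeft (nat_lit 1) (32 * v))) := Lan_lor (Lan_col _ _ _) (Lan_one _)
    have L2 : Lan (Nat.lor (col (colOf n) E w) (Nat.shiftLeft (nat_lit 1) (32 * w))) := Lan_lor (Lan_col _ _ _) (Lan_one _)
    rw [lan_shift_B L1 hw32 hj, lan_shift_B L2 hv32 hj, lane_B (lor_lt (row_lt _ _) (one_lt hv32)) hj, lane_B (lor_lt (row_lt _ _) (one_lt hw32)) hj]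
    simp only [lorb, col_bit, one_bit, row_bit]
    have e1 : 32 * i % 32 = 0 := by omega
    have e2 : 32 * i / 32 = i := by omega
    have e3 : ∀ t, (32 * i = 32 * t) = (i = t) := fun t => by simp
    simp only [e1, e2, e3, hi, hin, hj, decide_true, Bool.and_true, true_and, and_self]
    simp only [Bool.or_eq_true, Bool.and_eq_true, decide_eq_true_eq, B]
    tauto

theorem satur_spec {α : Type} {n t : ℕ} (UC E P : ℕ) (ht : 2 ≤ t) (htn : t < n) (hn : n ≤ 26) (k : ℕ → α) :
    ∃ P', satur (colOf n) UC E P t k = k P' ∧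
     (∀ i j, 2 ≤ i → B P' i j = true → B P i j = true) ∧
     (∀ i j, 2 ≤ i → i < n → j < 32 → B P i j = true → B P' i j = false → 
       popGe (row UC t >>> 29) (row E t) = true ∧ B E i j = false ∧ (i = t ∨ j = t)) := by
  have ht32 : t < 32 := by omega
  unfold satur
  rw [force_eq, ite'_eq]
  split_ifs with h
  · refine ⟨_, rfl, ?_, ?_⟩
    · intro i j hi h
      rw [junk_B' _ _ _ hi, clear_B, Bool.and_eq_true] at h
      exact h.1
    · intro i j hi hin hj h1 h2
      refine ⟨h, ?_⟩
      have hx : Nat.xor (row P t) (row E t) < 2 ^ 32 := Nat.xor_lt_two_pow (row_lt _ _) (row_lt _ _)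
      have xorb : ∀ a b q : ℕ, (Nat.xor a b).testBit q = (a.testBit q ^^ b.testBit q) := fun a b q => Nat.testBit_xor _ _ _
      rw [junk_B' _ _ _ hi, clear_B, h1, lor_B, shl5, lane_B hx hj, lan_shift_B (Lan_col _ _ _) ht32 hj, col_bit] at h2
      simp only [xorb, row_bit] at h2
      have e1 : 32 * i % 32 = 0 := by omega
      have e2 : 32 * i / 32 = i := by omega
      simp only [e1, e2, hi, hin, hj, decide_true, Bool.and_true, true_and, and_self] at h2
      by_cases c1 : i = t
      · subst c1
        rw [h1] at h2
        by_cases c2 : j = i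
        · subst c2; unfold B at *
          simp [h1] at h2; exact ⟨h2, Or.inl rfl⟩
        · simp [c2] at h2; exact ⟨h2, Or.inl rfl⟩
      · by_cases c2 : j = t
        · subst c2; unfold B at *
          simp [c1, h1] at h2; exact ⟨h2, Or.inr rfl⟩
        · simp [c1, c2] at h2
  · exact ⟨P, rfl, fun _ _ _ h => h, fun i j _ _ _ h1 h2 => by simp [h1] at h2⟩

end Eng
end

section
namespace Eng
open Finset

theorem popGe_spec (u r : ℕ) (h : popGe u r = true) : u ≤ ((range 32).filter fun j => r.testBit j = true).card ∨ 2 ^ 32 ≤ r := by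
  induction u generalizing r with
  | zero => left; exact Nat.zero_le _
  | succ u ih =>
    have e : popGe (u + 1) r = ite' (Nat.beq r 0) false (popGe u (r &&& (r - 1))) := rfl
    rw [e, ite'_eq] at h
    split_ifs at h with h0
    by_cases hr : 2 ^ 32 ≤ r
    · exact Or.inr hr
    left
    have hr0 : r ≠ 0 := by
      rintro rfl
      exact h0 rfl
    have hle : r &&& (r - 1) ≤ r - 1 := Nat.and_le_right
    rcases ih _ h with h1 | h1
    · refine lt_of_le_of_lt h1 (card_lt_card ?_)
      rw [Finset.ssubset_iff_of_subset]
      · have hne : r &&& (r - 1) ≠ r := by omega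
        by_contra hc
        push Not at hc
        apply hne
        apply Nat.eq_of_testBit_eq
        intro q
        rw [Nat.testBit_and]
        by_cases hq : r.testBit q = true
        · have hq32 : q < 32 := by
            by_contra hge
            have := Nat.testBit_lt_two_pow (x := r) (i := q) (lt_of_lt_of_le (by omega : r < 2 ^ 32) (Nat.pow_le_pow_right (by norm_num) (by omega)))
            rw [this] at hq; exact absurd hq (by simp)
          have := hc q (by simp [hq, hq32])
          simp only [mem_filter, mem_range, Nat.testBit_and, Bool.and_eq_true] at this
          rw [hq, this.2.2]; rfl
        · rw [Bool.not_eq_true] at hq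
          rw [hq]; rfl
      · intro q
        simp only [mem_filter, mem_range, Nat.testBit_and, Bool.and_eq_true]
        tauto
    · omega

theorem div_lane (a i : ℕ) : a / 2 ^ (32 * (i + 1)) = a / 2 ^ (32 * i) / 2 ^ 32 := by
  rw [Nat.div_div_eq_div_mul, ← pow_add]; congr 2

theorem add_div_lane (a b : ℕ) (h : ∀ i, row a i + row b i < 2 ^ 32) (i : ℕ) :
    (a + b) / 2 ^ (32 * i) = a / 2 ^ (32 * i) + b / 2 ^ (32 * i) := by
  induction i with
  | zero => simp
  | succ i ih =>
    rw [div_lane, div_lane, div_lane, ih]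
    have := h i
    rw [row_div, row_div] at this
    have e : (2:ℕ) ^ 32 = 4294967296 := by norm_num
    rw [e] at *
    omega

theorem add_lane (a b : ℕ) (h : ∀ i, row a i + row b i < 2 ^ 32) (i : ℕ) :
    row (a + b) i = row a i + row b i := by
  have h1 := h i
  rw [row_div, row_div] at h1
  rw [row_div, row_div, row_div, add_div_lane a b h]
  have e : (2:ℕ) ^ 32 = 4294967296 := by norm_num
  rw [e] at *
  omega

theorem sub_div_lane (a b : ℕ) (h : ∀ i, row b i ≤ row a i) (i : ℕ) :
    (a - b) / 2 ^ (32 * i) = a / 2 ^ (32 * i) - b / 2 ^ (32 * i) := by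
  induction i with
  | zero => simp
  | succ i ih =>
    rw [div_lane, div_lane, div_lane, ih]
    have := h i
    rw [row_div, row_div] at this
    have e : (2:ℕ) ^ 32 = 4294967296 := by norm_num
    rw [e] at *
    omega

theorem le_of_lanes (a b : ℕ) (n : ℕ) (hb : b < 2 ^ (32 * n)) (h : ∀ i, row b i ≤ row a i) : b ≤ a := by
  induction n generalizing a b with
  | zero => simp at hb; omega
  | succ n ih =>
    have e : (2:ℕ) ^ 32 = 4294967296 := by norm_num
    have h0 := h 0
    rw [row_div, row_div] at h0
    have hb' : b / 2 ^ 32 < 2 ^ (32 * n) := by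
      rw [Nat.div_lt_iff_lt_mul (by norm_num)]
      calc b < _ := hb
        _ = _ := by ring
    have := ih (a / 2 ^ 32) (b / 2 ^ 32) hb' (by
      intro i
      have := h (i + 1)
      rw [row_div, row_div] at this ⊢
      rw [Nat.div_div_eq_div_mul, Nat.div_div_eq_div_mul, ← pow_add]
      have e2 : 32 + 32 * i = 32 * (i + 1) := by ring
      rw [e2]; exact this)
    simp only [mul_zero, pow_zero, Nat.div_one] at h0
    rw [e] at *
    omega

theorem sub_lane (a b n : ℕ) (hb : b < 2 ^ (32 * n)) (h : ∀ i, row b i ≤ row a i) (i : ℕ) :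
    row (a - b) i = row a i - row b i := by
  have h1 := h i
  have hle : b / 2 ^ (32 * i) ≤ a / 2 ^ (32 * i) := Nat.div_le_div_right (le_of_lanes a b n hb h)
  rw [row_div, row_div] at h1
  rw [row_div, row_div, row_div, sub_div_lane a b h]
  have e : (2:ℕ) ^ 32 = 4294967296 := by norm_num
  rw [e] at *
  omega

theorem mod_le_sum (x n : ℕ) (hx : x < 2 ^ (32 * n)) : x % 4294967295 ≤ ∑ i ∈ range n, row x i := by
  induction n generalizing x with
  | zero => simp at hx; subst hx; simp
  | succ n ih =>
    rw [Finset.sum_range_succ']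
    have hx' : x / 2 ^ 32 < 2 ^ (32 * n) := by
      rw [Nat.div_lt_iff_lt_mul (by norm_num)]
      calc x < _ := hx
        _ = _ := by ring
    have h1 := ih (x / 2 ^ 32) hx'
    have h2 : ∀ i, row (x / 2 ^ 32) i = row x (i + 1) := by
      intro i
      rw [row_div, row_div, Nat.div_div_eq_div_mul, ← pow_add]
      have e2 : 32 + 32 * i = 32 * (i + 1) := by ring
      rw [e2]
    simp only [h2] at h1
    have h3 : row x 0 = x % 2 ^ 32 := by rw [row_div]; simp
    rw [h3]
    have e : (2:ℕ) ^ 32 = 4294967296 := by norm_num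
    rw [e] at *
    omega

theorem row_eq_of_bits (M i y : ℕ) (hy : y < 2 ^ 32) (h : ∀ j < 32, B M i j = y.testBit j) : row M i = y := by
  apply Nat.eq_of_testBit_eq
  intro j
  rw [row_bit]
  by_cases hj : j < 32
  · simp [hj, h j hj]
  · simp only [hj, decide_false, Bool.and_false]
    symm
    exact Nat.testBit_lt_two_pow (lt_of_lt_of_le hy (Nat.pow_le_pow_right (by norm_num) (by omega)))

theorem row_zero_of (M i : ℕ) (h : ∀ j < 32, B M i j = false) : row M i = 0 :=
  row_eq_of_bits M i 0 (by norm_num) (fun j hj => by rw [h j hj]; simp)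

/-- field occupied -/
def occ (P s k i : ℕ) : Prop := ∃ j, s ≤ j ∧ j < s + k ∧ B P i j = true

open Classical in
theorem fld_row {n P s k : ℕ} (hn : n ≤ 26) (hs : s + k ≤ n) (i : ℕ) :
    row (Nat.land (Nat.shiftRight (Nat.add (Nat.land (Nat.shiftRight P s) (colOf n * (2 ^ k - 1))) (colOf n * (2 ^ k - 1))) k) (colOf n)) i
      = if 2 ≤ i ∧ i < n ∧ occ P s k i then 1 else 0 := by
  set F := colOf n * (2 ^ k - 1) with hF
  have hk : (2:ℕ) ^ k ≤ 2 ^ 26 := Nat.pow_le_pow_right (by norm_num) (by omega)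
  have hk1 : (1:ℕ) ≤ 2 ^ k := Nat.one_le_two_pow
  have hklt : (2:ℕ) ^ k - 1 < 2 ^ 32 := by
    have : (2:ℕ)^26 < 2^32 := by norm_num
    omega
  have hFB : ∀ i j, j < 32 → B F i j = (decide (2 ≤ i ∧ i < n) && decide (j < k)) := by
    intro i j hj
    have := mul_B (s := colOf n) (Lan_colOf n) hklt hj i
    rw [show F = Nat.mul (colOf n) (2 ^ k - 1) from rfl, this, colOf_bit, Nat.testBit_two_pow_sub_one]
    congr 1
    simp only [decide_eq_decide]
    omega
  have hFr : ∀ i, row F i = if 2 ≤ i ∧ i < n then 2 ^ k - 1 else 0 := by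
    intro i
    apply row_eq_of_bits
    · split_ifs <;> omega
    · intro j hj
      rw [hFB i j hj]
      split_ifs with h
      · simp [h]
      · simp [h]
  set A := Nat.land (Nat.shiftRight P s) F with hA
  have hAB : ∀ i j, j < 32 → B A i j = (P.testBit (s + (32 * i + j)) && (decide (2 ≤ i ∧ i < n) && decide (j < k))) := by
    intro i j hj
    rw [← hFB i j hj]
    have e : A = (P >>> s) &&& F := rfl
    rw [B, e, Nat.testBit_and, Nat.testBit_shiftRight]; rfl
  have hAr : ∀ i, row A i ≤ row F i := by
    intro i
    have : row A i = row A i &&& row F i := by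
      apply Nat.eq_of_testBit_eq
      intro j
      rw [Nat.testBit_and, row_bit, row_bit]
      by_cases hj : j < 32
      · rw [hAB i j hj, hFB i j hj]
        cases P.testBit (s + (32 * i + j)) <;> cases decide (2 ≤ i ∧ i < n) <;> cases decide (j < k) <;> simp
      · simp [hj]
    rw [this]; exact Nat.and_le_right
  have hsum : ∀ i, row (A + F) i = row A i + row F i := by
    apply add_lane
    intro i
    have := hAr i
    have h2 := hFr i
    have : row F i ≤ 2 ^ 26 := by rw [h2]; split_ifs <;> omega
    have : (2:ℕ)^26 + 2^26 < 2^32 := by norm_num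
    omega
  apply row_eq_of_bits
  · split_ifs <;> norm_num
  intro j hj
  have e : Nat.land (Nat.shiftRight (Nat.add A F) k) (colOf n) = ((A + F) >>> k) &&& colOf n := rfl
  rw [e, B, Nat.testBit_and, Nat.testBit_shiftRight, colOf_bit]
  by_cases hj0 : j = 0
  · subst hj0
    by_cases hin : 2 ≤ i ∧ i < n
    · have e1 : decide ((32 * i + 0) % 32 = 0 ∧ 2 ≤ (32 * i + 0) / 32 ∧ (32 * i + 0) / 32 < n) = true := by
        simp only [decide_eq_true_eq]; omega
      rw [e1, Bool.and_true]
      have e2 : (A + F).testBit (k + (32 * i + 0)) = (row (A + F) i).testBit k := by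
        rw [row_bit, B]
        have : k < 32 := by omega
        simp [this, add_comm]
      rw [e2, hsum, hFr, if_pos hin]
      by_cases ho : occ P s k i
      · rw [if_pos ⟨hin.1, hin.2, ho⟩]
        obtain ⟨j, h1, h2, h3⟩ := ho
        have hpos : 1 ≤ row A i := by
          by_contra hc
          have h0 : row A i = 0 := by omega
          have := row_bit A i (j - s)
          rw [h0, hAB i (j - s) (by omega)] at this
          have e3 : s + (32 * i + (j - s)) = 32 * i + j := by omega
          rw [e3] at this
          have h3' : P.testBit (32 * i + j) = true := h3
          have hj1 : j - s < k := by omega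
          have hj2 : j - s < 32 := by omega
          simp [h3', hin, hj1, hj2] at this
        have hle := hAr i
        rw [hFr, if_pos hin] at hle
        have e4 : row A i + (2 ^ k - 1) = 2 ^ k * 1 + (row A i - 1) := by omega
        rw [e4, Nat.testBit_two_pow_mul_add _ (by omega), if_neg (by omega)]
        simp
      · rw [if_neg (by tauto)]
        have h0 : row A i = 0 := by
          apply row_zero_of
          intro j hj
          rw [hAB i j hj]
          by_contra hc
          simp only [Bool.not_eq_false, Bool.and_eq_true, decide_eq_true_eq] at hc
          apply ho
          refine ⟨s + j, by omega, by omega, ?_⟩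
          rw [B, ← hc.1]; congr 1; omega
        rw [h0, zero_add]
        rw [Nat.testBit_two_pow_sub_one]
        simp
    · have e1 : decide ((32 * i + 0) % 32 = 0 ∧ 2 ≤ (32 * i + 0) / 32 ∧ (32 * i + 0) / 32 < n) = false := by
        simp only [decide_eq_false_iff_not]; omega
      rw [e1, Bool.and_false, if_neg (by tauto)]; simp
  · have e1 : decide ((32 * i + j) % 32 = 0 ∧ 2 ≤ (32 * i + j) / 32 ∧ (32 * i + j) / 32 < n) = false := by
      simp only [decide_eq_false_iff_not]; omega
    rw [e1, Bool.and_false]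
    split_ifs
    · rw [eq_comm, Bool.eq_false_iff]; intro h; exact hj0 (Nat.testBit_one_eq_true_iff_self_eq_zero.1 h)
    · simp

/-- well-formed field list -/
def wfFs (n : ℕ) (fs : List (ℕ × ℕ × ℕ)) : Prop :=
  fs.length ≤ 26 ∧ ∀ f ∈ fs, f.2.1 = colOf n * (2 ^ f.2.2 - 1) ∧ f.1 + f.2.2 ≤ n

def cntA (COL P : Nat) (fs : List (Nat × Nat × Nat)) : Nat → Nat :=
  List.rec (motive := fun _ => Nat → Nat) (fun a => a)
    (fun f _ ih a => Prod.rec (motive := fun _ => Nat) (fun s p => Prod.rec (motive := fun _ => Nat) (fun F k =>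
       force (Nat.add a (Nat.land (Nat.shiftRight (Nat.add (Nat.land (Nat.shiftRight P s) F) F) k) COL)) ih) p) f) fs

open Classical in
theorem cntA_spec {n P : ℕ} (hn : n ≤ 26) (fs : List (ℕ × ℕ × ℕ)) 
    (h : ∀ f ∈ fs, f.2.1 = colOf n * (2 ^ f.2.2 - 1) ∧ f.1 + f.2.2 ≤ n) (a : ℕ) 
    (ha : ∀ i, 2 ≤ i → row a i + fs.length < 2 ^ 32) (i : ℕ) :
    row (cntA (colOf n) P fs a) i = row a i + if 2 ≤ i ∧ i < n then fs.countP (fun f => decide (occ P f.1 f.2.2 i)) else 0 := by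
  induction fs generalizing a with
  | nil => simp [cntA]
  | cons f fs ih =>
    obtain ⟨s, F, k⟩ := f
    have hf := h (s, F, k) (by simp)
    simp only at hf
    obtain ⟨rfl, hs⟩ := hf
    have e : cntA (colOf n) P ((s, colOf n * (2 ^ k - 1), k) :: fs) a = cntA (colOf n) P fs (a + 
       (Nat.land (Nat.shiftRight (Nat.add (Nat.land (Nat.shiftRight P s) (colOf n * (2 ^ k - 1))) (colOf n * (2 ^ k - 1))) k) (colOf n))) := rfl
    have hadd := add_lane a (Nat.land (Nat.shiftRight (Nat.add (Nat.land (Nat.shiftRight P s) (colOf n * (2 ^ k - 1))) (colOf n * (2 ^ k - 1))) k) (colOf n))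
      (by
        intro i
        rw [fld_row hn hs i]
        by_cases hi : 2 ≤ i
        · have := ha i hi
          rw [List.length_cons] at this
          split_ifs <;> omega
        · rw [if_neg (by tauto)]
          exact row_lt _ _)
    rw [e, ih (fun f hf => h f (by simp [hf])) _ (by
      intro i hi
      rw [hadd, fld_row hn hs]
      have := ha i hi
      rw [List.length_cons] at this
      split_ifs <;> omega), hadd, fld_row hn hs, List.countP_cons]
    by_cases hi : 2 ≤ i ∧ i < n
    · rw [if_pos hi, if_pos hi]
      by_cases ho : occ P s k i
      · rw [if_pos ⟨hi.1, hi.2, ho⟩, if_pos (by simpa using ho)]; ring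
      · rw [if_neg (by tauto), if_neg (by simpa using ho)]; simp
    · rw [if_neg hi, if_neg hi, if_neg (by tauto)]

theorem junk_row (P i : ℕ) (hi : 2 ≤ i) : row (Nat.land P (nat_lit 2305843009213693951)) i = 0 := by
  apply row_zero_of
  intro j hj
  apply Nat.testBit_lt_two_pow
  have : Nat.land P (nat_lit 2305843009213693951) ≤ 2305843009213693951 := Nat.and_le_right
  calc _ ≤ 2305843009213693951 := this
    _ < 2 ^ 64 := by norm_num
    _ ≤ 2 ^ (32 * i + j) := Nat.pow_le_pow_right (by norm_num) (by omega)

open Classical in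
theorem cnt_spec {n P : ℕ} (hn : n ≤ 26) {fs : List (ℕ × ℕ × ℕ)} (h : wfFs n fs) (i : ℕ) (hi : 2 ≤ i) :
    row (cnt (colOf n) P fs) i = if i < n then fs.countP (fun f => decide (occ P f.1 f.2.2 i)) else 0 := by
  have e : cnt (colOf n) P fs = cntA (colOf n) P fs (Nat.land P (nat_lit 2305843009213693951)) := rfl
  rw [e, cntA_spec hn fs h.2 _ (by
    intro i hi
    rw [junk_row P i hi]
    have := h.1
    have : (26:ℕ) < 2^32 := by norm_num
    omega), junk_row P i hi]
  simp [hi]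

theorem deficit_spec {n c TH : ℕ} (hn : n ≤ 26) (hc : ∀ i, 2 ≤ i → row c i ≤ 26) (hcn : ∀ i, n ≤ i → row c i = 0) (hc2 : c < 2 ^ (32 * 26))
    (hT0 : row TH 0 = 4294967295) (hT1 : row TH 1 = 4294967295) (hT : ∀ i, 2 ≤ i → i < n → 32 ≤ row TH i ∧ row TH i < 64) (hn2 : 2 ≤ n) :
    deficit (colOf n) c TH ≤ ∑ i ∈ Ico 2 n, ((row TH i - 32) - row c i) := by
  have e : deficit (colOf n) c TH = Nat.land (TH - c) (Nat.mul (col (colOf n) (TH - c) 5) 31) % 4294967295 := rfl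
  rw [e]
  have hle : ∀ i, row c i ≤ row TH i := by
    intro i
    by_cases h : 2 ≤ i
    · by_cases h2 : i < n
      · have := hc i h
        have := hT i h h2
        omega
      · rw [hcn i (by omega)]; exact Nat.zero_le _
    · have : i = 0 ∨ i = 1 := by omega
      have h3 := row_lt c i
      rcases this with rfl | rfl
      · rw [hT0]; omega
      · rw [hT1]; omega
  have ht : ∀ i, row (TH - c) i = row TH i - row c i := sub_lane TH c 26 hc2 hle
  set t := TH - c with htd
  set X := Nat.land t (Nat.mul (col (colOf n) t 5) 31) with hX
  have hXb : ∀ i j, j < 32 → B X i j = (B t i j && ((B t i 5 && decide (2 ≤ i ∧ i < n)) && decide (j < 5))) := by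
    intro i j hj
    have e : X = t &&& (Nat.mul (col (colOf n) t 5) 31) := rfl
    have h := mul_B (Lan_col n t 5) (r := 31) (by norm_num) hj i
    rw [B] at h
    rw [B, e, Nat.testBit_and, h, col_bit]
    have e31 : Nat.testBit 31 j = decide (j < 5) := by
      rw [show (31:ℕ) = 2 ^ 5 - 1 by norm_num, Nat.testBit_two_pow_sub_one]
    rw [e31]
    have e5 : decide (32 * i % 32 = 0 ∧ 2 ≤ 32 * i / 32 ∧ 32 * i / 32 < n) = decide (2 ≤ i ∧ i < n) := by
      simp only [decide_eq_decide]; omega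
    rw [e5]; rfl
  have hXlt : X < 2 ^ (32 * n) := by
    apply Nat.lt_pow_two_of_testBit
    intro q hq
    have := hXb (q / 32) (q % 32) (Nat.mod_lt _ (by norm_num))
    rw [B, Nat.div_add_mod] at this
    have h2 : ¬ (q / 32 < n) := by omega
    rw [this]; simp [h2]
  refine le_trans (mod_le_sum X n hXlt) ?_
  have hrow : ∀ i, row X i = if 2 ≤ i ∧ i < n then (row TH i - 32) - row c i else 0 := by
    intro i
    split_ifs with hi
    · have h1 := hT i hi.1 hi.2
      have h2 := ht i
      have h5 : B t i 5 = (row t i).testBit 5 := by rw [row_bit]; simp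
      by_cases h6 : 32 ≤ row t i
      · have h7 : row t i = 2 ^ 5 * 1 + (row t i - 32) := by omega
        have h8 : (row t i).testBit 5 = true := by
          rw [h7, Nat.testBit_two_pow_mul_add _ (by omega), if_neg (by omega)]; rfl
        apply row_eq_of_bits
        · omega
        · intro j hj
          rw [hXb i j hj, h5, h8]
          have h9 : B t i j = (row t i).testBit j := by rw [row_bit]; simp [hj]
          rw [h9, h7, Nat.testBit_two_pow_mul_add _ (by omega)]
          have h10 : row TH i - 32 - row c i = row t i - 32 := by omega
          rw [h10]
          by_cases hj5 : j < 5
          · simp [hj5, hi]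
          · simp only [hj5, decide_false, Bool.and_false]
            symm
            apply Nat.testBit_lt_two_pow
            calc row t i - 32 < 2 ^ 5 := by omega
              _ ≤ 2 ^ j := Nat.pow_le_pow_right (by norm_num) (by omega)
      · have h8 : (row t i).testBit 5 = false := Nat.testBit_lt_two_pow (by omega)
        have : row TH i - 32 - row c i = 0 := by omega
        rw [this]
        apply row_zero_of
        intro j hj
        rw [hXb i j hj, h5, h8]; simp
    · apply row_zero_of
      intro j hj
      rw [hXb i j hj]; simp [hi]
  rw [Finset.range_eq_Ico, ← Finset.sum_Ico_consecutive _ (Nat.zero_le 2) hn2]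
  have z : ∑ i ∈ Ico 0 2, row X i = 0 := by
    apply Finset.sum_eq_zero
    intro i hi
    rw [hrow, if_neg]
    rw [mem_Ico] at hi; omega
  rw [z, zero_add]
  apply Finset.sum_le_sum
  intro i hi
  rw [mem_Ico] at hi
  rw [hrow, if_pos hi]

theorem check_spec {n c : ℕ} (hn : n ≤ 26) (hn2 : 2 ≤ n) (hc : ∀ i, 2 ≤ i → row c i ≤ 26) (hcn : ∀ i, n ≤ i → row c i = 0) (hc2 : c < 2 ^ (32 * 26))
    (cs : List (ℕ × ℕ × ℕ))
    (hcs : ∀ f ∈ cs, row f.2.1 0 = 4294967295 ∧ row f.2.1 1 = 4294967295 ∧ ∀ i, 2 ≤ i → i < n → 32 ≤ row f.2.1 i ∧ row f.2.1 i < 64)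
    (h : check (colOf n) c cs = false) : ∃ f ∈ cs, f.2.2 < ∑ i ∈ Ico 2 n, ((row f.2.1 i - 32) - row c i) := by
  induction cs with
  | nil => exact absurd h (by show ¬ (true = false); simp)
  | cons f cs ih =>
    obtain ⟨s, TH, b⟩ := f
    have e : check (colOf n) c ((s, TH, b) :: cs) = ite' (Nat.ble (deficit (colOf n) c TH) b) (check (colOf n) c cs) false := rfl
    rw [e, ite'_eq] at h
    split_ifs at h with h1
    · obtain ⟨f, hf, h2⟩ := ih (fun f hf => hcs f (by simp [hf])) h
      exact ⟨f, by simp [hf], h2⟩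
    · refine ⟨_, List.mem_cons_self, ?_⟩
      have := hcs _ List.mem_cons_self
      have := deficit_spec hn hc hcn hc2 this.1 this.2.1 this.2.2 hn2
      rw [Nat.ble_eq] at h1
      simp only at *
      omega

open Classical in
theorem cnt_check {n P : ℕ} (hn : n ≤ 26) (hn2 : 2 ≤ n) {fs : List (ℕ × ℕ × ℕ)} (hfs : wfFs n fs) (cs : List (ℕ × ℕ × ℕ))
    (hcs : ∀ f ∈ cs, row f.2.1 0 = 4294967295 ∧ row f.2.1 1 = 4294967295 ∧ ∀ i, 2 ≤ i → i < n → 32 ≤ row f.2.1 i ∧ row f.2.1 i < 64)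
    (h : check (colOf n) (cnt (colOf n) P fs) cs = false) :
    ∃ f ∈ cs, f.2.2 < ∑ i ∈ Ico 2 n, ((row f.2.1 i - 32) - fs.countP (fun f => decide (occ P f.1 f.2.2 i))) := by
  have hr := cnt_spec (P := P) hn hfs
  have hz : ∀ i, n ≤ i → row (cnt (colOf n) P fs) i = 0 := by
    intro i hi
    rw [hr i (by omega), if_neg (by omega)]
  obtain ⟨f, hf, h⟩ := check_spec hn hn2 (by
    intro i hi
    rw [hr i hi]
    split_ifs
    · exact le_trans List.countP_le_length hfs.1
    · exact Nat.zero_le _) hz (by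
    apply Nat.lt_pow_two_of_testBit
    intro q hq
    have h1 := hz (q / 32) (by omega)
    have h2 := row_bit (cnt (colOf n) P fs) (q / 32) (q % 32)
    rw [h1, B, Nat.div_add_mod] at h2
    have h3 : q % 32 < 32 := Nat.mod_lt _ (by norm_num)
    simp [h3] at h2
    exact h2) cs hcs h
  refine ⟨f, hf, lt_of_lt_of_eq h ?_⟩
  apply Finset.sum_congr rfl
  intro i hi
  rw [mem_Ico] at hi
  rw [hr i hi.1, if_pos hi.2]

end Eng
end

section
open Finset
namespace Eng
noncomputable section

theorem low_lt (r : ℕ) : low r < 32 := by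
  have h : ∀ m : Fin 37, ((1927099591673202653400830979024622892061803801320520572166761615360 >>> (6 * m.1)) &&& 63) < 32 := by decide +kernel
  have e : low r = (1927099591673202653400830979024622892061803801320520572166761615360 >>> (6 * ((Nat.xor r (Nat.land r (Nat.sub r (nat_lit 1)))) % 37))) &&& 63 := rfl
  rw [e]
  exact h ⟨_, Nat.mod_lt _ (by norm_num)⟩

theorem bit_eq (r x : ℕ) : bit r x = r.testBit x := by
  have e : bit r x = Nat.beq ((r >>> x) &&& 1) 1 := rfl
  rw [e, Nat.testBit, Nat.and_comm 1]
  have := Nat.and_one_is_mod (r >>> x)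
  rcases Nat.mod_two_eq_zero_or_one (r >>> x) with h | h <;> rw [this, h] <;> rfl

theorem dswap_bit {m d : ℕ} (hm : ∀ q, m.testBit q = true → m.testBit (q + d) = false) (x q : ℕ) :
    (dswap m d x).testBit q = if m.testBit q = true then x.testBit (q + d) else
      if d ≤ q ∧ m.testBit (q - d) = true then x.testBit (q - d) else x.testBit q := by
  have e : dswap m d x = x ^^^ (((x ^^^ (x >>> d)) &&& m) ^^^ (((x ^^^ (x >>> d)) &&& m) <<< d)) := rfl
  rw [e]
  simp only [Nat.testBit_xor, Nat.testBit_and, Nat.testBit_shiftLeft, Nat.testBit_shiftRight]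
  by_cases h1 : m.testBit q = true
  · rw [if_pos h1, h1]
    have h2 : (decide (q ≥ d) && (((x.testBit (q - d) ^^ x.testBit (d + (q - d))) && m.testBit (q - d)))) = false := by
      by_cases h3 : d ≤ q
      · by_cases h4 : m.testBit (q - d) = true
        · have := hm _ h4
          rw [Nat.sub_add_cancel h3] at this
          rw [this] at h1; simp at h1
        · simp [h4]
      · simp [h3]
    rw [h2, Nat.add_comm d q]
    cases x.testBit q <;> cases x.testBit (q+d) <;> rfl
  · rw [if_neg h1]
    rw [Bool.not_eq_true] at h1
    rw [h1]
    by_cases h3 : d ≤ q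
    · have e2 : d + (q - d) = q := by omega
      rw [e2]
      by_cases h4 : m.testBit (q - d) = true
      · rw [if_pos ⟨h3, h4⟩, h4]
        simp only [h3, ge_iff_le, decide_true]
        cases x.testBit q <;> cases x.testBit (q-d) <;> simp
      · rw [if_neg (by tauto)]
        simp [h4]
    · rw [if_neg (by tauto)]
      simp [h3]

/-- block swap -/
def bsw (a k d i : ℕ) : ℕ := if a ≤ i ∧ i < a + k then i + d else if a + d ≤ i ∧ i < a + d + k then i - d else i

theorem bsw_inv {a k d : ℕ} (h : k ≤ d) (i : ℕ) : bsw a k d (bsw a k d i) = i := by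
  unfold bsw; split_ifs <;> omega

def InV (n i : ℕ) : Prop := 2 ≤ i ∧ i < n

structure SwOK (n UC : ℕ) (s : Sw) : Prop where
  hk : s.k ≤ s.d
  ha : 2 ≤ s.a
  hn : s.a + s.d + s.k ≤ n
  hm : s.m = (2 ^ s.k - 1) <<< s.a
  hc : s.c = colOf n * s.m
  hr : s.r = (2 ^ (32 * s.k) - 1) <<< (32 * s.a)
  hu : swInv s.d s.c s.r UC = true

theorem mask_bit (a k q : ℕ) : ((2 ^ k - 1) <<< a).testBit q = decide (a ≤ q ∧ q < a + k) := by
  rw [Nat.testBit_shiftLeft, Nat.testBit_two_pow_sub_one]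
  by_cases h : a ≤ q
  · simp only [h, ge_iff_le, decide_true, Bool.true_and, true_and, decide_eq_decide]; omega
  · simp [h]

theorem dswap_small {n UC : ℕ} {s : Sw} (h : SwOK n UC s) (x q : ℕ) :
    (dswap s.m s.d x).testBit q = x.testBit (bsw s.a s.k s.d q) := by
  have h1 := h.hk
  rw [dswap_bit]
  · rw [h.hm, mask_bit, mask_bit]
    unfold bsw
    simp only [decide_eq_true_eq]
    split_ifs <;> first | rfl | omega
  · intro q
    rw [h.hm, mask_bit, mask_bit]
    simp only [decide_eq_true_eq, decide_eq_false_iff_not]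
    omega

theorem swInv_spec {n UC : ℕ} {s : Sw} (hn : n ≤ 26) (h : SwOK n UC s) (M : ℕ) (hM : swInv s.d s.c s.r M = true) (i j : ℕ) (hi : InV n i) (hj : j < 32) :
    B M (bsw s.a s.k s.d i) (bsw s.a s.k s.d j) = B M i j := by
  have e : swInv s.d s.c s.r M = Nat.beq (dswap s.r (s.d <<< 5) (dswap s.c s.d M)) M := rfl
  rw [e, Nat.beq_eq] at hM
  have hk := h.hk
  have ha := h.ha
  have han := h.hn
  have hmlt : s.m < 2 ^ 32 := by
    apply Nat.lt_pow_two_of_testBit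
    intro q hq
    rw [h.hm, mask_bit]
    simp only [decide_eq_false_iff_not]; omega
  have hcb : ∀ i j, j < 32 → s.c.testBit (32 * i + j) = decide (2 ≤ i ∧ i < n ∧ s.a ≤ j ∧ j < s.a + s.k) := by
    intro i j hj
    rw [h.hc]
    have := mul_B (Lan_colOf n) hmlt hj i
    rw [B] at this
    have e : (colOf n * s.m) = (colOf n).mul s.m := rfl
    rw [e, this, colOf_bit, h.hm, mask_bit, ← Bool.decide_and, decide_eq_decide]
    omega
  have hrb : ∀ i j, j < 32 → s.r.testBit (32 * i + j) = decide (s.a ≤ i ∧ i < s.a + s.k) := by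
    intro i j hj
    rw [h.hr, mask_bit, decide_eq_decide]; omega
  have hcb' : ∀ q, s.c.testBit q = decide (2 ≤ q / 32 ∧ q / 32 < n ∧ s.a ≤ q % 32 ∧ q % 32 < s.a + s.k) := by
    intro q
    have := hcb (q / 32) (q % 32) (by omega)
    rwa [Nat.div_add_mod] at this
  have hrb' : ∀ q, s.r.testBit q = decide (s.a ≤ q / 32 ∧ q / 32 < s.a + s.k) := by
    intro q
    have := hrb (q / 32) (q % 32) (by omega)
    rwa [Nat.div_add_mod] at this
  have h1 : ∀ i j, InV n i → j < 32 → B (dswap s.c s.d M) i j = B M i (bsw s.a s.k s.d j) := by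
    intro i j hi hj
    unfold InV at hi
    rw [B, dswap_bit]
    · rw [hcb', hcb']
      unfold bsw B
      simp only [decide_eq_true_eq]
      split_ifs <;> first | rfl | (congr 1; omega) | (exfalso; omega)
    · intro q
      rw [hcb', hcb']
      simp only [decide_eq_true_eq, decide_eq_false_iff_not]
      omega
  have h2 : ∀ X i j, j < 32 → B (dswap s.r (s.d <<< 5) X) i j = B X (bsw s.a s.k s.d i) j := by
    intro X i j hj
    have e : s.d <<< 5 = 32 * s.d := shl5 s.d
    rw [B, e, dswap_bit]
    · rw [hrb', hrb']
      unfold bsw B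
      simp only [decide_eq_true_eq]
      split_ifs <;> first | rfl | (congr 1; omega) | (exfalso; omega)
    · intro q
      rw [hrb', hrb']
      simp only [decide_eq_true_eq, decide_eq_false_iff_not]
      omega
  have h3 := h2 (dswap s.c s.d M) i j hj
  rw [hM, h1 _ _ _ hj] at h3
  · exact h3.symm
  · unfold bsw InV at *; split_ifs <;> omega

/-- remV -/
theorem remV_spec (v R Q : ℕ) (hv : v < 32) (hR : R < 2 ^ 32) :
    (∀ i j, 2 ≤ i → B (remV v R Q) i j = true → B Q i j = true) ∧
    (∀ i j, 2 ≤ i → i < 32 → j < 32 → B Q i j = true → B (remV v R Q) i j = false →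
      (i = v ∧ R.testBit j = true) ∨ (j = v ∧ R.testBit i = true)) := by
  have key : ∀ f R Q, R < 2 ^ 32 → 
     (∀ i j, 2 ≤ i → B (Nat.rec (motive := fun _ => Nat → Nat → Nat) (fun _ Q => Q)
   (fun _ ih R Q => ite' (Nat.beq R (nat_lit 0)) Q
     (force (low R) fun x => force (Nat.land R (Nat.sub R (nat_lit 1))) fun R' =>
      ite' (bit R x) (hforce (clear Q (Nat.lor (Nat.shiftLeft (Nat.shiftLeft (nat_lit 1) x) (Nat.shiftLeft v (nat_lit 5)))
          (Nat.shiftLeft (Nat.shiftLeft (nat_lit 1) v) (Nat.shiftLeft x (nat_lit 5))))) fun Q => ih R' Q) Q)) f R Q) i j = true → B Q i j = true) ∧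
    (∀ i j, 2 ≤ i → i < 32 → j < 32 → B Q i j = true → B (Nat.rec (motive := fun _ => Nat → Nat → Nat) (fun _ Q => Q)
   (fun _ ih R Q => ite' (Nat.beq R (nat_lit 0)) Q
     (force (low R) fun x => force (Nat.land R (Nat.sub R (nat_lit 1))) fun R' =>
      ite' (bit R x) (hforce (clear Q (Nat.lor (Nat.shiftLeft (Nat.shiftLeft (nat_lit 1) x) (Nat.shiftLeft v (nat_lit 5)))
          (Nat.shiftLeft (Nat.shiftLeft (nat_lit 1) v) (Nat.shiftLeft x (nat_lit 5))))) fun Q => ih R' Q) Q)) f R Q) i j = false →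
      (i = v ∧ R.testBit j = true) ∨ (j = v ∧ R.testBit i = true)) := by
    intro f
    induction f with
    | zero =>
      intro R Q hR
      refine ⟨fun i j _ h => h, fun i j _ _ _ h1 h2 => ?_⟩
      rw [show B Q i j = false from h2] at h1; simp at h1
    | succ f ih =>
      intro R Q hR
      dsimp only
      rw [ite'_eq]
      split_ifs with h0
      · refine ⟨fun i j _ h => h, fun i j _ _ _ h1 h2 => ?_⟩
        rw [h2] at h1; simp at h1
      · rw [force_eq, force_eq, ite'_eq]
        split_ifs with hb
        · rw [hforce_eq]
          have hx := low_lt R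
          rw [bit_eq] at hb
          have hR' : Nat.land R (Nat.sub R (nat_lit 1)) < 2 ^ 32 := lt_of_le_of_lt Nat.and_le_left hR
          obtain ⟨i1, i2⟩ := ih (Nat.land R (Nat.sub R (nat_lit 1))) (clear Q (Nat.lor (Nat.shiftLeft (Nat.shiftLeft (nat_lit 1) (low R)) (Nat.shiftLeft v (nat_lit 5)))
             (Nat.shiftLeft (Nat.shiftLeft (nat_lit 1) v) (Nat.shiftLeft (low R) (nat_lit 5)))) ^^^ (clear Q (Nat.lor (Nat.shiftLeft (Nat.shiftLeft (nat_lit 1) (low R)) (Nat.shiftLeft v (nat_lit 5)))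
             (Nat.shiftLeft (Nat.shiftLeft (nat_lit 1) v) (Nat.shiftLeft (low R) (nat_lit 5))))) % 2305843009213693951) hR'
          refine ⟨?_, ?_⟩
          · intro i j hi h
            have := i1 i j hi h
            rw [junk_B _ _ _ hi, clear_B, Bool.and_eq_true] at this
            exact this.1
          · intro i j hi hi2 hj h1 h2
            by_cases h3 : B (clear Q (Nat.lor (Nat.shiftLeft (Nat.shiftLeft (nat_lit 1) (low R)) (Nat.shiftLeft v (nat_lit 5)))
             (Nat.shiftLeft (Nat.shiftLeft (nat_lit 1) v) (Nat.shiftLeft (low R) (nat_lit 5))))) i j = true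
            · have h4 := i2 i j hi hi2 hj (by rw [junk_B _ _ _ hi]; exact h3) h2
              have h5 : ∀ q, (Nat.land R (Nat.sub R (nat_lit 1))).testBit q = true → R.testBit q = true := by
                intro q h
                have e : Nat.land R (Nat.sub R (nat_lit 1)) = R &&& (R - 1) := rfl
                rw [e, Nat.testBit_and, Bool.and_eq_true] at h
                exact h.1
              rcases h4 with h4 | h4
              · exact Or.inl ⟨h4.1, h5 _ h4.2⟩
              · exact Or.inr ⟨h4.1, h5 _ h4.2⟩
            · rw [clear_B, h1, Bool.true_and, Bool.not_eq_true, Bool.not_eq_false', lor_B, shl5, shl5,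
                lane_B (one_lt hx) hj, lane_B (one_lt hv) hj, one_bit, one_bit] at h3
              simp only [Bool.or_eq_true, Bool.and_eq_true, decide_eq_true_eq] at h3
              rcases h3 with ⟨h3, h4⟩ | ⟨h3, h4⟩
              · left; exact ⟨h3, by rw [h4]; exact hb⟩
              · right; exact ⟨h4, by rw [h3]; exact hb⟩
        · refine ⟨fun i j _ h => h, fun i j _ _ _ h1 h2 => ?_⟩
          rw [h2] at h1; simp at h1
  exact key 30 R Q hR

end
end Eng
end

section
open Finset
namespace Eng
noncomputable section
open Classical

structure WF (n UC : ℕ) (fs cs : List (ℕ × ℕ × ℕ)) (fl : List (ℕ × List Sw)) : Prop where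
  hn : n ≤ 26
  hn2 : 2 ≤ n
  sym : ∀ i j, InV n i → InV n j → B UC i j = true → B UC j i = true
  hfs : wfFs n fs
  fcov : ∀ j, InV n j → ∃ f ∈ fs, f.1 ≤ j ∧ j < f.1 + f.2.2
  fsf : ∀ f ∈ fs, ∀ a b, f.1 ≤ a → a < f.1 + f.2.2 → f.1 ≤ b → b < f.1 + f.2.2 → B UC a b = true
  hcs : ∀ f ∈ cs, row f.2.1 0 = 4294967295 ∧ row f.2.1 1 = 4294967295 ∧ 26 ≤ f.1 ∧ ∀ i, InV n i → row f.2.1 i = 32 + (row UC i >>> f.1) % 8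
  hfl : ∀ p ∈ fl, (∀ j, p.1.testBit j = true → InV n j) ∧ ∀ s ∈ p.2, SwOK n UC s

def dg (A : ℕ → ℕ → Prop) (i : ℕ) : ℕ := ((range 32).filter (A i)).card

structure Sol (n UC : ℕ) (cs : List (ℕ × ℕ × ℕ)) (A : ℕ → ℕ → Prop) : Prop where
  symm : ∀ i j, A i j → A j i
  irr : ∀ i, ¬ A i i
  sup : ∀ i j, A i j → InV n i ∧ InV n j
  tri : ∀ a b c, A a b → A b c → A a c → False
  c4 : ∀ a b c d, A a b → A b c → A c d → A d a → a = c ∨ b = d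
  sf : ∀ v a b, A v a → A v b → B UC a b = true → a = b
  deg : ∀ i, InV n i → dg A i ≤ row UC i >>> 29
  bud : ∀ f ∈ cs, ∑ i ∈ Ico 2 n, ((row f.2.1 i - 32) - dg A i) ≤ f.2.2

structure Nd (n UC : ℕ) (cs : List (ℕ × ℕ × ℕ)) (E P : ℕ) (A : ℕ → ℕ → Prop) : Prop where
  sol : Sol n UC cs A
  le : ∀ i j, InV n i → InV n j → B E i j = true → A i j
  ge : ∀ i j, A i j → B P i j = true

structure St (n UC E P T : ℕ) : Prop where
  supE : ∀ i j, InV n i → j < 32 → B E i j = true → InV n j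
  symE : ∀ i j, InV n i → InV n j → B E i j = true → B E j i = true
  irrP : ∀ i, InV n i → B P i i = false
  T : ∀ a b, InV n a → InV n b → B T a b = true → a = b ∨ B E a b = true ∨ (∃ c, InV n c ∧ B E a c = true ∧ B E c b = true) ∨ B UC a b = true

structure AutM (n M : ℕ) (σ : ℕ → ℕ) : Prop where
  h : ∀ i j, InV n i → j < 32 → B M (σ i) (σ j) = B M i j

structure Aut (n UC E P : ℕ) (σ : ℕ → ℕ) : Prop where
  inv : ∀ i, σ (σ i) = i
  sup : ∀ i, InV n i → InV n (σ i)
  fix : ∀ i, ¬ InV n i → σ i = i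
  U : ∀ i j, InV n i → j < 32 → B UC (σ i) (σ j) = B UC i j
  E : ∀ i j, InV n i → j < 32 → B E (σ i) (σ j) = B E i j
  P : ∀ i j, InV n i → j < 32 → B P (σ i) (σ j) = B P i j

theorem inv_sum {n : ℕ} {σ : ℕ → ℕ} (inv : ∀ i, σ (σ i) = i) (sup : ∀ i, InV n i → InV n (σ i)) (f : ℕ → ℕ) :
    ∑ i ∈ Ico 2 n, f (σ i) = ∑ i ∈ Ico 2 n, f i := by
  refine Finset.sum_nbij' σ σ ?_ ?_ ?_ ?_ ?_
  · intro i hi; rw [mem_Ico] at hi ⊢; exact sup i hi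
  · intro i hi; rw [mem_Ico] at hi ⊢; exact sup i hi
  · intro i _; exact inv i
  · intro i _; exact inv i
  · intro i _; rfl

theorem Aut.dg {n UC E P : ℕ} {σ : ℕ → ℕ} (hn : n ≤ 26) (h : Aut n UC E P σ) (A : ℕ → ℕ → Prop) (i : ℕ) :
    dg (fun i j => A (σ i) (σ j)) i = dg A (σ i) := by
  have lt : ∀ j, j < 32 → σ j < 32 := by
    intro j hj
    by_cases hv : InV n j
    · have := h.sup j hv; unfold InV at this; omega
    · rw [h.fix j hv]; exact hj
  unfold Eng.dg
  refine Finset.card_nbij' σ σ ?_ ?_ ?_ ?_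
  · intro j hj
    simp only [mem_coe, mem_filter, mem_range] at hj ⊢
    exact ⟨lt j hj.1, hj.2⟩
  · intro j hj
    simp only [mem_coe, mem_filter, mem_range] at hj ⊢
    exact ⟨lt j hj.1, by rw [h.inv]; exact hj.2⟩
  · intro j _; exact h.inv j
  · intro j _; exact h.inv j

theorem Aut.row {n UC E P : ℕ} {σ : ℕ → ℕ} (hn : n ≤ 26) (h : Aut n UC E P σ) (i : ℕ) (hi : InV n i) (s : ℕ) (hs : 26 ≤ s) :
    row UC (σ i) >>> s = row UC i >>> s := by
  apply Nat.eq_of_testBit_eq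
  intro t
  rw [Nat.testBit_shiftRight, Nat.testBit_shiftRight, row_bit, row_bit]
  by_cases h32 : s + t < 32
  · have := h.U i (s + t) hi h32
    rw [h.fix (s + t) (by unfold InV; omega)] at this
    rw [this]
  · simp [h32]

theorem Nd.map {n UC E P : ℕ} {fs cs : List (ℕ × ℕ × ℕ)} {fl : List (ℕ × List Sw)} (wf : WF n UC fs cs fl) {σ : ℕ → ℕ} (h : Aut n UC E P σ)
    {A : ℕ → ℕ → Prop} (hA : Nd n UC cs E P A) : Nd n UC cs E P (fun i j => A (σ i) (σ j)) := by
  have sup' : ∀ i, InV n (σ i) → InV n i := fun i hi => by have := h.sup _ hi; rwa [h.inv] at this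
  have inj : ∀ a b, σ a = σ b → a = b := fun a b hab => by rw [← h.inv a, ← h.inv b, hab]
  have hn := wf.hn
  have lt : ∀ i, InV n i → i < 32 := fun i hi => by unfold InV at hi; omega
  refine ⟨⟨?_, ?_, ?_, ?_, ?_, ?_, ?_, ?_⟩, ?_, ?_⟩
  · exact fun i j => hA.sol.symm _ _
  · exact fun i => hA.sol.irr _
  · intro i j hij; have := hA.sol.sup _ _ hij; exact ⟨sup' _ this.1, sup' _ this.2⟩
  · exact fun a b c => hA.sol.tri _ _ _
  · intro a b c d h1 h2 h3 h4
    rcases hA.sol.c4 _ _ _ _ h1 h2 h3 h4 with h | h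
    · exact Or.inl (inj _ _ h)
    · exact Or.inr (inj _ _ h)
  · intro v a b h1 h2 h3
    have ha := sup' _ (hA.sol.sup _ _ h1).2
    have hb := sup' _ (hA.sol.sup _ _ h2).2
    apply inj
    apply hA.sol.sf _ _ _ h1 h2
    rw [h.U a b ha (lt _ hb)]; exact h3
  · intro i hi
    rw [h.dg hn, ← h.row hn i hi 29 (by norm_num)]
    exact hA.sol.deg _ (h.sup _ hi)
  · intro f hf
    have h1 := hA.sol.bud f hf
    rw [← inv_sum h.inv h.sup] at h1
    refine le_trans (le_of_eq ?_) h1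
    apply Finset.sum_congr rfl
    intro i hi
    rw [mem_Ico] at hi
    obtain ⟨_, _, h26, h3⟩ := wf.hcs f hf
    rw [h.dg hn, h3 i hi, h3 _ (h.sup i hi), h.row hn i hi _ h26]
  · intro i j hi hj hE
    apply hA.le _ _ (h.sup _ hi) (h.sup _ hj)
    rw [h.E i j hi (lt _ hj)]; exact hE
  · intro i j hij
    have hs := hA.sol.sup _ _ hij
    rw [← h.P i j (sup' _ hs.1) (lt _ (sup' _ hs.2))]
    exact hA.ge _ _ hij

def Bad (n UC : ℕ) (cs : List (ℕ × ℕ × ℕ)) (E P v x : ℕ) : Prop := ∀ A, Nd n UC cs E P A → ¬ A v x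

theorem Bad.map {n UC E P : ℕ} {fs cs : List (ℕ × ℕ × ℕ)} {fl : List (ℕ × List Sw)} (wf : WF n UC fs cs fl) {σ : ℕ → ℕ} (h : Aut n UC E P σ)
    {v x : ℕ} (hv : σ v = v) (hB : Bad n UC cs E P v x) : Bad n UC cs E P v (σ x) := by
  intro A hA hvx
  refine hB _ (hA.map wf h) ?_
  rw [hv]; exact hvx

def sw (a b i : ℕ) : ℕ := if i = a then b else if i = b then a else i

theorem sw_aut {n M w x : ℕ} (hw : InV n w) (hx : InV n x) (h1 : ∀ j, j < 32 → B M x j = B M w j) (h2 : ∀ i, InV n i → B M i x = B M i w) 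
    (i j : ℕ) (hi : InV n i) (hj : j < 32) : B M (sw w x i) (sw w x j) = B M i j := by
  have hs : InV n (sw w x i) := by unfold sw; split_ifs <;> assumption
  have e1 : B M (sw w x i) (sw w x j) = B M (sw w x i) j := by
    have h : sw w x j = j ∨ (j = w ∧ sw w x j = x) ∨ (j = x ∧ sw w x j = w) := by
      unfold sw; split_ifs <;> tauto
    rcases h with h | ⟨h, h'⟩ | ⟨h, h'⟩
    · rw [h]
    · rw [h', h, h2 _ hs]
    · rw [h', h, h2 _ hs]
  rw [e1]
  unfold sw
  split_ifs with h3 h4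
  · rw [h3, h1 j hj]
  · rw [h4, h1 j hj]
  · rfl

theorem row_eq_bits {M x w : ℕ} (h : row M x = row M w) (j : ℕ) (hj : j < 32) : B M x j = B M w j := by
  have h1 := row_bit M x j
  have h2 := row_bit M w j
  rw [h, h2] at h1
  simpa [hj] using h1.symm

theorem col_eq_bits {n M x w : ℕ} (h : col (colOf n) M x = col (colOf n) M w) (i : ℕ) (hi : InV n i) : B M i x = B M i w := by
  have h1 := col_bit n M x (32 * i)
  have h2 := col_bit n M w (32 * i)
  rw [h, h2] at h1
  have e : decide (32 * i % 32 = 0 ∧ 2 ≤ 32 * i / 32 ∧ 32 * i / 32 < n) = true := by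
    unfold InV at hi; simp only [decide_eq_true_eq]; omega
  rw [e, Bool.and_true, Bool.and_true] at h1
  unfold B
  first
  | exact h1.symm
  | (rw [Nat.add_comm (32 * i) x, Nat.add_comm (32 * i) w]; exact h1.symm)

theorem Bad.twin {n UC E P : ℕ} {fs cs : List (ℕ × ℕ × ℕ)} {fl : List (ℕ × List Sw)} (wf : WF n UC fs cs fl) {v w x : ℕ}
    (hw : InV n w) (hwv : w ≠ v)
    (h1 : row P x = row P w) (h2 : row E x = row E w) (h3 : row UC x = row UC w) (h4 : col (colOf n) P x = col (colOf n) P w) 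
    (h5 : col (colOf n) E x = col (colOf n) E w) (hB : Bad n UC cs E P v w) : Bad n UC cs E P v x := by
  by_cases hx : InV n x
  · by_cases hxv : x = v
    · intro A hA h; rw [hxv] at h; exact hA.sol.irr _ h
    · have hau : Aut n UC E P (sw w x) := by
        refine ⟨?_, ?_, ?_, ?_, ?_, ?_⟩
        · intro i; unfold sw; split_ifs <;> simp_all
        · intro i hi; unfold sw; split_ifs <;> assumption
        · intro i hi; unfold sw
          rw [if_neg (by rintro rfl; exact hi hw), if_neg (by rintro rfl; exact hi hx)]
        · apply sw_aut hw hx (row_eq_bits h3)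
          have hn := wf.hn
          intro i hi
          have a1 := row_eq_bits h3 i (by unfold InV at hi; omega)
          have s1 := wf.sym i x hi hx
          have s2 := wf.sym x i hx hi
          have s3 := wf.sym i w hi hw
          have s4 := wf.sym w i hw hi
          rw [Bool.eq_iff_iff]
          rw [Bool.eq_iff_iff] at a1
          tauto
        · exact sw_aut hw hx (row_eq_bits h2) (col_eq_bits h5)
        · exact sw_aut hw hx (row_eq_bits h1) (col_eq_bits h4)
      have := Bad.map wf hau (v := v) (x := w) (by unfold sw; rw [if_neg (by tauto), if_neg (by tauto)]) hB
      simpa [sw] using this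
  · intro A hA h; exact hx (hA.sol.sup _ _ h).2

def RInv (n UC : ℕ) (cs : List (ℕ × ℕ × ℕ)) (E P v R : ℕ) : Prop := R < 2 ^ 32 ∧ ∀ x, R.testBit x = true → Bad n UC cs E P v x

def twinsA (COL E P UC w f r R : Nat) : Nat :=
  Nat.rec (motive := fun _ => Nat → Nat → Nat) (fun _ R => R)
   (fun _ ih r R => ite' (Nat.beq r (nat_lit 0)) R
     (force (low r) fun x => force (Nat.land r (Nat.sub r (nat_lit 1))) fun r' =>
       ite' (Nat.beq (row P x) (row P w)) (ite' (Nat.beq (row E x) (row E w)) (ite' (Nat.beq (row UC x) (row UC w))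
        (ite' (Nat.beq (col COL P x) (col COL P w)) (ite' (Nat.beq (col COL E x) (col COL E w))
        (force (Nat.lor R (Nat.shiftLeft (nat_lit 1) x)) fun R => ih r' R) (ih r' R)) (ih r' R)) (ih r' R)) (ih r' R)) (ih r' R)))
   f r R

theorem twinsA_succ (COL E P UC w f r R : Nat) : twinsA COL E P UC w (f + 1) r R =
   ite' (Nat.beq r (nat_lit 0)) R
       (ite' (Nat.beq (row P (low r)) (row P w)) (ite' (Nat.beq (row E (low r)) (row E w)) (ite' (Nat.beq (row UC (low r)) (row UC w))
        (ite' (Nat.beq (col COL P (low r)) (col COL P w)) (ite' (Nat.beq (col COL E (low r)) (col COL E w))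
        (twinsA COL E P UC w f (Nat.land r (Nat.sub r (nat_lit 1))) (Nat.lor R (Nat.shiftLeft (nat_lit 1) (low r))))
        (twinsA COL E P UC w f (Nat.land r (Nat.sub r (nat_lit 1))) R)) (twinsA COL E P UC w f (Nat.land r (Nat.sub r (nat_lit 1))) R)) 
        (twinsA COL E P UC w f (Nat.land r (Nat.sub r (nat_lit 1))) R)) (twinsA COL E P UC w f (Nat.land r (Nat.sub r (nat_lit 1))) R)) 
        (twinsA COL E P UC w f (Nat.land r (Nat.sub r (nat_lit 1))) R)) := rfl

theorem twins_spec {n UC E P : ℕ} {fs cs : List (ℕ × ℕ × ℕ)} {fl : List (ℕ × List Sw)} (wf : WF n UC fs cs fl) {v w : ℕ}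
    (hw : InV n w) (hwv : w ≠ v) (hB : Bad n UC cs E P v w) (r R : ℕ) (hR : RInv n UC cs E P v R) : RInv n UC cs E P v (twins (colOf n) E P UC w r R) := by
  have e : twins (colOf n) E P UC w r R = twinsA (colOf n) E P UC w 6 r R := rfl
  rw [e]
  clear e
  generalize 6 = f
  induction f generalizing r R with
  | zero => exact hR
  | succ f ih =>
    rw [twinsA_succ]
    simp only [ite'_eq]
    split_ifs with h0 h1 h2 h3 h4 h5
    · exact hR
    · apply ih
      simp only [Nat.beq_eq] at h1 h2 h3 h4 h5
      refine ⟨Nat.or_lt_two_pow hR.1 (one_lt (low_lt r)), ?_⟩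
      intro x hx
      have e : (Nat.lor R (Nat.shiftLeft (nat_lit 1) (low r))).testBit x = (R.testBit x || (Nat.shiftLeft (nat_lit 1) (low r)).testBit x) := Nat.testBit_or _ _ _
      rw [e, one_bit, Bool.or_eq_true, decide_eq_true_eq] at hx
      rcases hx with hx | hx
      · exact hR.2 x hx
      · rw [hx]
        exact Bad.twin wf hw hwv h1 h2 h3 h4 h5 hB
    all_goals exact ih _ _ hR

theorem blocks_cons (v E P rv a k d m c r : ℕ) (sws : List Sw) (R : ℕ) : blocks v E P rv (⟨a, k, d, m, c, r⟩ :: sws) R = 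
      ite' (Nat.beq (Nat.land (Nat.xor rv (Nat.shiftRight rv d)) m) (nat_lit 0))
         (ite' (Nat.beq (dswap m d (Nat.shiftLeft (nat_lit 1) v)) (Nat.shiftLeft (nat_lit 1) v))
          (ite' (swInv d c r E) (ite' (swInv d c r P) (blocks v E P rv sws (Nat.lor R (dswap m d R))) (blocks v E P rv sws R)) (blocks v E P rv sws R)) (blocks v E P rv sws R))
        (blocks v E P rv sws R) := rfl

theorem blocks_spec {n UC E P : ℕ} {fs cs : List (ℕ × ℕ × ℕ)} {fl : List (ℕ × List Sw)} (wf : WF n UC fs cs fl) {v rv : ℕ}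
    (sws : List Sw) (hs : ∀ s ∈ sws, SwOK n UC s) (R : ℕ) (hR : RInv n UC cs E P v R) : RInv n UC cs E P v (blocks v E P rv sws R) := by
  induction sws generalizing R with
  | nil => exact hR
  | cons s sws ih =>
    have hok := hs s (by simp)
    have ih := ih (fun s h => hs s (by simp [h]))
    obtain ⟨a, k, d, m, c, r⟩ := s
    rw [blocks_cons]
    simp only [ite'_eq]
    split_ifs with h0 h1 h2 h3
    · apply ih
      rw [Nat.beq_eq] at h1
      have hn := wf.hn
      have hk := hok.hk
      have ha := hok.ha
      have han := hok.hn
      simp only at hk ha han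
      have hau : Aut n UC E P (bsw a k d) := by
        refine ⟨bsw_inv hk, ?_, ?_, swInv_spec hn hok UC hok.hu, swInv_spec hn hok E h2, swInv_spec hn hok P h3⟩
        · intro i hi; unfold bsw InV at *; split_ifs <;> omega
        · intro i hi; unfold bsw InV at *; split_ifs <;> omega
      have hv : bsw a k d v = v := by
        have e := dswap_small hok (Nat.shiftLeft (nat_lit 1) v) v
        simp only at e
        rw [h1, one_bit, one_bit] at e
        simpa using e
      have hds := dswap_small hok R
      simp only at hds
      refine ⟨Nat.or_lt_two_pow hR.1 ?_, ?_⟩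
      · apply Nat.lt_pow_two_of_testBit
        intro q hq
        rw [hds]
        apply Nat.testBit_lt_two_pow
        refine lt_of_lt_of_le hR.1 (Nat.pow_le_pow_right (by norm_num) ?_)
        unfold bsw; split_ifs <;> omega
      · intro x hx
        have e : (Nat.lor R (dswap m d R)).testBit x = (R.testBit x || (dswap m d R).testBit x) := Nat.testBit_or _ _ _
        rw [e, hds, Bool.or_eq_true] at hx
        rcases hx with hx | hx
        · exact hR.2 x hx
        · have := Bad.map wf hau hv (hR.2 _ hx)
          rwa [bsw_inv hk] at this
    all_goals exact ih _ hR

/-- counting check -/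
theorem check_sound {n UC E P : ℕ} {fs cs : List (ℕ × ℕ × ℕ)} {fl : List (ℕ × List Sw)} (wf : WF n UC fs cs fl)
   (h : check (colOf n) (cnt (colOf n) P fs) cs = false) (A : ℕ → ℕ → Prop) : ¬ Nd n UC cs E P A := by
  intro hA
  have hn := wf.hn
  obtain ⟨f, hf, hlt⟩ := cnt_check wf.hn wf.hn2 wf.hfs cs (by
    intro f hf
    obtain ⟨h1, h2, h3, h4⟩ := wf.hcs f hf
    refine ⟨h1, h2, fun i hi hi2 => ?_⟩
    rw [h4 i ⟨hi, hi2⟩]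
    omega) h
  have := hA.sol.bud f hf
  refine absurd (lt_of_lt_of_le hlt ?_) (not_lt.2 this)
  apply Finset.sum_le_sum
  intro i hi
  apply Nat.sub_le_sub_left
  choose! g hg1 hg2 hg3 using wf.fcov
  rw [List.countP_eq_length_filter]
  refine le_trans ?_ (List.toFinset_card_le _)
  unfold dg
  apply Finset.card_le_card_of_injOn g
  · intro j hj
    simp only [mem_coe, mem_filter, mem_range] at hj
    have hv := (hA.sol.sup _ _ hj.2).2
    simp only [List.coe_toFinset, List.mem_filter, Set.mem_ofPred_eq, decide_eq_true_eq]
    exact ⟨hg1 j hv, j, hg2 j hv, hg3 j hv, hA.ge _ _ hj.2⟩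
  · intro j hj j' hj' e
    simp only [mem_coe, mem_filter, mem_range] at hj hj'
    have hv := (hA.sol.sup _ _ hj.2).2
    have hv' := (hA.sol.sup _ _ hj'.2).2
    apply hA.sol.sf _ _ _ hj.2 hj'.2
    apply wf.fsf (g j) (hg1 j hv) _ _ (hg2 j hv) (hg3 j hv)
    · rw [e]; exact hg2 j' hv'
    · rw [e]; exact hg3 j' hv'

end
end Eng
end

section
open Finset
namespace Eng
noncomputable section
open Classical

/-- adding an edge -/
theorem step_sound {n UC E P Q T : ℕ} {fs cs : List (ℕ × ℕ × ℕ)} {fl : List (ℕ × List Sw)} (wf : WF n UC fs cs fl) (st : St n UC E P T) {v w : ℕ}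
   (hv : InV n v) (hw : InV n w) (hvw : v ≠ w) (hQP : ∀ i j, InV n i → InV n j → B Q i j = true → B P i j = true)
   (hQ : ∀ A, Nd n UC cs E P A → Nd n UC cs E Q A) (k : ℕ → ℕ → ℕ → Bool)
   (hk : ∀ E' P' T', St n UC E' P' T' → k E' P' T' = true → ∀ A, ¬ Nd n UC cs E' P' A)
   (h : (addE (colOf n) v w E Q T fun E' P' T' =>
                    satur (colOf n) UC E' P' v fun P' => satur (colOf n) UC E' P' w fun P' => k E' P' T') = true) :
   Bad n UC cs E P v w := by
  intro A hA0 hvwA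
  have hA := hQ A hA0
  have hn := wf.hn
  have lt : ∀ i, InV n i → i < 32 := fun i hi => by unfold InV at hi; omega
  obtain ⟨E', P', T', he, hE, hP, hT⟩ := addE_spec E Q T hv.1 hv.2 hw.1 hw.2 hn (fun E' P' T' =>
                    satur (colOf n) UC E' P' v fun P' => satur (colOf n) UC E' P' w fun P' => k E' P' T')
  rw [he] at h
  obtain ⟨P1, he1, h1a, h1b⟩ := satur_spec UC E' P' hv.1 hv.2 hn (fun P' => satur (colOf n) UC E' P' w fun P' => k E' P' T')
  rw [he1] at h
  obtain ⟨P2, he2, h2a, h2b⟩ := satur_spec UC E' P1 hw.1 hw.2 hn (fun P' => k E' P' T')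
  rw [he2] at h
  have symE' : ∀ i j, InV n i → InV n j → B E' i j = true → B E' j i = true := by
    intro i j hi hj hij
    rw [hE i j hi.1 (lt j hj)] at hij
    rw [hE j i hj.1 (lt i hi)]
    rcases hij with h | h | h
    · exact Or.inl (st.symE i j hi hj h)
    · exact Or.inr (Or.inr ⟨h.2, h.1⟩)
    · exact Or.inr (Or.inl ⟨h.2, h.1⟩)
  have hEA : ∀ i j, InV n i → InV n j → B E' i j = true → A i j := by
    intro i j hi hj hij
    rw [hE i j hi.1 (lt j hj)] at hij
    rcases hij with h | ⟨rfl, rfl⟩ | ⟨rfl, rfl⟩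
    · exact hA.le i j hi hj h
    · exact hvwA
    · exact hA.sol.symm _ _ hvwA
  have hEE : ∀ i j, InV n i → InV n j → B E i j = true → B E' i j = true := by
    intro i j hi hj h
    rw [hE i j hi.1 (lt j hj)]; exact Or.inl h
  have eVW : B E' v w = true := (hE v w hv.1 (lt w hw)).2 (Or.inr (Or.inl ⟨rfl, rfl⟩))
  have eWV : B E' w v = true := (hE w v hw.1 (lt v hv)).2 (Or.inr (Or.inr ⟨rfl, rfl⟩))
  have hwvA := hA.sol.symm _ _ hvwA
  have TA : ∀ x, ∀ a b, InV n a → InV n b → B T a b = true → A x a → A x b → a = b ∨ (B E a x = true ∧ B E x b = true) := by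
    intro x a b ha hb hab hxa hxb
    rcases st.T a b ha hb hab with h | h | ⟨c, hc, h1, h2⟩ | h
    · exact Or.inl h
    · exact (hA.sol.tri x a b hxa (hA.le a b ha hb h) hxb).elim
    · rcases hA.sol.c4 x a c b hxa (hA.le _ _ ha hc h1) (hA.le _ _ hc hb h2) (hA.sol.symm _ _ hxb) with h | h
      · subst h
        exact Or.inr ⟨h1, h2⟩
      · exact Or.inl h
    · exact Or.inl (hA.sol.sf x a b hxa hxb h)
  have hAP' : ∀ i j, A i j → B P' i j = true := by
    intro i j hij
    obtain ⟨hi, hj⟩ := hA.sol.sup _ _ hij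
    rw [hP i j hi.1 hi.2 (lt j hj)]
    by_cases hE' : B E' i j = true
    · exact Or.inl hE'
    right
    refine ⟨hA.ge i j hij, ?_⟩
    intro hK
    apply hE'
    have hji := hA.sol.symm _ _ hij
    rcases hK with ⟨h1, h2⟩ | ⟨h1, h2⟩ | ⟨rfl, h2⟩ | ⟨rfl, h2⟩ | ⟨rfl, h2⟩ | ⟨rfl, h2⟩
    · rcases h1 with h1 | rfl
      · rcases h2 with h2 | rfl
        · rcases hA.sol.c4 i v w j (hA.le _ _ hi hv h1) hvwA (hA.le _ _ hw hj h2) hji with h | h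
          · subst h; exact hEE _ _ hi hj h2
          · subst h; exact hEE _ _ hi hj h1
        · exact (hA.sol.tri _ _ _ (hA.le _ _ hi hv h1) hvwA hij).elim
      · rcases h2 with h2 | rfl
        · exact (hA.sol.tri _ _ _ hvwA (hA.le _ _ hw hj h2) hij).elim
        · exact eVW
    · rcases h1 with h1 | rfl
      · rcases h2 with h2 | rfl
        · rcases hA.sol.c4 i w v j (hA.le _ _ hi hw h1) hwvA (hA.le _ _ hv hj h2) hji with h | h
          · subst h; exact hEE _ _ hi hj h2
          · subst h; exact hEE _ _ hi hj h1
        · exact (hA.sol.tri _ _ _ (hA.le _ _ hi hw h1) hwvA hij).elim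
      · rcases h2 with h2 | rfl
        · exact (hA.sol.tri _ _ _ hwvA (hA.le _ _ hv hj h2) hij).elim
        · exact eWV
    · rcases TA i v j hv hj h2 hwvA hij with h | h
      · subst h; exact eWV
      · exact hEE _ _ hi hj h.2
    · rcases TA i w j hw hj h2 hvwA hij with h | h
      · subst h; exact eVW
      · exact hEE _ _ hi hj h.2
    · rcases TA j i v hi hv h2 hji hwvA with h | h
      · subst h; exact eVW
      · exact hEE _ _ hi hj h.1
    · rcases TA j i w hi hw h2 hji hvwA with h | h
      · subst h; exact eWV
      · exact hEE _ _ hi hj h.1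
  have supE' : ∀ i j, InV n i → j < 32 → B E' i j = true → InV n j := by
    intro i j hi hj h
    rw [hE i j hi.1 hj] at h
    rcases h with h | ⟨rfl, rfl⟩ | ⟨rfl, rfl⟩
    · exact st.supE i j hi hj h
    · exact hw
    · exact hv
  have satA : ∀ t, InV n t → popGe (row UC t >>> 29) (row E' t) = true → ∀ j, A t j → B E' t j = true := by
    intro t ht hp j htj
    by_contra hne
    rcases popGe_spec _ _ hp with h | h
    · have h2 := hA.sol.deg t ht
      have h3 : ((range 32).filter fun j => (row E' t).testBit j = true).card < dg A t := by
        apply Finset.card_lt_card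
        rw [Finset.ssubset_iff_of_subset]
        · refine ⟨j, ?_, ?_⟩
          · rw [mem_filter, mem_range]; exact ⟨lt _ (hA.sol.sup _ _ htj).2, htj⟩
          · rw [mem_filter, row_bit]
            simp only [Bool.and_eq_true]
            tauto
        · intro q hq
          rw [mem_filter, row_bit, Bool.and_eq_true] at hq
          rw [mem_filter]
          exact ⟨hq.1, hEA _ _ ht (supE' _ _ ht (mem_range.1 hq.1) hq.2.1) hq.2.1⟩
      omega
    · exact absurd (row_lt E' t) (by omega)
  refine hk E' P2 T' ⟨supE', symE', ?_, ?_⟩ h A ⟨hA.sol, hEA, ?_⟩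
  · intro i hi
    by_contra hc
    rw [Bool.not_eq_false] at hc
    have h1 := h1a i i hi.1 (h2a i i hi.1 hc)
    rw [hP i i hi.1 hi.2 (lt i hi)] at h1
    rcases h1 with h1 | h1
    · exact hA.sol.irr i (hEA i i hi hi h1)
    · have := hQP i i hi hi h1.1
      rw [st.irrP i hi] at this; simp at this
  · intro a b ha hb hab
    rw [hT a b ha.1 ha.2 (lt b hb)] at hab
    rcases hab with h | ⟨rfl, h | rfl⟩ | ⟨rfl, h | rfl⟩ | ⟨rfl, h | rfl⟩ | ⟨rfl, h | rfl⟩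
    · rcases st.T a b ha hb h with h | h | ⟨c, hc, h1, h2⟩ | h
      · exact Or.inl h
      · exact Or.inr (Or.inl (hEE _ _ ha hb h))
      · exact Or.inr (Or.inr (Or.inl ⟨c, hc, hEE _ _ ha hc h1, hEE _ _ hc hb h2⟩))
      · exact Or.inr (Or.inr (Or.inr h))
    · exact Or.inr (Or.inr (Or.inl ⟨v, hv, hEE _ _ ha hv h, eVW⟩))
    · exact Or.inr (Or.inl eVW)
    · exact Or.inr (Or.inr (Or.inl ⟨v, hv, eWV, hEE _ _ hv hb h⟩))
    · exact Or.inr (Or.inl eWV)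
    · exact Or.inr (Or.inr (Or.inl ⟨w, hw, hEE _ _ ha hw h, eWV⟩))
    · exact Or.inr (Or.inl eWV)
    · exact Or.inr (Or.inr (Or.inl ⟨w, hw, eVW, hEE _ _ hw hb h⟩))
    · exact Or.inr (Or.inl eVW)
  · have gen : ∀ t R R' , InV n t → (∀ i j, A i j → B R i j = true) → (∀ i j, 2 ≤ i → i < n → j < 32 → B R i j = true → B R' i j = false → 
       popGe (row UC t >>> 29) (row E' t) = true ∧ B E' i j = false ∧ (i = t ∨ j = t)) → ∀ i j, A i j → B R' i j = true := by
      intro t R R' ht hR hRR i j hij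
      by_contra hc
      rw [Bool.not_eq_true] at hc
      obtain ⟨hi, hj⟩ := hA.sol.sup _ _ hij
      obtain ⟨h1, h2, h3⟩ := hRR i j hi.1 hi.2 (lt j hj) (hR i j hij) hc
      rcases h3 with rfl | rfl
      · rw [satA i hi h1 j hij] at h2; simp at h2
      · have := symE' _ _ hj hi (satA j hj h1 i (hA.sol.symm _ _ hij))
        rw [this] at h2; simp at h2
    exact gen w P1 P2 hw (gen v P' P1 hv hAP' h1b) h2b

theorem pick_spec {α : Type} (o : ℕ) (fl : List (ℕ × List Sw)) (k : ℕ → List Sw → α) :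
    ∃ m s, pick o fl k = k m s ∧ ((m, s) ∈ fl ∨ (m = 0 ∧ s = [])) := by
  induction fl with
  | nil => exact ⟨0, [], rfl, Or.inr ⟨rfl, rfl⟩⟩
  | cons p fl ih =>
    obtain ⟨m, s⟩ := p
    have e : pick o ((m, s) :: fl) k = ite' (Nat.beq (Nat.land o m) (nat_lit 0)) (pick o fl k) (k m s) := rfl
    rw [e, ite'_eq]
    split_ifs
    · obtain ⟨m', s', h1, h2⟩ := ih
      refine ⟨m', s', h1, ?_⟩
      rcases h2 with h | h
      · exact Or.inl (by simp [h])
      · exact Or.inr h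
    · exact ⟨m, s, rfl, Or.inl (by simp)⟩

def loopA (COL UC : Nat) (fs : List (Nat × Nat × Nat)) (cs : List (Nat × Nat × Nat)) (rec : Nat → Nat → Nat → Nat → Bool)
    (E P T v om : Nat) (sws : List Sw) (f : Nat) (Q : Nat) : Bool :=
  Nat.rec (motive := fun _ => Nat → Bool) (fun _ => false)
          (fun _ loop Q =>
            force (Nat.land (row Q v) om) fun r =>
            ite' (Nat.beq r (nat_lit 0))
              (force (cnt COL Q fs) fun c => ite' (check COL c cs) (rec E Q T c) true)
              (force (low r) fun w =>
                ite' (bit r w)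
                (ite' (addE COL v w E Q T fun E' P' T' =>
                    satur COL UC E' P' v fun P' => satur COL UC E' P' w fun P' =>
                    force (cnt COL P' fs) fun c => ite' (check COL c cs) (rec E' P' T' c) true)
                  (force (twins COL E P UC w (Nat.land r (Nat.sub r (nat_lit 1))) (Nat.shiftLeft (nat_lit 1) w)) fun R =>
                   force (blocks v E P (row P v) sws R) fun R => force (remV v R Q) loop)
                  false) false))
          f Q

theorem loopA_succ (COL UC : Nat) (fs : List (Nat × Nat × Nat)) (cs : List (Nat × Nat × Nat)) (rec : Nat → Nat → Nat → Nat → Bool)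
    (E P T v om : Nat) (sws : List Sw) (f : Nat) (Q : Nat) : loopA COL UC fs cs rec E P T v om sws (f + 1) Q =
     ite' (Nat.beq (Nat.land (row Q v) om) (nat_lit 0))
              (ite' (check COL (cnt COL Q fs) cs) (rec E Q T (cnt COL Q fs)) true)
              (ite' (bit (Nat.land (row Q v) om) (low (Nat.land (row Q v) om)))
                (ite' (addE COL v (low (Nat.land (row Q v) om)) E Q T fun E' P' T' =>
                    satur COL UC E' P' v fun P' => satur COL UC E' P' (low (Nat.land (row Q v) om)) fun P' =>
                    ite' (check COL (cnt COL P' fs) cs) (rec E' P' T' (cnt COL P' fs)) true)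
                  (loopA COL UC fs cs rec E P T v om sws f (remV v
                    (blocks v E P (row P v) sws (twins COL E P UC (low (Nat.land (row Q v) om)) (Nat.land (Nat.land (row Q v) om) (Nat.sub (Nat.land (row Q v) om) (nat_lit 1))) (Nat.shiftLeft (nat_lit 1) (low (Nat.land (row Q v) om)))))
                     Q))
                  false) false) := rfl

theorem run_succ0 (COL UC NM : Nat) (H : Heur) (fs : List (Nat × Nat × Nat)) (cs : List (Nat × Nat × Nat)) (fl : List (Nat × List Sw))
   (fuel E P T c : Nat) : run COL UC NM H fs cs fl (fuel + 1) E P T c = 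
      force (Nat.xor P E) fun O =>
      force (choose COL P c O H) fun v =>
      ite' (Nat.ble (nat_lit 2) v) (ite' (Nat.ble v NM) (
      force (row O v) fun o =>
      pick o fl fun m sws =>
        force (Nat.land o m) fun om =>
        loopA COL UC fs cs (run COL UC NM H fs cs fl fuel) E P T v om sws 7 P) false) false := rfl

theorem force_eq2 {α : Type} (x : ℕ) (k : ℕ → α) : force x k = k x := by
  have h := force_eq x k
  rw [h]

theorem run_succ (COL UC NM : Nat) (H : Heur) (fs : List (Nat × Nat × Nat)) (cs : List (Nat × Nat × Nat)) (fl : List (Nat × List Sw))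
   (fuel E P T c : Nat) : run COL UC NM H fs cs fl (fuel + 1) E P T c = 
      ite' (Nat.ble (nat_lit 2) (choose COL P c (Nat.xor P E) H)) (ite' (Nat.ble (choose COL P c (Nat.xor P E) H) NM) (
      pick (row (Nat.xor P E) (choose COL P c (Nat.xor P E) H)) fl fun m sws =>
        loopA COL UC fs cs (run COL UC NM H fs cs fl fuel) E P T (choose COL P c (Nat.xor P E) H) (Nat.land (row (Nat.xor P E) (choose COL P c (Nat.xor P E) H)) m) sws 7 P) false) false := by
  rw [run_succ0]
  simp only [force_eq2]

theorem loop_sound {n UC E P T : ℕ} {fs cs : List (ℕ × ℕ × ℕ)} {fl : List (ℕ × List Sw)} (wf : WF n UC fs cs fl) (st : St n UC E P T) {v m : ℕ}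
   (hv : InV n v) (sws : List Sw) (hsw : ∀ s ∈ sws, SwOK n UC s) (hm : ∀ j, m.testBit j = true → InV n j)
   (rec : Nat → Nat → Nat → Nat → Bool)
   (hrec : ∀ E P T c, St n UC E P T → rec E P T c = true → ∀ A, ¬ Nd n UC cs E P A) (f Q : ℕ)
   (hQP : ∀ i j, InV n i → B Q i j = true → B P i j = true)
   (hQ : ∀ A, Nd n UC cs E P A → Nd n UC cs E Q A)
   (h : loopA (colOf n) UC fs cs rec E P T v (Nat.land (row (Nat.xor P E) v) m) sws f Q = true) (A : ℕ → ℕ → Prop) : ¬ Nd n UC cs E P A := by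
  have hn := wf.hn
  have lt : ∀ i, InV n i → i < 32 := fun i hi => by unfold InV at hi; omega
  induction f generalizing Q with
  | zero => exact absurd h (by show ¬ (false = true); simp)
  | succ f ih =>
    intro hA
    rw [loopA_succ, ite'_eq] at h
    split_ifs at h with h0
    · rw [ite'_eq] at h
      split_ifs at h with h1
      · refine hrec E Q T _ ⟨st.supE, st.symE, ?_, st.T⟩ h A (hQ A hA)
        intro i hi
        by_contra hc
        rw [Bool.not_eq_false] at hc
        have := hQP i i hi hc
        rw [st.irrP i hi] at this; simp at this
      · exact check_sound wf (by simpa using h1) A (hQ A hA)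
    · rw [ite'_eq] at h
      split_ifs at h with hb
      rw [ite'_eq] at h
      split_ifs at h with hadd
      set w := low (Nat.land (row Q v) (Nat.land (row (Nat.xor P E) v) m)) with hwdef
      rw [bit_eq] at hb
      have e1 : (Nat.land (row Q v) (Nat.land (row (Nat.xor P E) v) m)).testBit w = 
         ((row Q v).testBit w && ((row (Nat.xor P E) v).testBit w && m.testBit w)) := by
        have e : Nat.land (row Q v) (Nat.land (row (Nat.xor P E) v) m) = (row Q v) &&& ((row (Nat.xor P E) v) &&& m) := rfl
        rw [e, Nat.testBit_and, Nat.testBit_and]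
      rw [e1, row_bit, row_bit] at hb
      simp only [Bool.and_eq_true] at hb
      have hw : InV n w := hm w hb.2.2
      have hPvw := hQP v w hv hb.1.1
      have hvw : v ≠ w := by
        intro e; rw [← e, st.irrP v hv] at hPvw; simp at hPvw
      have hbad : Bad n UC cs E P v w := step_sound wf st hv hw hvw (fun i j hi _ => hQP i j hi) hQ 
        (fun E' P' T' => ite' (check (colOf n) (cnt (colOf n) P' fs) cs) (rec E' P' T' (cnt (colOf n) P' fs)) true)
        (by
          intro E' P' T' st' hk A
          rw [ite'_eq] at hk
          split_ifs at hk with h1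
          · exact hrec _ _ _ _ st' hk A
          · exact check_sound wf (by simpa using h1) A) hadd
      have hR1 : RInv n UC cs E P v (Nat.shiftLeft (nat_lit 1) w) := by
        refine ⟨one_lt (lt w hw), ?_⟩
        intro x hx
        rw [one_bit, decide_eq_true_eq] at hx
        rw [hx]; exact hbad
      have hR2 := blocks_spec wf (rv := row P v) sws hsw _ (twins_spec wf hw (Ne.symm hvw) hbad (Nat.land (Nat.land (row Q v) (Nat.land (row (Nat.xor P E) v) m)) (Nat.sub (Nat.land (row Q v) (Nat.land (row (Nat.xor P E) v) m)) (nat_lit 1))) _ hR1)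
      obtain ⟨q1, q2⟩ := remV_spec v _ Q (lt v hv) hR2.1
      refine ih _ ?_ ?_ h hA
      · intro i j hi hij
        exact hQP i j hi (q1 i j hi.1 hij)
      · intro A hA
        have hA' := hQ A hA
        refine ⟨hA.sol, hA.le, ?_⟩
        intro i j hij
        by_contra hc
        rw [Bool.not_eq_true] at hc
        obtain ⟨hi, hj⟩ := hA.sol.sup _ _ hij
        rcases q2 i j hi.1 (lt i hi) (lt j hj) (hA'.ge i j hij) hc with ⟨e, h⟩ | ⟨e, h⟩
        · rw [e] at hij; exact hR2.2 _ h A hA hij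
        · rw [e] at hij; exact hR2.2 _ h A hA (hA.sol.symm _ _ hij)

theorem run_sound {n UC NM : ℕ} {H : Heur} {fs cs : List (ℕ × ℕ × ℕ)} {fl : List (ℕ × List Sw)} (wf : WF n UC fs cs fl) (hNM : NM + 1 = n)
    (f E P T c : ℕ) (st : St n UC E P T) (h : run (colOf n) UC NM H fs cs fl f E P T c = true) (A : ℕ → ℕ → Prop) : ¬ Nd n UC cs E P A := by
  induction f generalizing E P T c A with
  | zero => exact absurd h (by show ¬ (false = true); simp)
  | succ f ih =>
    rw [run_succ, ite'_eq] at h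
    split_ifs at h with h1
    rw [ite'_eq] at h
    split_ifs at h with h2
    rw [Nat.ble_eq] at h1 h2
    obtain ⟨m, s, e, hp⟩ := pick_spec (row (Nat.xor P E) (choose (colOf n) P c (Nat.xor P E) H)) fl (fun m sws =>
        loopA (colOf n) UC fs cs (run (colOf n) UC NM H fs cs fl f) E P T (choose (colOf n) P c (Nat.xor P E) H) (Nat.land (row (Nat.xor P E) (choose (colOf n) P c (Nat.xor P E) H)) m) sws 7 P)
    rw [e] at h
    have hv : InV n (choose (colOf n) P c (Nat.xor P E) H) := ⟨h1, by omega⟩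
    have hms : (∀ j, m.testBit j = true → InV n j) ∧ ∀ t ∈ s, SwOK n UC t := by
      rcases hp with hp | ⟨rfl, rfl⟩
      · exact wf.hfl _ hp
      · simp
    exact loop_sound wf st hv s hms.2 hms.1 _ (fun E P T c st h A => ih E P T c st h A) 7 P (fun i j _ h => h) (fun A h => h) h A

end
end Eng
end

section
open Finset
namespace Eng

structure Spec where
  sp : List (List (ℕ × ℕ))
  useU : Bool
  bud : ℕ
  pre : List (ℕ × ℕ)
  non : List (ℕ × ℕ)
  prio : List ℕ

structure Data where
  n : ℕ
  COL : ℕ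
  UC : ℕ
  NM : ℕ
  H : Heur
  fs : List (ℕ × ℕ × ℕ)
  cs : List (ℕ × ℕ × ℕ)
  fl : List (ℕ × List Sw)
  E : ℕ
  P : ℕ
  T : ℕ
  c : ℕ

def flat : List (List (ℕ × ℕ)) → ℕ → List (ℕ × ℕ × ℕ)
  | [], _ => []
  | l :: sp, k => l.map (fun p => (k, p)) ++ flat sp (k + 1)

def forceL {β γ : Type} (f : β → (γ → Bool) → Bool) : List β → (List γ → Bool) → Bool
  | [], k => k []
  | b :: l, k => f b fun c => forceL f l fun cs => k (c :: cs)

def pk : List ℕ → ℕ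
  | [] => 0
  | a :: l => a + 2 ^ 32 * pk l

def lanes (l : List ℕ) : ℕ := 2 ^ 64 * pk l

def starts : List (List (ℕ × ℕ)) → ℕ → List (ℕ × List (ℕ × ℕ))
  | [], _ => []
  | l :: sp, s => (s, l) :: starts sp (s + l.length)

def tabl : ℕ → ℕ
  | 0 => 0
  | i + 1 => tabl i + i <<< (6 * (2 ^ (32 * i) % 59))

def f3 (a b c : ℕ) (k : ℕ × ℕ × ℕ → Bool) : Bool := force a fun a => force b fun b => force c fun c => k (a, b, c)

def mk (s : Spec) (k : Data → Bool) : Bool :=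
  force (2 + (flat s.sp 0).length) fun n =>
  force (lanes (List.replicate (n - 2) 1)) fun COL =>
  forceL (fun (p : ℕ × List (ℕ × ℕ)) k => f3 p.1 (COL * (2 ^ p.2.length - 1)) p.2.length k) (starts s.sp 2) fun fs =>
  force (lanes (fs.flatMap fun f => List.replicate f.2.2 ((2 ^ f.2.2 - 1) <<< f.1))) fun SF =>
  force (SF + lanes ((flat s.sp 0).map fun q => q.2.1 <<< 26 + q.2.2 <<< 29)) fun UC =>
  force (s.pre.foldr (fun e x => x + 2 ^ (32 * e.1 + e.2) + 2 ^ (32 * e.2 + e.1)) 0) fun E =>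
  force (COL * (2 ^ n - 4) - SF - s.non.foldr (fun e x => x + 2 ^ (32 * e.1 + e.2) + 2 ^ (32 * e.2 + e.1)) 0) fun P =>
  force (SF ||| E) fun T =>
  force (2 ^ 64 - 1 + lanes ((flat s.sp 0).map fun q => 32 + q.2.1)) fun THL =>
  force (2 ^ 64 - 1 + lanes ((flat s.sp 0).map fun q => 32 + q.2.2)) fun THU =>
  forceL (fun (p : ℕ × ℕ × ℕ) k => f3 p.1 p.2.1 p.2.2 k) ((26, THL, 0) :: (if s.useU then [(29, THU, s.bud)] else [])) fun cs =>
  force (2 ^ 63 + lanes ((flat s.sp 0).map fun q => 960 + 2 * q.2.1)) fun KO =>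
  force (COL * (2 ^ 31 - 1)) fun MX =>
  force (COL * 0x55555555) fun M1 =>
  force (COL * 0x33333333) fun M2 =>
  force (COL * 0x0f0f0f0f) fun M4 =>
  force (COL * 63) fun M6 =>
  force (tabl 29) fun TAB =>
  forceL (fun p k => force p k) s.prio fun prio =>
  forceL (fun (p : ℕ × List (ℕ × ℕ)) k => force ((2 ^ p.2.length - 1) <<< p.1) fun m =>
    forceL (fun (q : ℕ × List (ℕ × ℕ)) k => force (min p.1 q.1) fun a => force p.2.length fun kk => force (max p.1 q.1 - min p.1 q.1) fun d =>
       force ((2 ^ kk - 1) <<< a) fun mA => force (COL * mA) fun c => force ((2 ^ (32 * kk) - 1) <<< (32 * a)) fun r => k (Sw.mk a kk d mA c r))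
      ((starts s.sp 2).filter fun q => q.2 == p.2 && q.1 != p.1) fun sw => k (m, sw)) (starts s.sp 2).reverse fun fl =>
  force (cnt COL P fs) fun c =>
  force (n - 1) fun NM =>
  k ⟨n, COL, UC, NM, ⟨KO, MX, M1, M2, M4, M6, TAB, prio⟩, fs, cs, fl, E, P, T, c⟩

def WFa (s : Spec) (d : Data) : Prop :=
  d.n ≤ 26 ∧ 2 ≤ d.n ∧ (flat s.sp 0).length + 2 = d.n ∧ d.COL = colOf d.n ∧ d.NM + 1 = d.n ∧
    d.fs.length ≤ 26 ∧ (∀ f ∈ d.fs, f.2.1 = colOf d.n * (2 ^ f.2.2 - 1) ∧ f.1 + f.2.2 ≤ d.n)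
def WFb (s : Spec) (d : Data) : Prop :=
  ∀ i < d.n, 2 ≤ i → ((∀ j < d.n, 2 ≤ j → B d.UC i j = ((flat s.sp 0).getD (i - 2) (0, 0, 0)).1.beq ((flat s.sp 0).getD (j - 2) (0, 0, 0)).1) ∧
     (row d.UC i >>> 26) % 8 = ((flat s.sp 0).getD (i - 2) (0, 0, 0)).2.1 ∧ row d.UC i >>> 29 = ((flat s.sp 0).getD (i - 2) (0, 0, 0)).2.2)
def WFc (d : Data) : Prop :=
  (∀ j < d.n, 2 ≤ j → ∃ f ∈ d.fs, f.1 ≤ j ∧ j < f.1 + f.2.2) ∧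
  (∀ f ∈ d.fs, ∀ a < f.1 + f.2.2, f.1 ≤ a → ∀ b < f.1 + f.2.2, f.1 ≤ b → B d.UC a b = true)
def WFd (s : Spec) (d : Data) : Prop :=
  ∀ f ∈ d.cs, row f.2.1 0 = 4294967295 ∧ row f.2.1 1 = 4294967295 ∧ (f.1 = 26 ∨ f.1 = 29 ∧ s.bud ≤ f.2.2) ∧
     (∀ i < d.n, 2 ≤ i → row f.2.1 i = 32 + (row d.UC i >>> f.1) % 8)
def WFe (d : Data) : Prop :=
  ∀ p ∈ d.fl, p.1 < 2 ^ d.n ∧ p.1 % 4 = 0 ∧ ∀ t ∈ p.2, t.k ≤ t.d ∧ 2 ≤ t.a ∧ t.a + t.d + t.k ≤ d.n ∧ t.m = (2 ^ t.k - 1) <<< t.a ∧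
      t.c = colOf d.n * t.m ∧ t.r = (2 ^ (32 * t.k) - 1) <<< (32 * t.a) ∧ swInv t.d t.c t.r d.UC = true
def pf (s : Spec) (E n i j : ℕ) : Bool := !(B E i j) || (Nat.ble 2 j && Nat.blt j n && B E j i && ((i, j) ∈ s.pre ∨ (j, i) ∈ s.pre))
def pg (s : Spec) (P UC i j : ℕ) : Bool := B P i j || B UC i j || ((i, j) ∈ s.non ∨ (j, i) ∈ s.non)
def ph (T E UC i j : ℕ) : Bool := !(B T i j) || Nat.beq i j || B E i j || B UC i j
def WFf (s : Spec) (d : Data) : Prop := ∀ i < d.n, 2 ≤ i → ∀ j < 32, pf s d.E d.n i j = true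
def WFg (s : Spec) (d : Data) : Prop := ∀ i < d.n, 2 ≤ i → B d.P i i = false ∧ ∀ j < d.n, 2 ≤ j → pg s d.P d.UC i j = true
def WFh (d : Data) : Prop := ∀ i < d.n, 2 ≤ i → ∀ j < d.n, 2 ≤ j → ph d.T d.E d.UC i j = true
def WFP (s : Spec) (d : Data) : Prop := WFa s d ∧ WFb s d ∧ WFc d ∧ WFd s d ∧ WFe d ∧ WFf s d ∧ WFg s d ∧ WFh d

instance (s : Spec) (d : Data) : Decidable (WFa s d) := by unfold WFa; infer_instance
instance (s : Spec) (d : Data) : Decidable (WFb s d) := by unfold WFb; infer_instance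
instance (d : Data) : Decidable (WFc d) := by unfold WFc; infer_instance
instance (s : Spec) (d : Data) : Decidable (WFd s d) := by unfold WFd; infer_instance
instance (d : Data) : Decidable (WFe d) := by unfold WFe; infer_instance
instance (s : Spec) (d : Data) : Decidable (WFf s d) := by unfold WFf; infer_instance
instance (s : Spec) (d : Data) : Decidable (WFg s d) := by unfold WFg; infer_instance
instance (d : Data) : Decidable (WFh d) := by unfold WFh; infer_instance
instance (s : Spec) (d : Data) : Decidable (WFP s d) := by unfold WFP; infer_instance

noncomputable def runSpec (s : Spec) : Bool :=
  mk s fun d => ite' (decide (WFP s d)) (run d.COL d.UC d.NM d.H d.fs d.cs d.fl 200 d.E d.P d.T d.c) false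

theorem forceL_ex {β γ : Type} (f : β → (γ → Bool) → Bool) (hf : ∀ b, ∃ c, ∀ k, f b k = k c) (l : List β) : ∃ cs, ∀ k, forceL f l k = k cs := by
  induction l with
  | nil => exact ⟨[], fun k => rfl⟩
  | cons b l ih =>
    obtain ⟨c, hc⟩ := hf b
    obtain ⟨cs, hcs⟩ := ih
    refine ⟨c :: cs, fun k => ?_⟩
    rw [forceL, hc, hcs]

end Eng
end

section
open Finset
namespace Eng

def HasVal {γ : Type} (m : (γ → Bool) → Bool) : Prop := ∃ c, ∀ k, m k = k c

theorem HasVal.pure {γ : Type} (c : γ) : HasVal (fun k => k c) := ⟨c, fun _ => rfl⟩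
theorem HasVal.force {γ : Type} (x : ℕ) (g : ℕ → (γ → Bool) → Bool) (h : ∀ y, HasVal (g y)) : HasVal (fun k => force x fun y => g y k) := by
  obtain ⟨c, hc⟩ := h x
  exact ⟨c, fun k => by beta_reduce; rw [force_eq, hc]⟩
theorem HasVal.forceL {β δ γ : Type} (f : β → (δ → Bool) → Bool) (hf : ∀ b, HasVal (f b)) (l : List β) (g : List δ → (γ → Bool) → Bool)
    (h : ∀ y, HasVal (g y)) : HasVal (fun k => forceL f l fun y => g y k) := by
  obtain ⟨cs, hcs⟩ := forceL_ex f hf l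
  obtain ⟨c, hc⟩ := h cs
  exact ⟨c, fun k => by beta_reduce; rw [hcs, hc]⟩
theorem HasVal.f3 (a b c : ℕ) : HasVal (f3 a b c) := by
  unfold Eng.f3
  refine HasVal.force _ _ fun _ => HasVal.force _ _ fun _ => HasVal.force _ _ fun _ => HasVal.pure _

theorem mk_ex (s : Spec) : HasVal (mk s) := by
  unfold mk
  refine .force _ _ fun n => .force _ _ fun COL => .forceL _ (fun b => .f3 _ _ _) _ _ fun fs => .force _ _ fun SF => .force _ _ fun UC => .force _ _ fun E =>
    .force _ _ fun P => .force _ _ fun T => .force _ _ fun THL => .force _ _ fun THU => .forceL _ (fun b => .f3 _ _ _) _ _ fun cs => .force _ _ fun KO =>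
    .force _ _ fun MX => .force _ _ fun M1 => .force _ _ fun M2 => .force _ _ fun M4 => .force _ _ fun M6 => .force _ _ fun TAB =>
    .forceL _ (fun b => .force _ _ fun _ => .pure _) _ _ fun prio => .forceL _ (fun b => ?_) _ _ fun fl => .force _ _ fun c => .force _ _ fun NM => .pure _
  refine .force _ _ fun m => .forceL _ (fun b => ?_) _ _ fun sw => .pure _
  exact .force _ _ fun a => .force _ _ fun kk => .force _ _ fun d => .force _ _ fun mA => .force _ _ fun c => .force _ _ fun r => .pure _

theorem WFP.wf {s : Spec} {d : Data} (h : WFP s d) : WF d.n d.UC d.fs d.cs d.fl := by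
  obtain ⟨⟨hn, hn2, hl, hC, hN, hf1, hf2⟩, hb, ⟨hc1, hc2⟩, hd, he, hf, hg, hh⟩ := h
  refine ⟨hn, hn2, ?_, ⟨hf1, hf2⟩, ?_, ?_, ?_, ?_⟩
  · intro i j hi hj h
    rw [(hb i hi.2 hi.1).1 j hj.2 hj.1] at h
    rw [(hb j hj.2 hj.1).1 i hi.2 hi.1]
    simp only [Nat.beq_eq] at h ⊢
    exact h.symm
  · intro j hj; exact hc1 j hj.2 hj.1
  · intro f hf a b h1 h2 h3 h4; exact hc2 f hf a h2 h1 b h4 h3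
  · intro f hf
    obtain ⟨h1, h2, h3, h4⟩ := hd f hf
    exact ⟨h1, h2, by omega, fun i hi => h4 i hi.2 hi.1⟩
  · intro p hp
    obtain ⟨h1, h2, h3⟩ := he p hp
    refine ⟨fun j hj => ⟨?_, ?_⟩, fun t ht => ?_⟩
    · by_contra hj2
      have e : (p.1 % 2 ^ 2).testBit j = true := by rw [Nat.testBit_mod_two_pow]; simp [hj]; omega
      rw [show p.1 % 2 ^ 2 = 0 from h2] at e
      simp at e
    · by_contra hj2
      rw [Nat.testBit_lt_two_pow (lt_of_lt_of_le h1 (Nat.pow_le_pow_right (by norm_num) (by omega)))] at hj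
      exact absurd hj (by simp)
    · obtain ⟨a, b, c, d, e, f, g⟩ := h3 t ht
      exact ⟨a, b, c, d, e, f, g⟩

theorem WFP.st {s : Spec} {d : Data} (h : WFP s d) : St d.n d.UC d.E d.P d.T := by
  obtain ⟨⟨hn, hn2, hl, hC, hN, hf1, hf2⟩, hb, ⟨hc1, hc2⟩, hd, he, hf, hg, hh⟩ := h
  have hf' : ∀ i j, InV d.n i → j < 32 → B d.E i j = true → (2 ≤ j ∧ j < d.n) ∧ B d.E j i = true := by
    intro i j hi hj h
    have := hf i hi.2 hi.1 j hj
    simp only [pf, h, Bool.not_true, Bool.false_or, Bool.and_eq_true, Nat.ble_eq, Nat.blt_eq] at this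
    tauto
  refine ⟨?_, ?_, ?_, ?_⟩
  · intro i j hi hj h; exact (hf' i j hi hj h).1
  · intro i j hi hj h; exact (hf' i j hi (by have := hj.2; omega) h).2
  · intro i hi; exact (hg i hi.2 hi.1).1
  · intro a b ha hb h
    have := hh a ha.2 ha.1 b hb.2 hb.1
    simp only [ph, h, Bool.not_true, Bool.false_or, Bool.or_eq_true, Nat.beq_eq] at this
    tauto

end Eng
end

section
open Finset
namespace Eng
noncomputable section
open Classical

theorem sum_getD {α : Type*} (f : α → ℕ) (l : List α) (d : α) : ∑ i ∈ range l.length, f (l.getD i d) = (l.map f).sum := by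
  induction l with
  | nil => simp
  | cons a l ih =>
    rw [List.length_cons, Finset.sum_range_succ']
    simp only [List.getD_cons_succ, List.getD_cons_zero, List.map_cons, List.sum_cons]
    rw [ih, add_comm]

theorem sum_Ico_getD {α : Type*} (f : α → ℕ) (l : List α) (d : α) (n : ℕ) (hn : l.length + 2 = n) : ∑ i ∈ Ico 2 n, f (l.getD (i - 2) d) = (l.map f).sum := by
  rw [← sum_getD f l d, Finset.sum_Ico_eq_sum_range]
  have : n - 2 = l.length := by omega
  rw [this]
  apply Finset.sum_congr rfl
  intro i _
  rw [show 2 + i - 2 = i by omega]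

theorem mem_dg (A : ℕ → ℕ → Prop) (i j : ℕ) : j ∈ (range 32).filter (A i) ↔ j < 32 ∧ A i j := by
  rw [Finset.mem_filter, Finset.mem_range]

theorem iface0 {s : Spec} (h : runSpec s = true) {V : Type*} (G : SimpleGraph V) (L : List V) (c : V → ℕ) (hnd : L.Nodup)
    (dl : V → ℕ) (hdl : ∀ v ∈ L, dl v = (L.toFinset.filter (G.Adj v)).card)
    (hF : List.Forall₂ (fun v (q : ℕ × ℕ × ℕ) => c v = q.1 ∧ q.2.1 ≤ dl v ∧ dl v ≤ q.2.2) L (flat s.sp 0))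
    (hc : ∀ v ∈ L, ∀ a ∈ L, ∀ b ∈ L, c a = c b → G.Adj v a → G.Adj v b → a = b)
    (hi : ∀ a ∈ L, ∀ b ∈ L, c a = c b → ¬ G.Adj a b)
    (tri : ∀ a b c, G.Adj a b → G.Adj b c → G.Adj a c → False)
    (c4 : ∀ a b c d, G.Adj a b → G.Adj b c → G.Adj c d → G.Adj d a → a = c ∨ b = d)
    (bud : ((flat s.sp 0).map (fun q => q.2.2)).sum ≤ (L.map dl).sum + s.bud)
    (pre : ∀ e ∈ s.pre, ∀ a b, L[e.1 - 2]? = some a → L[e.2 - 2]? = some b → G.Adj a b)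
    (non : ∀ e ∈ s.non, ∀ a b, L[e.1 - 2]? = some a → L[e.2 - 2]? = some b → ¬ G.Adj a b) : False := by
  obtain ⟨d, hd⟩ := mk_ex s
  rw [runSpec, hd, ite'_eq] at h
  split_ifs at h with hw
  replace hw : WFP s d := of_decide_eq_true hw
  have wf := hw.wf
  have st := hw.st
  obtain ⟨⟨hn, hn2, hl, hC, hN, hf1, hf2⟩, hb, ⟨hc1, hc2⟩, hcs, he, hf, hg, hh⟩ := hw
  rw [hC] at h
  have hlen : L.length + 2 = d.n := by rw [hF.length_eq]; exact hl
  let A : ℕ → ℕ → Prop := fun i j => InV d.n i ∧ InV d.n j ∧ ∃ a b, L[i - 2]? = some a ∧ L[j - 2]? = some b ∧ G.Adj a b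
  refine run_sound wf hN _ _ _ _ _ st h A ?_
  have inj : ∀ i j a, InV d.n i → InV d.n j → L[i - 2]? = some a → L[j - 2]? = some a → i = j := by
    intro i j a hi hj h1 h2
    have := List.getElem?_inj (l := L) (i := i - 2) (j := j - 2) (by have := hi.2; have := hi.1; omega) hnd |>.1 (h1.trans h2.symm)
    have := hi.1; have := hj.1; omega
  have ex : ∀ i, InV d.n i → ∃ v, v ∈ L ∧ L[i - 2]? = some v ∧ L.getD (i - 2) v = v ∧ c v = ((flat s.sp 0).getD (i - 2) (0, 0, 0)).1 ∧ ((flat s.sp 0).getD (i - 2) (0, 0, 0)).2.1 ≤ dl v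
      ∧ dl v ≤ ((flat s.sp 0).getD (i - 2) (0, 0, 0)).2.2 := by
    intro i hi
    have hi2 : i - 2 < L.length := by have := hi.2; have := hi.1; omega
    have hi3 : i - 2 < (flat s.sp 0).length := by rw [← hF.length_eq]; exact hi2
    have := hF.get hi2 hi3
    refine ⟨L[i - 2], List.getElem_mem hi2, List.getElem?_eq_getElem hi2, ?_, ?_⟩
    · rw [List.getD_eq_getElem _ _ hi2]
    · rw [List.getD_eq_getElem _ _ hi3]; exact this
  have ofmem : ∀ v ∈ L, ∃ i, InV d.n i ∧ L[i - 2]? = some v := by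
    intro v hv
    obtain ⟨i, hi, rfl⟩ := List.mem_iff_getElem.1 hv
    exact ⟨i + 2, ⟨by omega, by omega⟩, by simp [hi]⟩
  have col : ∀ i j a b, InV d.n i → InV d.n j → L[i - 2]? = some a → L[j - 2]? = some b → B d.UC i j = true → c a = c b := by
    intro i j a b hi hj ha hb' h
    rw [(hb i hi.2 hi.1).1 j hj.2 hj.1, Nat.beq_eq] at h
    obtain ⟨a', -, ha', -, e1, -⟩ := ex i hi
    obtain ⟨b', -, hb'', -, e2, -⟩ := ex j hj
    rw [ha] at ha'; rw [hb'] at hb''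
    cases ha'; cases hb''
    rw [e1, e2, h]
  have hdg : ∀ i v, InV d.n i → L[i - 2]? = some v → dg A i = dl v := by
    intro i v hi hv
    have hvL : v ∈ L := List.mem_of_getElem? hv
    rw [hdl v hvL, dg]
    refine Finset.card_bij (fun j _ => L.getD (j - 2) v) ?_ ?_ ?_
    · intro j hj
      replace hj := (mem_dg A i j).1 hj
      obtain ⟨-, -, hjV, a, b, h1, h2, h3⟩ := hj
      rw [hv] at h1; cases h1
      simp only [Finset.mem_filter, List.mem_toFinset, List.getD_eq_getElem?_getD, h2, Option.getD_some]
      exact ⟨List.mem_of_getElem? h2, h3⟩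
    · intro j hj j' hj' e
      replace hj := (mem_dg A i j).1 hj
      obtain ⟨-, -, hjV, a, b, h1, h2, h3⟩ := hj
      replace hj' := (mem_dg A i j').1 hj'
      obtain ⟨-, -, hjV', a', b', h1', h2', h3'⟩ := hj'
      simp only [List.getD_eq_getElem?_getD, h2, h2', Option.getD_some] at e
      subst e
      exact inj _ _ _ hjV hjV' h2 h2'
    · intro b hb
      obtain ⟨hb1, hb2⟩ := Finset.mem_filter.1 hb
      obtain ⟨j, hj, hjb⟩ := ofmem b (List.mem_toFinset.1 hb1)
      refine ⟨j, (mem_dg A i j).2 ⟨by have := hj.2; omega, hi, hj, v, b, hv, hjb, hb2⟩, ?_⟩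
      simp only [List.getD_eq_getElem?_getD, hjb, Option.getD_some]
  constructor
  · constructor
    · rintro i j ⟨h1, h2, a, b, h3, h4, h5⟩; exact ⟨h2, h1, b, a, h4, h3, h5.symm⟩
    · rintro i ⟨h1, h2, a, b, h3, h4, h5⟩; rw [h3] at h4; cases h4; exact G.loopless.irrefl _ h5
    · rintro i j ⟨h1, h2, -⟩; exact ⟨h1, h2⟩
    · rintro i j k ⟨-, -, a, b, h1, h2, h3⟩ ⟨-, -, b', c', h4, h5, h6⟩ ⟨-, -, a', c'', h7, h8, h9⟩
      rw [h2] at h4; rw [h1] at h7; rw [h5] at h8; cases h4; cases h7; cases h8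
      exact tri _ _ _ h3 h6 h9
    · rintro i j k l ⟨hi, hj, a, b, h1, h2, h3⟩ ⟨-, hk, b', c', h4, h5, h6⟩ ⟨-, hl, c'', d', h7, h8, h9⟩ ⟨-, -, d'', a', h10, h11, h12⟩
      rw [h2] at h4; rw [h5] at h7; rw [h8] at h10; rw [h1] at h11; cases h4; cases h7; cases h10; cases h11
      rcases c4 _ _ _ _ h3 h6 h9 h12 with rfl | rfl
      · left; exact inj _ _ _ hi hk h1 h5
      · right; exact inj _ _ _ hj hl h2 h8
    · rintro v i j ⟨hv, hi, a, b, h1, h2, h3⟩ ⟨-, hj, a', b', h4, h5, h6⟩ hU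
      rw [h1] at h4; cases h4
      have := col i j b b' hi hj h2 h5 hU
      have := hc a (List.mem_of_getElem? h1) b (List.mem_of_getElem? h2) b' (List.mem_of_getElem? h5) this h3 h6
      subst this
      exact inj _ _ _ hi hj h2 h5
    · intro i hi
      obtain ⟨v, hv, h1, -, -, -, h2⟩ := ex i hi
      rw [hdg i v hi h1, (hb i hi.2 hi.1).2.2]; exact h2
    · intro f hf
      obtain ⟨-, -, h3, h4⟩ := hcs f hf
      rcases h3 with h3 | ⟨h3, hbud⟩
      · apply le_of_eq_of_le _ (Nat.zero_le _)
        apply Finset.sum_eq_zero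
        intro i hi
        have hi : InV d.n i := Finset.mem_Ico.1 hi
        obtain ⟨v, hv, h1, -, -, h2, -⟩ := ex i hi
        rw [hdg i v hi h1, h4 i hi.2 hi.1, h3, (hb i hi.2 hi.1).2.1]
        omega
      · have e0 : L ≠ [] ∨ L = [] := by tauto
        rcases e0 with e0 | e0
        swap
        · have : d.n = 2 := by rw [e0] at hlen; exact hlen.symm
          rw [this]; simp
        obtain ⟨v0, hv0⟩ := List.exists_mem_of_ne_nil L e0
        have e1 := sum_Ico_getD (fun q : ℕ × ℕ × ℕ => q.2.2) (flat s.sp 0) (0, 0, 0) d.n hl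
        have e2 := sum_Ico_getD dl L v0 d.n hlen
        have e3 : ∑ i ∈ Ico 2 d.n, ((row f.2.1 i - 32) - dg A i) + ∑ i ∈ Ico 2 d.n, dl (L.getD (i - 2) v0) = ∑ i ∈ Ico 2 d.n, ((flat s.sp 0).getD (i - 2) (0, 0, 0)).2.2 := by
          rw [← Finset.sum_add_distrib]
          apply Finset.sum_congr rfl
          intro i hi
          have hi : InV d.n i := Finset.mem_Ico.1 hi
          obtain ⟨v, hv, h1, -, -, -, h2⟩ := ex i hi
          have e5 : row d.UC i < 4294967296 := by
            unfold row
            exact lt_of_le_of_lt Nat.and_le_right (by norm_num)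
          have e6 : row d.UC i >>> 29 % 8 = row d.UC i >>> 29 := by
            apply Nat.mod_eq_of_lt
            rw [Nat.shiftRight_eq_div_pow]
            omega
          rw [hdg i v hi h1, h4 i hi.2 hi.1, h3, e6, (hb i hi.2 hi.1).2.2, List.getD_eq_getElem?_getD (l := L), h1, Option.getD_some]
          omega
        omega
  · intro i j hi hj hE
    have := hf i hi.2 hi.1 j (by have := hj.2; omega)
    simp only [pf, hE, Bool.not_true, Bool.false_or, Bool.and_eq_true, decide_eq_true_eq] at this
    obtain ⟨a, -, h1, -⟩ := ex i hi
    obtain ⟨b, -, h2, -⟩ := ex j hj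
    refine ⟨hi, hj, a, b, h1, h2, ?_⟩
    rcases this.2 with h3 | h3
    · exact pre _ h3 a b h1 h2
    · exact (pre _ h3 b a h2 h1).symm
  · rintro i j ⟨hi', hj, a, b, h1, h2, h3⟩
    have := (hg i hi'.2 hi'.1).2 j hj.2 hj.1
    simp only [pg, Bool.or_eq_true, decide_eq_true_eq] at this
    rcases this with (h4 | h4) | h4 | h4
    · exact h4
    · exact absurd h3 (hi a (List.mem_of_getElem? h1) b (List.mem_of_getElem? h2) (col i j a b hi' hj h1 h2 h4))
    · exact absurd h3 (non _ h4 a b h1 h2)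
    · exact absurd h3.symm (non _ h4 b a h2 h1)

end
end Eng
end

section
open Finset
namespace Eng
noncomputable section
open Classical

theorem flat_col {V : Type} (R : V → ℕ × ℕ → Prop) (flds : List (List V)) (sp : List (List (ℕ × ℕ))) (k : ℕ)
    (h : List.Forall₂ (List.Forall₂ R) flds sp) (hnd : flds.flatten.Nodup) :
    ∃ c : V → ℕ, (∀ v ∈ flds.flatten, k ≤ c v) ∧ List.Forall₂ (fun v (q : ℕ × ℕ × ℕ) => c v = q.1 ∧ R v q.2) flds.flatten (flat sp k) ∧
      ∀ a ∈ flds.flatten, ∀ b ∈ flds.flatten, c a = c b → ∃ l ∈ flds, a ∈ l ∧ b ∈ l := by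
  induction h generalizing k with
  | nil => exact ⟨fun _ => 0, by simp, by simp [flat], by simp⟩
  | @cons l p flds sp h1 h2 ih =>
    rw [List.flatten_cons, List.nodup_append'] at hnd
    obtain ⟨hn1, hn2, hdj⟩ := hnd
    obtain ⟨c, hc1, hc2, hc3⟩ := ih (k + 1) hn2
    have key : ∀ v ∈ flds.flatten, v ∉ l := fun v hv hl => hdj hl hv
    refine ⟨fun v => if v ∈ l then k else c v, ?_, ?_, ?_⟩
    · intro v hv
      rw [List.flatten_cons, List.mem_append] at hv
      beta_reduce
      split_ifs with hl
      · exact le_rfl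
      · have := hc1 v (by tauto); omega
    · rw [List.flatten_cons, flat]
      refine List.rel_append ?_ ?_
      · rw [List.forall₂_map_right_iff]
        rw [List.forall₂_iff_get] at h1 ⊢
        refine ⟨h1.1, fun i hi1 hi2 => ⟨?_, h1.2 i hi1 hi2⟩⟩
        beta_reduce
        rw [if_pos (List.get_mem l ⟨i, hi1⟩)]
      · have hc2' : List.Forall₂ (fun v (q : ℕ × ℕ × ℕ) => c v = q.1 ∧ R v q.2) flds.flatten (flat sp (k + 1)) := hc2
        rw [List.forall₂_iff_get] at hc2' ⊢
        refine ⟨hc2'.1, fun i hi1 hi2 => ?_⟩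
        beta_reduce
        rw [if_neg (key _ (List.get_mem flds.flatten ⟨i, hi1⟩))]
        exact hc2'.2 i hi1 hi2
    · intro a ha b hb e
      rw [List.flatten_cons, List.mem_append] at ha hb
      by_cases h3 : a ∈ l <;> by_cases h4 : b ∈ l
      · exact ⟨l, by simp, h3, h4⟩
      · simp only [h3, h4, if_true, if_false] at e
        have := hc1 b (by tauto); omega
      · simp only [h3, h4, if_true, if_false] at e
        have := hc1 a (by tauto); omega
      · simp only [h3, h4, if_false] at e
        obtain ⟨l', hl', h5⟩ := hc3 a (by tauto) b (by tauto) e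
        exact ⟨l', by simp [hl'], h5⟩

structure Good {V : Type} (G : SimpleGraph V) : Prop where
  tri : ∀ a b c, G.Adj a b → G.Adj b c → G.Adj a c → False
  c4 : ∀ a b c d, G.Adj a b → G.Adj b c → G.Adj c d → G.Adj d a → a = c ∨ b = d

def N {V : Type} (G : SimpleGraph V) (S : Finset V) (v : V) : Finset V := S.filter (G.Adj v)
def dd {V : Type} (G : SimpleGraph V) (S : Finset V) (v : V) : ℕ := (N G S v).card
def e2 {V : Type} (G : SimpleGraph V) (S : Finset V) : ℕ := ∑ v ∈ S, dd G S v

theorem mem_N {V : Type} {G : SimpleGraph V} {S : Finset V} {v w : V} : w ∈ N G S v ↔ w ∈ S ∧ G.Adj v w := by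
  rw [N, Finset.mem_filter]

theorem map_sum_flat (sp : List (List (ℕ × ℕ))) (k : ℕ) : ((flat sp k).map (fun q => q.2.2)).sum = (sp.map fun l => (l.map fun p => p.2).sum).sum := by
  induction sp generalizing k with
  | nil => rfl
  | cons l sp ih => simp [flat, ih, Function.comp_def]

theorem flatten_sing {V : Type} (zs : List V) : (zs.map fun z => [z]).flatten = zs := by
  induction zs with
  | nil => rfl
  | cons a l ih => simp [List.map_cons, List.flatten_cons, ih]

theorem star {s : Spec} (h : runSpec s = true) {V : Type} {G : SimpleGraph V} (hG : Good G) {S : Finset V} {x : V} (hx : x ∈ S)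
    (ys : List V) (hys : ys.Nodup) (hys' : ∀ v, v ∈ ys ↔ v ∈ N G S x) (grp : V → List V) (hgn : ∀ y ∈ ys, (grp y).Nodup)
    (hg : ∀ y ∈ ys, ∀ v, v ∈ grp y ↔ v ∈ N G S y ∧ v ≠ x) (zs : List V) (hzn : zs.Nodup)
    (hz : ∀ v, v ∈ zs ↔ v ∈ S ∧ v ≠ x ∧ ¬ G.Adj x v ∧ ∀ y ∈ ys, ¬ G.Adj y v)
    (spg : List (List (ℕ × ℕ))) (spz : List (ℕ × ℕ)) (hsp : s.sp = spg ++ spz.map fun p => [p])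
    (hF : List.Forall₂ (fun y l => List.Forall₂ (fun v (p : ℕ × ℕ) => p.1 + 1 ≤ dd G S v ∧ dd G S v ≤ p.2 + 1) (grp y) l) ys spg)
    (hFz : List.Forall₂ (fun v (p : ℕ × ℕ) => p.1 ≤ dd G S v ∧ dd G S v ≤ p.2) zs spz)
    (bud : (s.sp.map fun l => (l.map fun p => p.2).sum).sum + dd G S x + (ys.map (dd G S)).sum + (spg.map List.length).sum ≤ e2 G S + s.bud)
    (pre : ∀ e ∈ s.pre, ∀ a b, ((ys.map grp).flatten ++ zs)[e.1 - 2]? = some a → ((ys.map grp).flatten ++ zs)[e.2 - 2]? = some b → G.Adj a b)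
    (non : ∀ e ∈ s.non, ∀ a b, ((ys.map grp).flatten ++ zs)[e.1 - 2]? = some a → ((ys.map grp).flatten ++ zs)[e.2 - 2]? = some b → ¬ G.Adj a b) :
    False := by
  set L1 := (ys.map grp).flatten with hL1
  have mem1 : ∀ v, v ∈ L1 ↔ ∃ y, G.Adj x y ∧ y ∈ S ∧ v ∈ S ∧ G.Adj y v ∧ v ≠ x := by
    intro v
    rw [hL1]
    simp only [List.mem_flatten, List.mem_map, exists_exists_and_eq_and]
    constructor
    · rintro ⟨y, hy, hv⟩
      rw [hg y hy, mem_N] at hv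
      rw [hys', mem_N] at hy
      exact ⟨y, hy.2, hy.1, hv.1.1, hv.1.2, hv.2⟩
    · rintro ⟨y, h1, h2, h3, h4, h5⟩
      have hy : y ∈ ys := by rw [hys', mem_N]; exact ⟨h2, h1⟩
      exact ⟨y, hy, by rw [hg y hy, mem_N]; exact ⟨⟨h3, h4⟩, h5⟩⟩
  have nd1 : L1.Nodup := by
    rw [hL1, List.nodup_flatten]
    constructor
    · intro l hl
      obtain ⟨y, hy, rfl⟩ := List.mem_map.1 hl
      exact hgn y hy
    · rw [List.pairwise_map]
      refine List.Pairwise.imp_of_mem ?_ hys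
      intro a b ha hb hab v h1 h2
      rw [hg a ha, mem_N] at h1
      rw [hg b hb, mem_N] at h2
      rw [hys', mem_N] at ha hb
      rcases hG.c4 x a v b ha.2 h1.1.2 h2.1.2.symm hb.2.symm with e | e
      · exact h1.2 e.symm
      · exact hab e
  have hzd : ∀ v ∈ L1, v ∉ zs := by
    intro v h1 h2
    obtain ⟨y, h3, h4, h5, h6, h7⟩ := (mem1 v).1 h1
    exact ((hz v).1 h2).2.2.2 y (by rw [hys', mem_N]; exact ⟨h4, h3⟩) h6
  have nd : (L1 ++ zs).Nodup := by
    rw [List.nodup_append']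
    exact ⟨nd1, hzn, fun v h1 h2 => hzd v h1 h2⟩
  have memL : ∀ v, v ∈ L1 ++ zs ↔ v ∈ S ∧ v ≠ x ∧ ¬ G.Adj x v := by
    intro v
    rw [List.mem_append, mem1, hz]
    constructor
    · rintro (⟨y, h1, h2, h3, h4, h5⟩ | ⟨h1, h2, h3, -⟩)
      · exact ⟨h3, h5, fun h => hG.tri x y v h1 h4 h⟩
      · exact ⟨h1, h2, h3⟩
    · rintro ⟨h1, h2, h3⟩
      by_cases h4 : ∀ y ∈ ys, ¬ G.Adj y v
      · right; exact ⟨h1, h2, h3, h4⟩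
      · left; push Not at h4
        obtain ⟨y, hy, h5⟩ := h4
        rw [hys', mem_N] at hy
        exact ⟨y, hy.2, hy.1, h1, h5, h2⟩
  have hfin : (L1 ++ zs).toFinset = S.filter (fun v => v ≠ x ∧ ¬ G.Adj x v) := by
    ext v
    rw [List.mem_toFinset, memL, Finset.mem_filter]
  let dl : V → ℕ := fun v => ((L1 ++ zs).toFinset.filter (G.Adj v)).card
  have dl1 : ∀ v ∈ L1, dl v + 1 = dd G S v := by
    intro v hv
    obtain ⟨y, h1, h2, h3, h4, h5⟩ := (mem1 v).1 hv
    have e : N G S v = insert y ((L1 ++ zs).toFinset.filter (G.Adj v)) := by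
      ext w
      rw [mem_N, Finset.mem_insert, hfin, Finset.mem_filter, Finset.mem_filter]
      constructor
      · rintro ⟨h6, h7⟩
        by_cases h8 : G.Adj x w
        · left
          rcases hG.c4 x w v y h8 h7.symm h4.symm h1.symm with e | e
          · exact absurd e.symm h5
          · exact e
        · right
          refine ⟨⟨h6, ?_, h8⟩, h7⟩
          rintro rfl
          exact hG.tri w y v h1 h4 h7.symm
      · rintro (rfl | h6)
        · exact ⟨h2, h4.symm⟩
        · exact ⟨h6.1.1, h6.2⟩
    rw [dd, e, Finset.card_insert_of_notMem]
    rw [hfin, Finset.mem_filter, Finset.mem_filter]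
    exact fun h => h.1.2.2 h1
  have dl2 : ∀ v ∈ zs, dl v = dd G S v := by
    intro v hv
    obtain ⟨h1, h2, h3, h4⟩ := (hz v).1 hv
    show Finset.card _ = _
    rw [dd]
    congr 1
    ext w
    rw [mem_N, hfin, Finset.mem_filter, Finset.mem_filter]
    constructor
    · rintro ⟨h5, h6⟩; exact ⟨h5.1, h6⟩
    · rintro ⟨h5, h6⟩
      refine ⟨⟨h5, ?_, ?_⟩, h6⟩
      · rintro rfl; exact h3 h6.symm
      · intro h7
        exact h4 w (by rw [hys', mem_N]; exact ⟨h5, h7⟩) h6.symm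
  have hflat : (ys.map grp ++ zs.map fun z => [z]).flatten = L1 ++ zs := by
    rw [List.flatten_append, hL1]
    congr 1
    exact flatten_sing zs
  have hFF : List.Forall₂ (List.Forall₂ (fun v (p : ℕ × ℕ) => p.1 ≤ dl v ∧ dl v ≤ p.2)) (ys.map grp ++ zs.map fun z => [z]) s.sp := by
    rw [hsp]
    refine List.rel_append ?_ ?_
    · rw [List.forall₂_map_left_iff]
      rw [List.forall₂_iff_get] at hF ⊢
      refine ⟨hF.1, fun i hi1 hi2 => ?_⟩
      have h1 := hF.2 i hi1 hi2
      rw [List.forall₂_iff_get] at h1 ⊢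
      refine ⟨h1.1, fun j hj1 hj2 => ?_⟩
      have h2 := h1.2 j hj1 hj2
      have h3 := dl1 ((grp (ys.get ⟨i, hi1⟩)).get ⟨j, hj1⟩) (by
        rw [hL1, List.mem_flatten]
        exact ⟨_, List.mem_map_of_mem (List.get_mem ys ⟨i, hi1⟩), List.get_mem _ _⟩)
      omega
    · rw [List.forall₂_map_left_iff, List.forall₂_map_right_iff]
      rw [List.forall₂_iff_get] at hFz ⊢
      refine ⟨hFz.1, fun i hi1 hi2 => ?_⟩
      have h2 := hFz.2 i hi1 hi2
      have h3 := dl2 (zs.get ⟨i, hi1⟩) (List.get_mem _ _)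
      refine List.Forall₂.cons ?_ List.Forall₂.nil
      omega
  obtain ⟨c, -, hc2, hc3⟩ := flat_col _ _ _ 0 hFF (by rw [hflat]; exact nd)
  rw [hflat] at hc2 hc3
  have hsame : ∀ a ∈ L1 ++ zs, ∀ b ∈ L1 ++ zs, c a = c b → a = b ∨ ∃ y, G.Adj x y ∧ G.Adj y a ∧ G.Adj y b := by
    intro a ha b hb e
    obtain ⟨l, hl, h1, h2⟩ := hc3 a ha b hb e
    rw [List.mem_append, List.mem_map, List.mem_map] at hl
    rcases hl with ⟨y, hy, rfl⟩ | ⟨z, hz', rfl⟩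
    · right
      rw [hg y hy, mem_N] at h1 h2
      rw [hys', mem_N] at hy
      exact ⟨y, hy.2, h1.1.2, h2.1.2⟩
    · left
      rw [List.mem_singleton] at h1 h2
      rw [h1, h2]
  refine iface0 h G (L1 ++ zs) c nd dl (fun v _ => rfl) hc2 ?_ ?_ hG.tri hG.c4 ?_ pre non
  · intro v hv a ha b hb e h1 h2
    rcases hsame a ha b hb e with h3 | ⟨y, hy, h3, h4⟩
    · exact h3
    · rcases hG.c4 a v b y h1.symm h2 h4.symm h3 with e | e
      · exact e
      · subst e
        exact absurd hy ((memL v).1 hv).2.2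
  · intro a ha b hb e h1
    rcases hsame a ha b hb e with h3 | ⟨y, hy, h3, h4⟩
    · subst h3; exact G.loopless.irrefl _ h1
    · exact hG.tri y a b h3 h1 h4
  · rw [map_sum_flat]
    have e1 : e2 G S = dd G S x + (ys.map (dd G S)).sum + ((L1 ++ zs).map (dd G S)).sum := by
      have hnd' : (x :: (ys ++ (L1 ++ zs))).Nodup := by
        rw [List.nodup_cons, List.nodup_append', List.mem_append]
        refine ⟨?_, hys, nd, ?_⟩
        · rintro (h1 | h1)
          · rw [hys', mem_N] at h1; exact G.loopless.irrefl _ h1.2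
          · exact ((memL x).1 h1).2.1 rfl
        · intro v h1 h2
          rw [hys', mem_N] at h1
          exact ((memL v).1 h2).2.2 h1.2
      have hS : S = (x :: (ys ++ (L1 ++ zs))).toFinset := by
        ext v
        rw [List.mem_toFinset, List.mem_cons, List.mem_append, memL, hys', mem_N]
        constructor
        · intro h; tauto
        · rintro (rfl | h | h)
          · exact hx
          · exact h.1
          · exact h.1
      have : e2 G S = ∑ v ∈ (x :: (ys ++ (L1 ++ zs))).toFinset, dd G S v := by rw [← hS]; rfl
      rw [this, List.sum_toFinset _ hnd']
      simp only [List.map_cons, List.map_append, List.sum_cons, List.sum_append]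
      ring
    have e2' : ((L1 ++ zs).map (dd G S)).sum = ((L1 ++ zs).map dl).sum + L1.length := by
      rw [List.map_append, List.map_append, List.sum_append, List.sum_append]
      have a1 : (zs.map (dd G S)).sum = (zs.map dl).sum := by
        congr 1
        exact List.map_congr_left fun v hv => (dl2 v hv).symm
      have a2 : (L1.map (dd G S)).sum = (L1.map dl).sum + L1.length := by
        rw [show L1.map (dd G S) = L1.map (fun v => dl v + 1) from List.map_congr_left fun v hv => (dl1 v hv).symm, List.sum_map_add]
        simp
      omega
    have e3 : L1.length = (spg.map List.length).sum := by
      rw [hL1, List.length_flatten, List.map_map]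
      congr 1
      clear_value L1
      clear bud pre non hsp hFF hL1 hg hgn hys hys' hz hflat hzd mem1 memL hfin hc2 hc3 hsame e1
      induction hF with
      | nil => rfl
      | cons h1 _ ih => simp [h1.length_eq, ih]
    omega

end
end Eng
end

section
open Finset
namespace Eng
noncomputable section
open Classical
variable {V : Type} {G : SimpleGraph V}

theorem N_sub {S : Finset V} {v : V} : N G S v ⊆ S := Finset.filter_subset _ _

theorem sum_ite_adj (A : Finset V) (v : V) : ∑ a ∈ A, (if G.Adj v a then 1 else 0) = dd G A v := by
  rw [dd, N, Finset.card_filter]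

theorem dd_comm (A B : Finset V) : ∑ a ∈ A, dd G B a = ∑ b ∈ B, dd G A b := by
  simp only [← sum_ite_adj]
  rw [Finset.sum_comm]
  simp only [G.adj_comm]

theorem dd_split {S T : Finset V} (h : T ⊆ S) (v : V) : dd G S v = dd G (S \ T) v + dd G T v := by
  simp only [← sum_ite_adj]
  rw [Finset.sum_sdiff h]

theorem e2_sdiff {S T : Finset V} (h : T ⊆ S) : e2 G S + e2 G T = e2 G (S \ T) + 2 * ∑ v ∈ T, dd G S v := by
  have h1 : e2 G S = ∑ v ∈ S \ T, dd G S v + ∑ v ∈ T, dd G S v := by rw [e2, Finset.sum_sdiff h]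
  have h2 : ∑ v ∈ S \ T, dd G S v = e2 G (S \ T) + ∑ v ∈ S \ T, dd G T v := by
    rw [e2, ← Finset.sum_add_distrib]
    exact Finset.sum_congr rfl fun v _ => dd_split h v
  have h3 : ∑ v ∈ T, dd G S v = ∑ v ∈ T, dd G (S \ T) v + e2 G T := by
    rw [e2, ← Finset.sum_add_distrib]
    exact Finset.sum_congr rfl fun v _ => dd_split h v
  rw [dd_comm (S \ T) T] at h2
  omega

theorem dd_self (v : V) : dd G {v} v = 0 := by
  rw [dd, Finset.card_eq_zero, N, Finset.filter_eq_empty_iff]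
  intro a ha
  rw [Finset.mem_singleton.1 ha]
  exact G.loopless.irrefl v

theorem e2_erase {S : Finset V} {v : V} (h : v ∈ S) : e2 G S = e2 G (S.erase v) + 2 * dd G S v := by
  have := e2_sdiff (G := G) (Finset.singleton_subset_iff.2 h)
  rw [Finset.sdiff_singleton_eq_erase, Finset.sum_singleton] at this
  have h0 : e2 G {v} = 0 := by rw [e2, Finset.sum_singleton, dd_self]
  omega

theorem e2_even (S : Finset V) : e2 G S % 2 = 0 := by
  induction S using Finset.induction_on with
  | empty => simp [e2]
  | insert a S ha ih =>
    rw [e2_erase (Finset.mem_insert_self a S), Finset.erase_insert ha]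
    omega

theorem avg {S : Finset V} {m : ℕ} (h : ∀ v ∈ S, e2 G (S.erase v) ≤ m) : S.card * e2 G S ≤ S.card * m + 2 * e2 G S := by
  have : ∑ v ∈ S, e2 G S ≤ ∑ v ∈ S, (m + 2 * dd G S v) := by
    apply Finset.sum_le_sum
    intro v hv
    rw [e2_erase hv]
    have := h v hv
    omega
  rw [Finset.sum_const, Finset.sum_add_distrib, Finset.sum_const, ← Finset.mul_sum] at this
  exact this

theorem nadj (a : V) : ¬ G.Adj a a := G.loopless.irrefl a

/-- far vertices -/
def Zf (G : SimpleGraph V) (S : Finset V) (x : V) : Finset V := S.filter fun v => v ≠ x ∧ ¬ G.Adj x v ∧ ∀ y ∈ N G S x, ¬ G.Adj y v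

theorem mem_Zf {S : Finset V} {x v : V} : v ∈ Zf G S x ↔ v ∈ S ∧ v ≠ x ∧ ¬ G.Adj x v ∧ ∀ y ∈ N G S x, ¬ G.Adj y v := by
  rw [Zf, Finset.mem_filter]

theorem ball (hG : Good G) {S : Finset V} {x : V} (hx : x ∈ S) : ∑ y ∈ N G S x, dd G S y + 1 + (Zf G S x).card = S.card := by
  have hU : (N G S x).biUnion (fun y => N G S y) ∪ (N G S x ∪ Zf G S x) = if dd G S x = 0 then S.erase x else S := by
    ext v
    rw [Finset.mem_union, Finset.mem_union, Finset.mem_biUnion, mem_Zf, mem_N]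
    split_ifs with h0
    · rw [dd, Finset.card_eq_zero] at h0
      have h1 : ∀ v, v ∉ N G S x := by simp [h0]
      rw [Finset.mem_erase, h0]
      have := h1 v
      rw [mem_N] at this
      simp only [Finset.notMem_empty, false_and, exists_false, false_or]
      tauto
    · constructor
      · rintro (⟨y, -, h1⟩ | h | h)
        · exact (mem_N.1 h1).1
        · exact h.1
        · exact h.1
      · intro hv
        by_cases hvx : v = x
        · subst hvx
          obtain ⟨y, hy⟩ := Finset.card_pos.1 (Nat.pos_of_ne_zero h0)
          left
          exact ⟨y, hy, mem_N.2 ⟨hv, (mem_N.1 hy).2.symm⟩⟩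
        · by_cases h1 : G.Adj x v
          · tauto
          · by_cases h2 : ∀ y ∈ N G S x, ¬ G.Adj y v
            · tauto
            · push Not at h2
              obtain ⟨y, hy, h3⟩ := h2
              left
              exact ⟨y, hy, mem_N.2 ⟨hv, h3⟩⟩
  have hd1 : Disjoint ((N G S x).biUnion (fun y => N G S y)) (N G S x ∪ Zf G S x) := by
    rw [Finset.disjoint_left]
    intro v hv hv2
    rw [Finset.mem_biUnion] at hv
    obtain ⟨y, hy, h1⟩ := hv
    rw [Finset.mem_union, mem_Zf] at hv2
    rcases hv2 with h2 | h2
    · exact hG.tri x y v (mem_N.1 hy).2 (mem_N.1 h1).2 (mem_N.1 h2).2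
    · exact h2.2.2.2 y hy (mem_N.1 h1).2
  have hd2 : Disjoint (N G S x) (Zf G S x) := by
    rw [Finset.disjoint_left]
    intro v hv hv2
    exact (mem_Zf.1 hv2).2.2.1 (mem_N.1 hv).2
  have hc : ((N G S x).biUnion (fun y => N G S y)).card + dd G S x = ∑ y ∈ N G S x, dd G S y + (if dd G S x = 0 then 0 else 1) := by
    have e1 : (N G S x).biUnion (fun y => N G S y) = (N G S x).biUnion (fun y => (N G S y).erase x) ∪ (if dd G S x = 0 then ∅ else {x}) := by
      ext v
      rw [Finset.mem_union, Finset.mem_biUnion, Finset.mem_biUnion]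
      constructor
      · rintro ⟨y, hy, h1⟩
        by_cases hvx : v = x
        · right
          rw [if_neg]
          · simp [hvx]
          · rw [dd, Finset.card_eq_zero]; rintro h; rw [h] at hy; simp at hy
        · left; exact ⟨y, hy, Finset.mem_erase.2 ⟨hvx, h1⟩⟩
      · rintro (⟨y, hy, h1⟩ | h)
        · exact ⟨y, hy, (Finset.mem_erase.1 h1).2⟩
        · split_ifs at h with h0
          · simp at h
          · rw [Finset.mem_singleton] at h
            subst h
            obtain ⟨y, hy⟩ := Finset.card_pos.1 (Nat.pos_of_ne_zero h0)
            exact ⟨y, hy, mem_N.2 ⟨hx, (mem_N.1 hy).2.symm⟩⟩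
    have e2' : Disjoint ((N G S x).biUnion (fun y => (N G S y).erase x)) (if dd G S x = 0 then ∅ else {x}) := by
      split_ifs
      · simp
      · rw [Finset.disjoint_singleton_right, Finset.mem_biUnion]
        rintro ⟨y, -, h⟩
        simp at h
    rw [e1, Finset.card_union_of_disjoint e2', Finset.card_biUnion]
    · have e3 : ∑ y ∈ N G S x, dd G S y = ∑ y ∈ N G S x, ((N G S y).erase x).card + dd G S x := by
        rw [dd, Finset.card_eq_sum_ones, ← Finset.sum_add_distrib]
        apply Finset.sum_congr rfl
        intro y hy
        rw [dd, Finset.card_erase_add_one]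
        exact mem_N.2 ⟨hx, (mem_N.1 hy).2.symm⟩
      rw [e3]
      split_ifs <;> simp <;> omega
    · intro a ha b hb hab
      rw [Function.onFun, Finset.disjoint_left]
      intro v h1 h2
      rw [Finset.mem_erase, mem_N] at h1 h2
      rcases hG.c4 x a v b (mem_N.1 ha).2 h1.2.2 h2.2.2.symm (mem_N.1 hb).2.symm with e | e
      · exact h1.1 e.symm
      · exact hab e
  have hfin := congrArg Finset.card hU
  rw [Finset.card_union_of_disjoint hd1, Finset.card_union_of_disjoint hd2] at hfin
  change _ + (dd G S x + _) = _ at hfin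
  have hS : 0 < S.card := Finset.card_pos.2 ⟨x, hx⟩
  have hSe := Finset.card_erase_of_mem hx
  split_ifs at hfin hc <;> omega

/-- ordered pair count -/
theorem pairs (hG : Good G) {S A : Finset V} (hA : A ⊆ S) :
    ∑ v ∈ S, dd G A v * dd G A v + e2 G A + A.card ≤ A.card * A.card + ∑ v ∈ S, dd G A v := by
  have h1 : (S.biUnion fun v => (N G A v).offDiag).card = ∑ v ∈ S, (N G A v).offDiag.card := by
    apply Finset.card_biUnion
    intro v _ w _ hvw
    rw [Function.onFun, Finset.disjoint_left]
    rintro ⟨a, b⟩ h1 h2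
    rw [Finset.mem_offDiag, mem_N, mem_N] at h1 h2
    rcases hG.c4 v a w b h1.1.2 h2.1.2.symm h2.2.1.2 h1.2.1.2.symm with e | e
    · exact hvw e
    · exact h1.2.2 e
  have h2 : e2 G A = (A.offDiag.filter fun p => G.Adj p.1 p.2).card := by
    have : (A.offDiag.filter fun p => G.Adj p.1 p.2) = (A ×ˢ A).filter fun p => G.Adj p.1 p.2 := by
      ext ⟨a, b⟩
      simp only [Finset.mem_filter, Finset.mem_offDiag, Finset.mem_product]
      constructor
      · rintro ⟨⟨h1, h2, -⟩, h3⟩; exact ⟨⟨h1, h2⟩, h3⟩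
      · rintro ⟨⟨h1, h2⟩, h3⟩; exact ⟨⟨h1, h2, h3.ne⟩, h3⟩
    rw [this, Finset.card_filter, Finset.sum_product, e2]
    exact Finset.sum_congr rfl fun v _ => (sum_ite_adj A v).symm
  have h3 : (S.biUnion fun v => (N G A v).offDiag).card + (A.offDiag.filter fun p => G.Adj p.1 p.2).card ≤ A.offDiag.card := by
    rw [← Finset.card_union_of_disjoint]
    · apply Finset.card_le_card
      intro p hp
      rw [Finset.mem_union, Finset.mem_biUnion] at hp
      rcases hp with ⟨v, -, h⟩ | h
      · rw [Finset.mem_offDiag, mem_N, mem_N] at h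
        rw [Finset.mem_offDiag]
        exact ⟨h.1.1, h.2.1.1, h.2.2⟩
      · exact (Finset.mem_filter.1 h).1
    · rw [Finset.disjoint_left]
      intro p hp h
      rw [Finset.mem_biUnion] at hp
      obtain ⟨v, -, hp⟩ := hp
      rw [Finset.mem_offDiag, mem_N, mem_N] at hp
      exact hG.tri v p.1 p.2 hp.1.2 (Finset.mem_filter.1 h).2 hp.2.1.2
  rw [h1, ← h2, Finset.offDiag_card] at h3
  have h4 : ∑ v ∈ S, (N G A v).offDiag.card + ∑ v ∈ S, dd G A v = ∑ v ∈ S, dd G A v * dd G A v := by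
    rw [← Finset.sum_add_distrib]
    apply Finset.sum_congr rfl
    intro v _
    rw [Finset.offDiag_card, dd]
    have := Nat.le_mul_self (N G A v).card
    omega
  have := Nat.le_mul_self A.card
  omega

theorem sum_dd_sq {S : Finset V} : ∑ x ∈ S, ∑ y ∈ N G S x, dd G S y = ∑ v ∈ S, dd G S v * dd G S v := by
  have : ∀ x ∈ S, ∑ y ∈ N G S x, dd G S y = ∑ y ∈ S, (if G.Adj y x then dd G S y else 0) := by
    intro x _
    rw [N, Finset.sum_filter]
    simp only [G.adj_comm]
  rw [Finset.sum_congr rfl this, Finset.sum_comm]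
  apply Finset.sum_congr rfl
  intro v _
  rw [← Finset.sum_filter, Finset.sum_const, smul_eq_mul]
  rfl

end
end Eng
end

section
open Finset
namespace Eng
noncomputable section
open Classical
variable {V : Type} {G : SimpleGraph V}

def grpP (G : SimpleGraph V) (S : Finset V) (x : V) (p : V → Prop) (y : V) : List V :=
  (((N G S y).erase x).filter p).toList ++ (((N G S y).erase x).filter fun v => ¬ p v).toList

theorem mem_grpP {S : Finset V} {x y v : V} {p : V → Prop} : v ∈ grpP G S x p y ↔ v ∈ N G S y ∧ v ≠ x := by
  rw [grpP, List.mem_append, Finset.mem_toList, Finset.mem_toList, Finset.mem_filter, Finset.mem_filter, Finset.mem_erase]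
  tauto

theorem nodup_filters {α : Type} (A : Finset α) (p : α → Prop) : ((A.filter p).toList ++ (A.filter fun v => ¬ p v).toList).Nodup := by
  rw [List.nodup_append']
  refine ⟨Finset.nodup_toList _, Finset.nodup_toList _, ?_⟩
  intro v h1 h2
  rw [Finset.mem_toList, Finset.mem_filter] at h1 h2
  exact h2.2 h1.2

theorem f2_rep {α β : Type} {R : α → β → Prop} {l : List α} {k : ℕ} {p : β} (h : l.length = k) (h2 : ∀ v ∈ l, R v p) : List.Forall₂ R l (List.replicate k p) := by
  subst h
  induction l with
  | nil => exact List.Forall₂.nil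
  | cons a l ih => exact List.Forall₂.cons (h2 a (by simp)) (ih fun v hv => h2 v (by simp [hv]))

theorem f2_app {α β : Type} {R : α → β → Prop} {l l' : List α} {m m' : List β} (h : List.Forall₂ R l m) (h' : List.Forall₂ R l' m') :
    List.Forall₂ R (l ++ l') (m ++ m') := List.rel_append h h'

theorem grpP_length {S : Finset V} {x y : V} {p : V → Prop} (h : x ∈ N G S y) : (grpP G S x p y).length + 1 = dd G S y := by
  rw [grpP, List.length_append, Finset.length_toList, Finset.length_toList, Finset.card_filter_add_card_filter_not, Finset.card_erase_add_one h, dd]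

theorem grp_uni {S : Finset V} {x y : V} {p : V → Prop} (hx : x ∈ S) (hy : y ∈ N G S x) {k lo up : ℕ} (h : dd G S y = k + 1)
    (h2 : ∀ v ∈ N G S y, v ≠ x → lo + 1 ≤ dd G S v ∧ dd G S v ≤ up + 1) :
    List.Forall₂ (fun v (p : ℕ × ℕ) => p.1 + 1 ≤ dd G S v ∧ dd G S v ≤ p.2 + 1) (grpP G S x p y) (List.replicate k (lo, up)) := by
  apply f2_rep
  · have := grpP_length (p := p) (mem_N.2 ⟨hx, (mem_N.1 hy).2.symm⟩ : x ∈ N G S y)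
    omega
  · intro v hv
    rw [mem_grpP] at hv
    exact h2 v hv.1 hv.2

theorem starP {s : Spec} (h : runSpec s = true) (hG : Good G) {S : Finset V} {x : V} (hx : x ∈ S) (p q q' : V → Prop) (hq : ∀ v, q' v ↔ ¬ q v)
    (zs : List V) (hzn : zs.Nodup) (hz : ∀ v, v ∈ zs ↔ v ∈ Zf G S x)
    (sp1 sp2 : List (List (ℕ × ℕ))) (spz : List (ℕ × ℕ)) (hsp : s.sp = (sp1 ++ sp2) ++ spz.map fun p => [p])
    (hF1 : List.Forall₂ (fun y l => List.Forall₂ (fun v (p : ℕ × ℕ) => p.1 + 1 ≤ dd G S v ∧ dd G S v ≤ p.2 + 1) (grpP G S x p y) l) ((N G S x).filter q).toList sp1)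
    (hF2 : List.Forall₂ (fun y l => List.Forall₂ (fun v (p : ℕ × ℕ) => p.1 + 1 ≤ dd G S v ∧ dd G S v ≤ p.2 + 1) (grpP G S x p y) l) ((N G S x).filter q').toList sp2)
    (hFz : List.Forall₂ (fun v (p : ℕ × ℕ) => p.1 ≤ dd G S v ∧ dd G S v ≤ p.2) zs spz)
    (bud : (s.sp.map fun l => (l.map fun p => p.2).sum).sum + dd G S x + (∑ y ∈ N G S x, dd G S y) + ((sp1 ++ sp2).map List.length).sum ≤ e2 G S + s.bud)
    (pre : ∀ e ∈ s.pre, ∀ a b, (((((N G S x).filter q).toList ++ ((N G S x).filter q').toList).map (grpP G S x p)).flatten ++ zs)[e.1 - 2]? = some a →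
      (((((N G S x).filter q).toList ++ ((N G S x).filter q').toList).map (grpP G S x p)).flatten ++ zs)[e.2 - 2]? = some b → G.Adj a b)
    (non : ∀ e ∈ s.non, ∀ a b, (((((N G S x).filter q).toList ++ ((N G S x).filter q').toList).map (grpP G S x p)).flatten ++ zs)[e.1 - 2]? = some a →
      (((((N G S x).filter q).toList ++ ((N G S x).filter q').toList).map (grpP G S x p)).flatten ++ zs)[e.2 - 2]? = some b → ¬ G.Adj a b) :
    False := by
  have hmem : ∀ v, v ∈ ((N G S x).filter q).toList ++ ((N G S x).filter q').toList ↔ v ∈ N G S x := by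
    intro v
    rw [List.mem_append, Finset.mem_toList, Finset.mem_toList, Finset.mem_filter, Finset.mem_filter, hq]
    tauto
  have hq' : (N G S x).filter q' = (N G S x).filter fun v => ¬ q v := Finset.filter_congr fun v _ => hq v
  refine star h hG hx _ (by rw [hq']; exact nodup_filters _ q) hmem (grpP G S x p) (fun y _ => nodup_filters _ p) (fun y _ v => mem_grpP) zs hzn ?_ (sp1 ++ sp2) spz hsp (f2_app hF1 hF2) hFz ?_ pre non
  · intro v
    rw [hz, mem_Zf]
    simp only [hmem]
  · rw [hq', List.map_append, List.sum_append, Finset.sum_map_toList, Finset.sum_map_toList, Finset.sum_filter_add_sum_filter_not]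
    exact bud

/-- degree classes -/
def cls (G : SimpleGraph V) (S : Finset V) (k : ℕ) : Finset V := S.filter fun v => dd G S v = k

theorem mem_cls {S : Finset V} {k : ℕ} {v : V} : v ∈ cls G S k ↔ v ∈ S ∧ dd G S v = k := by rw [cls, Finset.mem_filter]
theorem cls_sub {S : Finset V} {k : ℕ} : cls G S k ⊆ S := Finset.filter_subset _ _

theorem cls_empty {S : Finset V} {k : ℕ} (h : ∀ v ∈ S, dd G S v ≠ k) : cls G S k = ∅ := by
  rw [cls, Finset.filter_eq_empty_iff]
  exact fun v hv => h v hv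

theorem dd_empty (v : V) : dd G ∅ v = 0 := by simp [dd, N]

theorem dd_filter {S : Finset V} {x : V} {k : ℕ} {q : V → Prop} [DecidablePred q] (hq : ∀ v, q v ↔ dd G S v = k) : ((N G S x).filter q).card = dd G (cls G S k) x := by
  rw [dd]; congr 1
  ext v
  rw [mem_N, mem_cls, Finset.mem_filter, mem_N, hq]
  tauto

theorem dd_filter_not {S : Finset V} {x : V} {k : ℕ} {q : V → Prop} [DecidablePred q] (hq : ∀ v, q v ↔ ¬ dd G S v = k) : ((N G S x).filter q).card + dd G (cls G S k) x = dd G S x := by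
  have : (N G S x).filter q = (N G S x).filter fun v => ¬ dd G S v = k := Finset.filter_congr fun v _ => hq v
  rw [this, ← dd_filter (q := fun v => dd G S v = k) (fun v => Iff.rfl), add_comm, Finset.card_filter_add_card_filter_not, dd]

theorem deg_mul (hG : Good G) {S : Finset V} {m : ℕ} (h : ∀ v ∈ S, m ≤ dd G S v) {x : V} (hx : x ∈ S) : dd G S x * m + 1 ≤ S.card := by
  have h1 := ball hG hx
  have h2 := Finset.card_nsmul_le_sum (N G S x) (fun v => dd G S v) m fun v hv => h v (N_sub hv)
  rw [smul_eq_mul] at h2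
  change dd G S x * m ≤ _ at h2
  omega

theorem del_star {S T : Finset V} {b : V} (hb : b ∈ S) (hT : T ⊆ N G S b) :
    e2 G S + 2 * T.card ≤ e2 G (S \ insert b T) + 2 * dd G S b + 2 * ∑ v ∈ T, dd G S v ∧ (S \ insert b T).card + T.card + 1 = S.card := by
  have hbT : b ∉ T := fun h => nadj b (mem_N.1 (hT h)).2
  have hs : insert b T ⊆ S := Finset.insert_subset hb (hT.trans N_sub)
  have h1 := e2_sdiff (G := G) hs
  rw [Finset.sum_insert hbT] at h1
  have h2 : 2 * T.card ≤ e2 G (insert b T) := by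
    rw [e2, Finset.sum_insert hbT]
    have a1 : T.card ≤ dd G (insert b T) b := by
      apply Finset.card_le_card
      intro v hv
      exact mem_N.2 ⟨Finset.mem_insert_of_mem hv, (mem_N.1 (hT hv)).2⟩
    have a2 := Finset.card_nsmul_le_sum T (fun v => dd G (insert b T) v) 1 (by
      intro v hv
      apply Finset.card_pos.2
      exact ⟨b, mem_N.2 ⟨Finset.mem_insert_self _ _, (mem_N.1 (hT hv)).2.symm⟩⟩)
    rw [smul_eq_mul, mul_one] at a2
    omega
  have h3 := Finset.card_sdiff_add_card_eq_card hs
  rw [Finset.card_insert_of_notMem hbT] at h3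
  omega

theorem del_pair {S : Finset V} {a b : V} (ha : a ∈ S) (hb : b ∈ S) (h : G.Adj a b) :
    ∃ T : Finset V, T.card + 2 = S.card ∧ e2 G S + 2 ≤ e2 G T + 2 * dd G S a + 2 * dd G S b := by
  have := del_star (T := {b}) ha (by rw [Finset.singleton_subset_iff, mem_N]; exact ⟨hb, h⟩)
  rw [Finset.sum_singleton, Finset.card_singleton] at this
  exact ⟨_, by omega, this.1⟩

end
end Eng
end

section
namespace Eng
def s1 : Spec := ⟨[[(4, 4), (4, 4), (4, 4), (4, 4)], [(4, 4), (4, 4), (4, 4), (4, 4)], [(4, 4), (4, 4), (4, 4), (4, 4)], [(4, 4), (4, 4), (4, 4), (4, 4)], [(5, 5)], [(5, 5)], [(5, 5)], [(5, 5)], [(5, 5)], [(5, 5)], [(5, 5)], [(5, 5)]], false, 0, [(18, 19), (20, 21), (22, 23), (24, 25)], [(18, 20), (18, 21), (18, 22), (18, 23), (18, 24), (18, 25), (19, 20), (19, 21), (19, 22), (19, 23), (19, 24), (19, 25), (20, 22), (20, 23), (20, 24), (20, 25), (21, 22), (21, 23), (21, 24), (21, 25), (22, 24), (22, 25), (23,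 24), (23, 25)], []⟩
theorem c1 : runSpec s1 = true := by decide +kernel

def s2 : Spec := ⟨[[(4, 4), (4, 4), (4, 4), (4, 4)], [(4, 4), (4, 4), (4, 4), (4, 4)], [(4, 4), (4, 4), (4, 4), (4, 4)], [(4, 4), (4, 4), (4, 4), (4, 4)], [(4, 4), (4, 4), (4, 4), (4, 4)], [(4, 4)], [(5, 5)], [(5, 5)]], false, 0, [(22, 23)], [], [22, 23]⟩
theorem c2 : runSpec s2 = true := by decide +kernel

def s3 : Spec := ⟨[[(4, 4), (4, 4), (4, 4), (4, 4)], [(4, 4), (4, 4), (4, 4), (4, 4)], [(4, 4), (4, 4), (4, 4), (4, 4)], [(4, 4), (4, 4), (4, 4), (4, 4)], [(4, 4), (4, 4), (4, 4), (3, 3)], [(4, 4)], [(5, 5)]], false, 0, [], [], [22, 23]⟩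
theorem c3 : runSpec s3 = true := by decide +kernel

def s4 : Spec := ⟨[[(4, 4), (4, 4), (4, 4), (4, 4)], [(4, 4), (4, 4), (4, 4), (4, 4)], [(4, 4), (4, 4), (4, 4), (4, 4)], [(4, 4), (4, 4), (4, 4), (4, 4)], [(4, 4), (4, 4), (4, 4), (4, 4)], [(4, 4)], [(4, 4)]], false, 0, [], [], [22]⟩
theorem c4 : runSpec s4 = true := by decide +kernel

def s5 : Spec := ⟨[[(4, 4), (4, 4), (4, 4), (4, 4)], [(4, 4), (4, 4), (4, 4), (4, 4)], [(4, 4), (4, 4), (4, 4), (4, 4)], [(4, 4), (4, 4), (4, 4), (4, 4)], [(3, 3), (3, 3), (3, 3), (4, 4), (4, 4)], [(5, 5)]], false, 0, [], [], []⟩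
theorem c5 : runSpec s5 = true := by decide +kernel

def s6 : Spec := ⟨[[(3, 4), (3, 4), (3, 4)], [(3, 4), (3, 4), (3, 4)], [(3, 4), (3, 4), (3, 4)], [(3, 4), (3, 4), (3, 4)], [(3, 3), (3, 3), (3, 3), (3, 3)]], true, 6, [], [], []⟩
theorem c6 : runSpec s6 = true := by decide +kernel

def s7 : Spec := ⟨[[(3, 4), (3, 4), (3, 4)], [(3, 4), (3, 4), (3, 4)], [(3, 4), (3, 4), (3, 4)], [(3, 4), (3, 4), (3, 4), (3, 4)], [(3, 4), (3, 4), (3, 4), (3, 4)]], true, 10, [], [], [18]⟩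
theorem c7 : runSpec s7 = true := by decide +kernel

def s8 : Spec := ⟨[[(4, 4), (4, 4), (4, 4)], [(3, 4), (3, 4), (3, 4), (3, 4)], [(3, 4), (3, 4), (3, 4), (3, 4)], [(3, 4), (3, 4), (3, 4), (3, 4)], [(3, 4), (3, 4), (3, 4), (3, 4)]], true, 8, [], [], []⟩
theorem c8 : runSpec s8 = true := by decide +kernel

def s9 : Spec := ⟨[[(4, 4), (4, 4), (4, 4)], [(4, 4), (4, 4), (4, 4)], [(3, 4), (3, 4), (3, 4), (3, 4)], [(3, 4), (3, 4), (3, 4), (3, 4)], [(3, 4), (3, 4), (3, 4), (3, 4)], [(4, 5)]], true, 7, [], [], [20, 2, 3, 4, 5, 6, 7]⟩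
theorem c9 : runSpec s9 = true := by decide +kernel

def s10 : Spec := ⟨[[(3, 3), (3, 3)], [(2, 3), (2, 3), (2, 3)], [(2, 3), (2, 3), (2, 3)], [(2, 3), (2, 3), (2, 3)]], true, 5, [], [], []⟩
theorem c10 : runSpec s10 = true := by decide +kernel

end Eng
end

section
open Finset
namespace Eng
noncomputable section
open Classical
variable {V : Type} {G : SimpleGraph V}

def Bd (G : SimpleGraph V) (n m : ℕ) : Prop := ∀ S : Finset V, S.card = n → e2 G S ≤ m

theorem Bd.erase {n m : ℕ} (h : Bd G n m) {S : Finset V} (hS : S.card = n + 1) {v : V} (hv : v ∈ S) : e2 G S ≤ m + 2 * dd G S v := by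
  rw [e2_erase hv]
  have := h (S.erase v) (by rw [Finset.card_erase_of_mem hv, hS]; rfl)
  omega

theorem Bd.avg {n m : ℕ} (h : Bd G n m) {S : Finset V} (hS : S.card = n + 1) : (n + 1) * e2 G S ≤ (n + 1) * m + 2 * e2 G S := by
  rw [← hS]
  exact Eng.avg fun v hv => h (S.erase v) (by rw [Finset.card_erase_of_mem hv, hS]; rfl)

theorem Bd.pair {n m : ℕ} (h : Bd G n m) {S : Finset V} (hS : S.card = n + 2) {a b : V} (ha : a ∈ S) (hb : b ∈ S) (hab : G.Adj a b) :
    e2 G S + 2 ≤ m + 2 * dd G S a + 2 * dd G S b := by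
  obtain ⟨T, h1, h2⟩ := del_pair ha hb hab
  have := h T (by omega)
  omega

theorem split3 {S : Finset V} (a : ℕ) (h : ∀ v ∈ S, a ≤ dd G S v ∧ dd G S v ≤ a + 2) (f : V → ℕ) :
    ∑ v ∈ S, f v = ∑ v ∈ cls G S a, f v + ∑ v ∈ cls G S (a + 1), f v + ∑ v ∈ cls G S (a + 2), f v := by
  rw [← Finset.sum_fiberwise_of_maps_to (g := dd G S) (t := {a, a + 1, a + 2}) (fun v hv => by
    have := h v hv
    simp only [Finset.mem_insert, Finset.mem_singleton]; omega)]
  rw [Finset.sum_insert (by simp), Finset.sum_insert (by simp), Finset.sum_singleton, add_assoc]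
  rfl

theorem split3d {S : Finset V} (a : ℕ) (h : ∀ v ∈ S, a ≤ dd G S v ∧ dd G S v ≤ a + 2) :
    S.card = (cls G S a).card + (cls G S (a + 1)).card + (cls G S (a + 2)).card ∧
    e2 G S = a * (cls G S a).card + (a + 1) * (cls G S (a + 1)).card + (a + 2) * (cls G S (a + 2)).card ∧
    (∀ x, dd G S x = dd G (cls G S a) x + dd G (cls G S (a + 1)) x + dd G (cls G S (a + 2)) x) ∧
    (∀ x, ∑ v ∈ N G S x, dd G S v = a * dd G (cls G S a) x + (a + 1) * dd G (cls G S (a + 1)) x + (a + 2) * dd G (cls G S (a + 2)) x) := by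
  have key : ∀ k, ∀ f : V → ℕ, ∑ v ∈ cls G S k, f v * dd G S v = k * ∑ v ∈ cls G S k, f v := by
    intro k f
    rw [Finset.mul_sum]
    apply Finset.sum_congr rfl
    intro v hv
    rw [(mem_cls.1 hv).2, mul_comm]
  refine ⟨?_, ?_, ?_, ?_⟩
  · have := split3 a h fun _ => 1
    simpa using this
  · have := split3 a h fun v => 1 * dd G S v
    rw [key, key, key] at this
    simpa [e2] using this
  · intro x
    simp only [← sum_ite_adj]
    exact split3 a h _
  · intro x
    have := split3 a h fun v => (if G.Adj x v then 1 else 0) * dd G S v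
    rw [key, key, key, sum_ite_adj, sum_ite_adj, sum_ite_adj] at this
    rw [← this, N, Finset.sum_filter]
    simp

theorem conv {α : Type} (B : Finset α) (f : α → ℕ) (m : ℕ) : (2 * m + 1) * ∑ v ∈ B, f v ≤ ∑ v ∈ B, f v * f v + B.card * (m * (m + 1)) := by
  rw [Finset.mul_sum, ← smul_eq_mul (B.card), ← Finset.sum_const, ← Finset.sum_add_distrib]
  apply Finset.sum_le_sum
  intro v _
  rcases le_total (f v) m with h | h
  · obtain ⟨d, rfl⟩ := Nat.exists_eq_add_of_le h
    nlinarith [Nat.zero_le d]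
  · rcases h.eq_or_lt with h | h
    · rw [← h]; nlinarith
    · obtain ⟨d, hd⟩ := Nat.exists_eq_add_of_le (Nat.succ_le_of_lt h)
      rw [hd]; nlinarith [Nat.zero_le d]

theorem f2_uni {S : Finset V} {x : V} (hx : x ∈ S) (p q : V → Prop) (k g lo up : ℕ) (hk : ((N G S x).filter q).card = k)
    (h : ∀ y ∈ N G S x, q y → dd G S y = g + 1 ∧ ∀ v ∈ N G S y, v ≠ x → lo + 1 ≤ dd G S v ∧ dd G S v ≤ up + 1) :
    List.Forall₂ (fun y l => List.Forall₂ (fun v (p : ℕ × ℕ) => p.1 + 1 ≤ dd G S v ∧ dd G S v ≤ p.2 + 1) (grpP G S x p y) l) ((N G S x).filter q).toList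
      (List.replicate k (List.replicate g (lo, up))) := by
  apply f2_rep
  · rw [Finset.length_toList, hk]
  · intro y hy
    rw [Finset.mem_toList, Finset.mem_filter] at hy
    obtain ⟨h1, h2⟩ := h y hy.1 hy.2
    exact grp_uni hx hy.1 h1 h2

theorem starU {s : Spec} (h : runSpec s = true) (hG : Good G) {S : Finset V} {x : V} (hx : x ∈ S) (q q' : V → Prop) (hq : ∀ v, q' v ↔ ¬ q v)
    (zs : List V) (hzn : zs.Nodup) (hz : ∀ v, v ∈ zs ↔ v ∈ Zf G S x)
    (k1 g1 lo1 up1 k2 g2 lo2 up2 : ℕ) (spz : List (ℕ × ℕ))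
    (hsp : s.sp = (List.replicate k1 (List.replicate g1 (lo1, up1)) ++ List.replicate k2 (List.replicate g2 (lo2, up2))) ++ spz.map fun p => [p])
    (hk1 : ((N G S x).filter q).card = k1) (hk2 : ((N G S x).filter q').card = k2)
    (h1 : ∀ y ∈ N G S x, q y → dd G S y = g1 + 1 ∧ ∀ v ∈ N G S y, v ≠ x → lo1 + 1 ≤ dd G S v ∧ dd G S v ≤ up1 + 1)
    (h2 : ∀ y ∈ N G S x, q' y → dd G S y = g2 + 1 ∧ ∀ v ∈ N G S y, v ≠ x → lo2 + 1 ≤ dd G S v ∧ dd G S v ≤ up2 + 1)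
    (hFz : List.Forall₂ (fun v (p : ℕ × ℕ) => p.1 ≤ dd G S v ∧ dd G S v ≤ p.2) zs spz)
    (bud : (s.sp.map fun l => (l.map fun p => p.2).sum).sum + dd G S x + (∑ y ∈ N G S x, dd G S y) + (k1 * g1 + k2 * g2) ≤ e2 G S + s.bud)
    (pre : ∀ e ∈ s.pre, k1 * g1 + k2 * g2 + 2 ≤ e.1 ∧ k1 * g1 + k2 * g2 + 2 ≤ e.2 ∧ ∀ a b, zs[e.1 - (k1 * g1 + k2 * g2 + 2)]? = some a → zs[e.2 - (k1 * g1 + k2 * g2 + 2)]? = some b → G.Adj a b)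
    (non : ∀ e ∈ s.non, k1 * g1 + k2 * g2 + 2 ≤ e.1 ∧ k1 * g1 + k2 * g2 + 2 ≤ e.2 ∧ ∀ a b, zs[e.1 - (k1 * g1 + k2 * g2 + 2)]? = some a → zs[e.2 - (k1 * g1 + k2 * g2 + 2)]? = some b → ¬ G.Adj a b) : False := by
  have hF1 := f2_uni (G := G) hx (fun _ => True) q k1 g1 lo1 up1 hk1 h1
  have hF2 := f2_uni (G := G) hx (fun _ => True) q' k2 g2 lo2 up2 hk2 h2
  have hlen : ((((N G S x).filter q).toList ++ ((N G S x).filter q').toList).map (grpP G S x fun _ => True)).flatten.length = k1 * g1 + k2 * g2 := by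
    rw [List.length_flatten, List.map_append, List.map_append, List.sum_append, List.map_map, List.map_map]
    have e1 : ∀ (Q : V → Prop) (k g : ℕ), ((N G S x).filter Q).card = k → (∀ y ∈ N G S x, Q y → dd G S y = g + 1) →
        (((N G S x).filter Q).toList.map (List.length ∘ grpP G S x fun _ => True)).sum = k * g := by
      intro Q k g hk hg
      rw [Finset.sum_map_toList, ← hk, ← smul_eq_mul, ← Finset.sum_const]
      apply Finset.sum_congr rfl
      intro y hy
      rw [Finset.mem_filter] at hy
      have a1 := hg y hy.1 hy.2
      have a2 := grpP_length (p := fun _ => True) (mem_N.2 ⟨hx, (mem_N.1 hy.1).2.symm⟩ : x ∈ N G S y)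
      simp only [Function.comp]
      omega
    rw [e1 q k1 g1 hk1 fun y hy hq => (h1 y hy hq).1, e1 q' k2 g2 hk2 fun y hy hq => (h2 y hy hq).1]
  refine starP h hG hx (fun _ => True) q q' hq zs hzn hz _ _ spz hsp hF1 hF2 hFz ?_ ?_ ?_
  · refine le_trans (le_of_eq ?_) bud
    simp
  · intro e he a b ha hb
    obtain ⟨l1, l2, l3⟩ := pre e he
    rw [List.getElem?_append_right (by rw [hlen]; omega), hlen] at ha hb
    refine l3 a b ?_ ?_
    · rw [← ha]; congr 1; omega
    · rw [← hb]; congr 1; omega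
  · intro e he a b ha hb
    obtain ⟨l1, l2, l3⟩ := non e he
    rw [List.getElem?_append_right (by rw [hlen]; omega), hlen] at ha hb
    refine l3 a b ?_ ?_
    · rw [← ha]; congr 1; omega
    · rw [← hb]; congr 1; omega

theorem fE {S : Finset V} {x : V} {k m : ℕ} {q : V → Prop} {_ : DecidablePred q} (hq : ∀ v, q v ↔ dd G S v = k) (h : dd G (cls G S k) x = m) : ((N G S x).filter q).card = m := by
  rw [← h]; exact dd_filter hq

theorem fN {S : Finset V} {x : V} {k m : ℕ} {q : V → Prop} {_ : DecidablePred q} (hq : ∀ v, q v ↔ ¬ dd G S v = k) (h : dd G S x = m + dd G (cls G S k) x) : ((N G S x).filter q).card = m := by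
  have := dd_filter_not (x := x) hq
  omega

theorem mem_N' {S : Finset V} {x y : V} (hx : x ∈ S) (h : y ∈ N G S x) : x ∈ N G S y := mem_N.2 ⟨hx, (mem_N.1 h).2.symm⟩

theorem dd_pos {A : Finset V} {v w : V} (h : w ∈ A) (h2 : G.Adj v w) : 1 ≤ dd G A v := Finset.card_pos.2 ⟨w, mem_N.2 ⟨h, h2⟩⟩

theorem dd_zero {A : Finset V} {v : V} (h : ∀ w ∈ A, ¬ G.Adj v w) : dd G A v = 0 := by
  rw [dd, Finset.card_eq_zero, N, Finset.filter_eq_empty_iff]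
  exact fun w hw => h w hw

theorem dd_ex {A : Finset V} {v : V} (h : 1 ≤ dd G A v) : ∃ w ∈ A, G.Adj v w := by
  obtain ⟨w, hw⟩ := Finset.card_pos.1 h
  exact ⟨w, mem_N.1 hw⟩

theorem cls0 {S : Finset V} {k : ℕ} (h : ∀ v ∈ S, dd G S v ≠ k) : (cls G S k).card = 0 ∧ ∀ x, dd G (cls G S k) x = 0 := by
  rw [cls_empty h]
  exact ⟨rfl, dd_empty⟩

theorem sum_eq {A : Finset V} {f : V → ℕ} {m : ℕ} (h : ∀ v ∈ A, f v = m) : ∑ v ∈ A, f v = A.card * m := by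
  rw [Finset.sum_congr rfl h, Finset.sum_const, smul_eq_mul]
theorem sum_le {A : Finset V} {f : V → ℕ} {m : ℕ} (h : ∀ v ∈ A, f v ≤ m) : ∑ v ∈ A, f v ≤ A.card * m := by
  rw [← smul_eq_mul]; exact Finset.sum_le_card_nsmul _ _ _ h
theorem le_sum {A : Finset V} {f : V → ℕ} {m : ℕ} (h : ∀ v ∈ A, m ≤ f v) : A.card * m ≤ ∑ v ∈ A, f v := by
  rw [← smul_eq_mul]; exact Finset.card_nsmul_le_sum _ _ _ h

theorem two_of {A : Finset V} (h : 2 ≤ A.card) : ∃ a ∈ A, ∃ b ∈ A, a ≠ b := by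
  obtain ⟨a, ha, b, hb, hab⟩ := Finset.one_lt_card.1 h
  exact ⟨a, ha, b, hb, hab⟩

theorem sumsq10 (hG : Good G) {S : Finset V} (hS : S.card = 10) : ∑ v ∈ S, dd G S v * dd G S v + 10 + ∑ x ∈ S, (Zf G S x).card = 100 := by
  have : ∑ x ∈ S, (∑ y ∈ N G S x, dd G S y + 1 + (Zf G S x).card) = S.card * 10 := sum_eq fun v hv => by rw [ball hG hv, hS]
  rw [Finset.sum_add_distrib, Finset.sum_add_distrib, sum_dd_sq, sum_eq (m := 1) (fun _ _ => rfl), hS] at this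
  omega

theorem F10 (hG : Good G) : Bd G 10 30 := by
  intro S hS
  have h1 := sumsq10 hG hS
  have h2 := conv S (dd G S) 3
  have h3 := e2_even (G := G) S
  change 7 * e2 G S ≤ _ at h2
  omega

theorem F11 (hG : Good G) : Bd G 11 32 := by
  intro S hS
  by_contra hc
  have h3 := e2_even (G := G) S
  by_cases h : ∃ v ∈ S, dd G S v ≤ 2
  · obtain ⟨v, hv, h⟩ := h
    have a1 := F10 hG (S.erase v) (by rw [Finset.card_erase_of_mem hv, hS])
    have a2 := e2_erase (G := G) hv
    have b1 := sumsq10 hG (S := S.erase v) (by rw [Finset.card_erase_of_mem hv, hS])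
    have b2 := conv (S.erase v) (dd G (S.erase v)) 3
    change 7 * e2 G (S.erase v) ≤ _ at b2
    rw [Finset.card_erase_of_mem hv, hS] at b2
    have b3 : ∑ x ∈ S.erase v, (Zf G (S.erase v) x).card = 0 := by omega
    rw [Finset.sum_eq_zero_iff] at b3
    obtain ⟨a, ha, b, hb, hab⟩ := two_of (show 2 ≤ (N G S v).card by change 2 ≤ dd G S v; omega)
    rw [mem_N] at ha hb
    have ha' : a ∈ S.erase v := Finset.mem_erase.2 ⟨ha.2.ne', ha.1⟩
    have hb' : b ∈ S.erase v := Finset.mem_erase.2 ⟨hb.2.ne', hb.1⟩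
    have b4 : b ∉ Zf G (S.erase v) a := by
      rw [Finset.card_eq_zero.1 (b3 a ha')]; simp
    rw [mem_Zf] at b4
    apply b4
    refine ⟨hb', hab.symm, fun h => hG.tri v a b ha.2 h hb.2, ?_⟩
    intro y hy hyb
    rw [mem_N] at hy
    rcases hG.c4 v a y b ha.2 hy.2 hyb hb.2.symm with e | e
    · exact (Finset.mem_erase.1 hy.1).1 e.symm
    · exact hab e
  · push Not at h
    have : ∑ v ∈ S, dd G S v ≤ S.card * 3 := sum_le fun v hv => by
      have := deg_mul hG (m := 3) (fun v hv => h v hv) hv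
      omega
    change e2 G S ≤ _ at this
    omega

theorem F12 (hG : Good G) : Bd G 12 36 := by
  intro S hS
  by_contra hc
  have h3 := e2_even (G := G) S
  have h : ∀ v ∈ S, 3 ≤ dd G S v := fun v hv => by have := (F11 hG).erase hS hv; omega
  have : ∑ v ∈ S, dd G S v ≤ S.card * 3 := sum_le fun v hv => by
    have := deg_mul hG (m := 3) (fun v hv => h v hv) hv
    omega
  change e2 G S ≤ _ at this
  omega

theorem F13 (hG : Good G) : Bd G 13 42 := by
  intro S hS
  have h1 := (F12 hG).avg hS
  have h2 := e2_even (G := G) S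
  omega

theorem F14 (hG : Good G) : Bd G 14 46 := by
  intro S hS
  by_contra hc
  have h1 := (F13 hG).avg hS
  have h2 := e2_even (G := G) S
  have h3 : ∀ v ∈ S, 3 ≤ dd G S v := fun v hv => by have := (F13 hG).erase hS hv; omega
  have h4 : ∀ v ∈ S, dd G S v ≤ 4 := fun v hv => by
    have := deg_mul hG (m := 3) h3 hv
    omega
  have h5 : ∀ v ∈ S, 3 ≤ dd G S v ∧ dd G S v ≤ 3 + 2 := fun v hv => ⟨h3 v hv, (h4 v hv).trans (by omega)⟩
  obtain ⟨c1, c2, c3, c4⟩ := split3d 3 h5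
  obtain ⟨d1, d2⟩ := cls0 (G := G) (S := S) (k := 5) (fun v hv => by have := h4 v hv; omega)
  norm_num at c1 c2 c3 c4
  have h6 : ∀ v ∈ cls G S 3, dd G (cls G S 4) v = 3 := by
    intro v hv
    have a1 : dd G (cls G S 3) v = 0 := dd_zero fun w hw ha => by
      have := (F12 hG).pair hS (mem_cls.1 hv).1 (mem_cls.1 hw).1 ha
      rw [(mem_cls.1 hv).2, (mem_cls.1 hw).2] at this
      omega
    have := c3 v
    rw [a1, d2, (mem_cls.1 hv).2] at this
    omega
  have h7 := pairs hG (cls_sub (G := G) (S := S) (k := 4))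
  rw [split3 3 h5 (fun v => dd G (cls G S 4) v * _), split3 3 h5] at h7
  norm_num at h7
  rw [sum_eq (m := 9) (fun v hv => by rw [h6 v hv]), sum_eq (A := cls G S 3) h6] at h7
  have h8 := conv (cls G S 4) (dd G (cls G S 4)) 0
  have h9 := conv (cls G S 5) (dd G (cls G S 4)) 0
  have e4 : (cls G S 4).card = 6 := by omega
  rw [e4] at h7 h8
  omega

theorem F15 (hG : Good G) : Bd G 15 52 := by
  intro S hS
  have h1 := (F14 hG).avg hS
  have h2 := e2_even (G := G) S
  omega

theorem zs0 {S : Finset V} {x : V} (h : (Zf G S x).card = 0) : ∀ v, v ∈ ([] : List V) ↔ v ∈ Zf G S x := by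
  rw [Finset.card_eq_zero.1 h]; simp

theorem low_nbr {S : Finset V} {x : V} {k : ℕ} (hk : ∀ a ∈ cls G S k, ∀ b ∈ cls G S k, ¬ G.Adj a b) (hz : (Zf G S x).card = 0)
    (hxk : dd G S x ≠ k) (hn : ∀ v ∈ N G S x, dd G S v = k) : (cls G S k).card ≤ dd G S x := by
  apply Finset.card_le_card
  intro v hv
  by_contra hc
  have : v ∉ Zf G S x := by rw [Finset.card_eq_zero.1 hz]; simp
  rw [mem_Zf] at this
  apply this
  refine ⟨(mem_cls.1 hv).1, ?_, ?_, ?_⟩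
  · rintro rfl; exact hxk (mem_cls.1 hv).2
  · intro h; exact hc (mem_N.2 ⟨(mem_cls.1 hv).1, h⟩)
  · intro y hy
    exact hk y (mem_cls.2 ⟨N_sub hy, hn y hy⟩) v hv

theorem F16 (hG : Good G) : Bd G 16 56 := by
  intro S hS
  by_contra hc
  have h1 := (F15 hG).avg hS
  have h2 := e2_even (G := G) S
  have h3 : ∀ v ∈ S, 3 ≤ dd G S v := fun v hv => by have := (F15 hG).erase hS hv; omega
  have h4 : ∀ v ∈ S, dd G S v ≤ 5 := fun v hv => by
    have := deg_mul hG (m := 3) h3 hv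
    omega
  have h5 : ∀ v ∈ S, 3 ≤ dd G S v ∧ dd G S v ≤ 3 + 2 := fun v hv => ⟨h3 v hv, h4 v hv⟩
  obtain ⟨c1, c2, c3, c4⟩ := split3d 3 h5
  norm_num at c1 c2 c3 c4
  have h6 : ∀ v ∈ cls G S 3, ∀ w ∈ cls G S 3, ¬ G.Adj v w := by
    intro v hv w hw ha
    have := (F14 hG).pair hS (mem_cls.1 hv).1 (mem_cls.1 hw).1 ha
    rw [(mem_cls.1 hv).2, (mem_cls.1 hw).2] at this
    omega
  have h7 : ∀ v ∈ S, dd G S v ≠ 5 := by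
    intro x hx e
    have b := ball hG hx
    have b1 := c3 x
    rw [c4 x] at b
    have : (cls G S 3).card ≤ dd G S x := by
      apply low_nbr h6 (by omega) (by omega)
      intro v hv
      by_contra hv3
      have := h5 v (N_sub hv)
      have hv4 : dd G S v = 4 ∨ dd G S v = 5 := by omega
      rcases hv4 with h | h
      · have := dd_pos (mem_cls.2 ⟨N_sub hv, h⟩) (mem_N.1 hv).2
        omega
      · have := dd_pos (mem_cls.2 ⟨N_sub hv, h⟩) (mem_N.1 hv).2
        omega
    omega
  obtain ⟨d1, d2⟩ := cls0 h7
  simp only [d1, d2] at c1 c2 c3 c4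
  have e1 := dd_comm (G := G) (cls G S 4) (cls G S 3)
  rw [sum_eq (A := cls G S 3) (m := 3) (fun v hv => by
    have := c3 v
    rw [dd_zero (h6 v hv), (mem_cls.1 hv).2] at this
    omega)] at e1
  have : ∃ x ∈ cls G S 4, dd G (cls G S 3) x ≤ 1 := by
    by_contra hcon
    push Not at hcon
    have := le_sum (m := 2) hcon
    omega
  obtain ⟨x, hx4, hx1⟩ := this
  have hx := (mem_cls.1 hx4).1
  have b := ball hG hx
  have b0 := c3 x
  have b1 := c4 x
  rw [(mem_cls.1 hx4).2] at b0
  refine starU c10 hG hx (fun v => dd G S v = 3) (fun v => ¬ dd G S v = 3) (fun _ => Iff.rfl) [] (by simp) (zs0 (by omega)) 1 2 3 3 3 3 2 3 [] rfl (fE (fun _ => Iff.rfl) (by omega)) (fN (fun _ => Iff.rfl) (by rw [(mem_cls.1 hx4).2]; omega)) ?_ ?_ (by simp) ?_ (by simp [s10]) (by simp [s10])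
  · intro y hy hq
    refine ⟨by omega, fun v hv _ => ?_⟩
    have := h5 v (N_sub hv)
    have := h7 v (N_sub hv)
    have : dd G S v ≠ 3 := fun h => h6 y (mem_cls.2 ⟨N_sub hy, hq⟩) v (mem_cls.2 ⟨N_sub hv, h⟩) (mem_N.1 hv).2
    omega
  · intro y hy hq
    have := h5 y (N_sub hy)
    have := h7 y (N_sub hy)
    refine ⟨by omega, fun v hv _ => ?_⟩
    have := h5 v (N_sub hv)
    have := h7 v (N_sub hv)
    omega
  · rw [(mem_cls.1 hx4).2]
    simp [s10]; omega

end
end Eng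
end

section
open Finset
namespace Eng
noncomputable section
open Classical
variable {V : Type} {G : SimpleGraph V}

theorem F17 (hG : Good G) : Bd G 17 62 := by
  intro S hS
  have h1 := (F16 hG).avg hS
  have h2 := e2_even (G := G) S
  omega
theorem F18 (hG : Good G) : Bd G 18 68 := by
  intro S hS
  have h1 := (F17 hG).avg hS
  have h2 := e2_even (G := G) S
  omega
theorem F19 (hG : Good G) : Bd G 19 76 := by
  intro S hS
  have h1 := (F18 hG).avg hS
  have h2 := e2_even (G := G) S
  omega
theorem F20 (hG : Good G) : Bd G 20 82 := by
  intro S hS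
  by_contra hc
  have h3 := e2_even (G := G) S
  have h : ∀ v ∈ S, 4 ≤ dd G S v := fun v hv => by have := (F19 hG).erase hS hv; omega
  have : ∑ v ∈ S, dd G S v ≤ S.card * 4 := sum_le fun v hv => by
    have := deg_mul hG (m := 4) (fun v hv => h v hv) hv
    omega
  change e2 G S ≤ _ at this
  omega

theorem Bd.path {n m : ℕ} (h : Bd G n m) {S : Finset V} (hS : S.card = n + 3) {a b c : V} (ha : a ∈ S) (hb : b ∈ S) (hc : c ∈ S) (hab : G.Adj b a) (hbc : G.Adj b c) (hac : a ≠ c) :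
    e2 G S + 4 ≤ m + 2 * dd G S a + 2 * dd G S b + 2 * dd G S c := by
  have h1 := del_star (T := {a, c}) hb (by
    intro v hv
    rw [Finset.mem_insert, Finset.mem_singleton] at hv
    rcases hv with rfl | rfl
    · exact mem_N.2 ⟨ha, hab⟩
    · exact mem_N.2 ⟨hc, hbc⟩)
  rw [Finset.sum_pair hac, Finset.card_pair hac] at h1
  have := h _ (by omega : (S \ insert b {a, c}).card = n)
  omega

theorem F21 (hG : Good G) : Bd G 21 88 := by
  intro S hS
  by_contra hc
  have h1 := (F20 hG).avg hS
  have h2 := e2_even (G := G) S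
  have h3 : ∀ v ∈ S, 4 ≤ dd G S v := fun v hv => by have := (F20 hG).erase hS hv; omega
  have h4 : ∀ v ∈ S, dd G S v ≤ 5 := fun v hv => by
    have := deg_mul hG (m := 4) h3 hv
    omega
  have h5 : ∀ v ∈ S, 4 ≤ dd G S v ∧ dd G S v ≤ 4 + 2 := fun v hv => ⟨h3 v hv, (h4 v hv).trans (by omega)⟩
  obtain ⟨c1, c2, c3, c4⟩ := split3d 4 h5
  obtain ⟨d1, d2⟩ := cls0 (G := G) (S := S) (k := 6) (fun v hv => by have := h4 v hv; omega)
  norm_num at c1 c2 c3 c4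
  simp only [d1, d2] at c1 c2 c3 c4
  have e1 := dd_comm (G := G) (cls G S 4) (cls G S 5)
  rw [sum_eq (A := cls G S 5) (m := 5) (fun v hv => by
    have b := ball hG (mem_cls.1 hv).1
    have b1 := c3 v
    have b2 := c4 v
    rw [(mem_cls.1 hv).2] at b1
    omega)] at e1
  have h6 : ∀ v ∈ cls G S 4, dd G (cls G S 4) v ≤ 1 := by
    intro v hv
    by_contra hcon
    obtain ⟨a, ha, b, hb, hab⟩ := two_of (show 2 ≤ (N G (cls G S 4) v).card by change 2 ≤ dd _ _ _; omega)
    rw [mem_N, mem_cls] at ha hb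
    have := (F18 hG).path hS ha.1.1 (mem_cls.1 hv).1 hb.1.1 ha.2 hb.2 hab
    rw [ha.1.2, hb.1.2, (mem_cls.1 hv).2] at this
    omega
  have h7 : (cls G S 4).card * 3 ≤ ∑ v ∈ cls G S 4, dd G (cls G S 5) v := le_sum fun v hv => by
    have := h6 v hv
    have := c3 v
    rw [(mem_cls.1 hv).2] at this
    omega
  omega

theorem F22 (hG : Good G) : Bd G 22 94 := by
  intro S hS
  by_contra hc
  have h1 := (F21 hG).avg hS
  have h2 := e2_even (G := G) S
  have h3 : ∀ v ∈ S, 4 ≤ dd G S v := fun v hv => by have := (F21 hG).erase hS hv; omega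
  have h4 : ∀ v ∈ S, dd G S v ≤ 5 := fun v hv => by
    have := deg_mul hG (m := 4) h3 hv
    omega
  have h5 : ∀ v ∈ S, 4 ≤ dd G S v ∧ dd G S v ≤ 4 + 2 := fun v hv => ⟨h3 v hv, (h4 v hv).trans (by omega)⟩
  obtain ⟨c1, c2, c3, c4⟩ := split3d 4 h5
  obtain ⟨d1, d2⟩ := cls0 (G := G) (S := S) (k := 6) (fun v hv => by have := h4 v hv; omega)
  norm_num at c1 c2 c3 c4
  simp only [d1, d2] at c1 c2 c3 c4
  have n5 : (cls G S 5).card = 8 := by omega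
  have n4 : (cls G S 4).card = 14 := by omega
  have h6 : ∀ v ∈ cls G S 5, dd G (cls G S 5) v ≤ 1 := by
    intro v hv
    have b := ball hG (mem_cls.1 hv).1
    have b1 := c3 v
    have b2 := c4 v
    rw [(mem_cls.1 hv).2] at b1
    omega
  by_cases h7 : ∃ x ∈ cls G S 5, dd G (cls G S 5) x = 1
  · obtain ⟨x, hx5, hx1⟩ := h7
    have hx := (mem_cls.1 hx5).1
    have b := ball hG hx
    have b0 := c3 x
    have b1 := c4 x
    have hxd := (mem_cls.1 hx5).2
    refine starU c6 hG hx (fun v => dd G S v = 4) (fun v => ¬ dd G S v = 4) (fun _ => Iff.rfl) [] (by simp) (zs0 (by omega)) 4 3 3 4 1 4 3 3 [] rfl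
      (fE (fun _ => Iff.rfl) (by omega)) (fN (fun _ => Iff.rfl) (by omega)) ?_ ?_ (by simp) ?_ (by simp [s6]) (by simp [s6])
    · intro y hy hq
      refine ⟨by omega, fun v hv _ => ?_⟩
      have := h4 v (N_sub hv)
      have := h3 v (N_sub hv)
      omega
    · intro y hy hq
      have a1 := h4 y (N_sub hy)
      have a2 := h3 y (N_sub hy)
      refine ⟨by omega, fun v hv hvx => ?_⟩
      have := h4 v (N_sub hv)
      have := h3 v (N_sub hv)
      have : dd G S v ≠ 5 := by
        intro hv5
        have a3 := h6 y (mem_cls.2 ⟨N_sub hy, by omega⟩)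
        have a4 := Finset.card_le_one.1 a3 v (mem_N.2 ⟨mem_cls.2 ⟨N_sub hv, hv5⟩, (mem_N.1 hv).2⟩) x (mem_N.2 ⟨hx5, (mem_N.1 hy).2.symm⟩)
        exact hvx a4
      omega
    · simp [s6]; omega
  · push Not at h7
    have h8 : ∀ v ∈ cls G S 5, dd G (cls G S 5) v = 0 := fun v hv => by
      have := h6 v hv
      have := h7 v hv
      omega
    have e1 := dd_comm (G := G) (cls G S 4) (cls G S 5)
    rw [sum_eq (A := cls G S 5) (m := 5) (fun v hv => by
      have b1 := c3 v
      have b2 := h8 v hv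
      rw [(mem_cls.1 hv).2] at b1
      omega)] at e1
    have p := pairs hG (cls_sub (G := G) (S := S) (k := 5))
    rw [split3 4 h5 (fun v => dd G (cls G S 5) v * _), split3 4 h5] at p
    norm_num at p
    rw [sum_eq (A := cls G S 5) h8] at p
    have q := conv (cls G S 4) (dd G (cls G S 5)) 2
    rw [n4] at q
    rw [n5] at p e1
    rw [cls_empty (k := 6) (fun v hv => by have := h4 v hv; omega)] at p
    simp only [Finset.sum_empty] at p
    omega

theorem F23 (hG : Good G) : Bd G 23 100 := by
  intro S hS
  by_contra hc
  have h1 := (F22 hG).avg hS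
  have h2 := e2_even (G := G) S
  have h3 : ∀ v ∈ S, 4 ≤ dd G S v := fun v hv => by have := (F22 hG).erase hS hv; omega
  have h4 : ∀ v ∈ S, dd G S v ≤ 5 := fun v hv => by
    have := deg_mul hG (m := 4) h3 hv
    omega
  have h5 : ∀ v ∈ S, 4 ≤ dd G S v ∧ dd G S v ≤ 4 + 2 := fun v hv => ⟨h3 v hv, (h4 v hv).trans (by omega)⟩
  obtain ⟨c1, c2, c3, c4⟩ := split3d 4 h5
  obtain ⟨d1, d2⟩ := cls0 (G := G) (S := S) (k := 6) (fun v hv => by have := h4 v hv; omega)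
  norm_num at c1 c2 c3 c4
  simp only [d1, d2] at c1 c2 c3 c4
  have n5 : (cls G S 5).card = 10 := by omega
  have n4 : (cls G S 4).card = 13 := by omega
  have h6 : ∀ v ∈ cls G S 5, dd G (cls G S 5) v ≤ 2 := by
    intro v hv
    have b := ball hG (mem_cls.1 hv).1
    have b1 := c3 v
    have b2 := c4 v
    rw [(mem_cls.1 hv).2] at b1
    omega
  by_cases h7 : ∃ x ∈ cls G S 5, dd G (cls G S 5) x = 2
  · obtain ⟨x, hx5, hx1⟩ := h7
    have hx := (mem_cls.1 hx5).1
    have b := ball hG hx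
    have b0 := c3 x
    have b1 := c4 x
    have hxd := (mem_cls.1 hx5).2
    refine starU c7 hG hx (fun v => dd G S v = 4) (fun v => ¬ dd G S v = 4) (fun _ => Iff.rfl) [] (by simp) (zs0 (by omega)) 3 3 3 4 2 4 3 4 [] rfl
      (fE (fun _ => Iff.rfl) (by omega)) (fN (fun _ => Iff.rfl) (by omega)) ?_ ?_ (by simp) ?_ (by simp [s7]) (by simp [s7])
    · intro y hy hq
      refine ⟨by omega, fun v hv _ => ?_⟩
      have := h4 v (N_sub hv)
      have := h3 v (N_sub hv)
      omega
    · intro y hy hq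
      have a1 := h4 y (N_sub hy)
      have a2 := h3 y (N_sub hy)
      refine ⟨by omega, fun v hv hvx => ?_⟩
      have := h4 v (N_sub hv)
      have := h3 v (N_sub hv)
      omega
    · simp [s7]; omega
  · push Not at h7
    have h8 : ∀ v ∈ cls G S 5, dd G (cls G S 5) v ≤ 1 := fun v hv => by
      have := h6 v hv
      have := h7 v hv
      omega
    have e1 := dd_comm (G := G) (cls G S 4) (cls G S 5)
    have e3 : ∑ v ∈ cls G S 5, dd G (cls G S 4) v + ∑ v ∈ cls G S 5, dd G (cls G S 5) v = (cls G S 5).card * 5 := by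
      rw [← Finset.sum_add_distrib]
      apply sum_eq
      intro v hv
      have b1 := c3 v
      rw [(mem_cls.1 hv).2] at b1
      omega
    have e4 := sum_le h8
    have p := pairs hG (cls_sub (G := G) (S := S) (k := 5))
    rw [split3 4 h5 (fun v => dd G (cls G S 5) v * _), split3 4 h5] at p
    norm_num at p
    have q := conv (cls G S 4) (dd G (cls G S 5)) 3
    have q2 := conv (cls G S 5) (dd G (cls G S 5)) 0
    rw [n4] at q
    rw [n5] at p e3 e4
    rw [cls_empty (k := 6) (fun v hv => by have := h4 v hv; omega)] at p
    simp only [Finset.sum_empty, e2] at p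
    omega

theorem F24 (hG : Good G) : Bd G 24 108 := by
  intro S hS
  have h1 := (F23 hG).avg hS
  have h2 := e2_even (G := G) S
  omega

theorem F25 (hG : Good G) : Bd G 25 114 := by
  intro S hS
  by_contra hc
  have h1 := (F24 hG).avg hS
  have h2 := e2_even (G := G) S
  have h3 : ∀ v ∈ S, 4 ≤ dd G S v := fun v hv => by have := (F24 hG).erase hS hv; omega
  have h4 : ∀ v ∈ S, dd G S v ≤ 6 := fun v hv => by
    have := deg_mul hG (m := 4) h3 hv
    omega
  have h5 : ∀ v ∈ S, 4 ≤ dd G S v ∧ dd G S v ≤ 4 + 2 := fun v hv => ⟨h3 v hv, h4 v hv⟩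
  obtain ⟨c1, c2, c3, c4⟩ := split3d 4 h5
  norm_num at c1 c2 c3 c4
  have h6 : ∀ v ∈ cls G S 4, ∀ w ∈ cls G S 4, ¬ G.Adj v w := by
    intro v hv w hw ha
    have := (F23 hG).pair hS (mem_cls.1 hv).1 (mem_cls.1 hw).1 ha
    rw [(mem_cls.1 hv).2, (mem_cls.1 hw).2] at this
    omega
  have h7 : ∀ v ∈ S, dd G S v ≠ 6 := by
    intro x hx e
    have b := ball hG hx
    have b1 := c3 x
    rw [c4 x] at b
    have : (cls G S 4).card ≤ dd G S x := by
      apply low_nbr h6 (by omega) (by omega)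
      intro v hv
      by_contra hv3
      have := h5 v (N_sub hv)
      have hv4 : dd G S v = 5 ∨ dd G S v = 6 := by omega
      rcases hv4 with h | h
      · have := dd_pos (mem_cls.2 ⟨N_sub hv, h⟩) (mem_N.1 hv).2
        omega
      · have := dd_pos (mem_cls.2 ⟨N_sub hv, h⟩) (mem_N.1 hv).2
        omega
    omega
  obtain ⟨d1, d2⟩ := cls0 h7
  simp only [d1, d2] at c1 c2 c3 c4
  have e1 := dd_comm (G := G) (cls G S 5) (cls G S 4)
  rw [sum_eq (A := cls G S 4) (m := 4) (fun v hv => by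
    have := c3 v
    rw [dd_zero (h6 v hv), (mem_cls.1 hv).2] at this
    omega)] at e1
  have : ∃ x ∈ cls G S 5, dd G (cls G S 4) x ≤ 2 := by
    by_contra hcon
    push Not at hcon
    have := le_sum (m := 3) hcon
    omega
  obtain ⟨x, hx5, hx1⟩ := this
  have hx := (mem_cls.1 hx5).1
  have b := ball hG hx
  have b0 := c3 x
  have b1 := c4 x
  have hxd := (mem_cls.1 hx5).2
  have g1 : ∀ y ∈ N G S x, dd G S y = 4 → dd G S y = 3 + 1 ∧ ∀ v ∈ N G S y, v ≠ x → 4 + 1 ≤ dd G S v ∧ dd G S v ≤ 4 + 1 := by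
    intro y hy hq
    refine ⟨by omega, fun v hv _ => ?_⟩
    have := h5 v (N_sub hv)
    have := h7 v (N_sub hv)
    have : dd G S v ≠ 4 := fun h => h6 y (mem_cls.2 ⟨N_sub hy, hq⟩) v (mem_cls.2 ⟨N_sub hv, h⟩) (mem_N.1 hv).2
    omega
  have g2 : ∀ y ∈ N G S x, ¬ dd G S y = 4 → dd G S y = 4 + 1 ∧ ∀ v ∈ N G S y, v ≠ x → 3 + 1 ≤ dd G S v ∧ dd G S v ≤ 4 + 1 := by
    intro y hy hq
    have := h5 y (N_sub hy)
    have := h7 y (N_sub hy)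
    refine ⟨by omega, fun v hv _ => ?_⟩
    have := h5 v (N_sub hv)
    have := h7 v (N_sub hv)
    omega
  have cs : dd G (cls G S 4) x = 1 ∨ dd G (cls G S 4) x = 2 := by omega
  rcases cs with cs | cs
  · refine starU c8 hG hx (fun v => dd G S v = 4) (fun v => ¬ dd G S v = 4) (fun _ => Iff.rfl) [] (by simp) (zs0 (by omega)) 1 3 4 4 4 4 3 4 [] rfl
      (fE (fun _ => Iff.rfl) (by omega)) (fN (fun _ => Iff.rfl) (by omega)) g1 g2 (by simp) ?_ (by simp [s8]) (by simp [s8])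
    simp [s8]; omega
  · obtain ⟨z, hz⟩ := Finset.card_eq_one.1 (show (Zf G S x).card = 1 by omega)
    have hzS : z ∈ S := (mem_Zf.1 (hz ▸ Finset.mem_singleton_self z : z ∈ Zf G S x)).1
    refine starU c9 hG hx (fun v => dd G S v = 4) (fun v => ¬ dd G S v = 4) (fun _ => Iff.rfl) [z] (by simp) (by simp [hz]) 2 3 4 4 3 4 3 4 [(4, 5)] rfl
      (fE (fun _ => Iff.rfl) (by omega)) (fN (fun _ => Iff.rfl) (by omega)) g1 g2 ?_ ?_ (by simp [s9]) (by simp [s9])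
    · refine List.Forall₂.cons ?_ List.Forall₂.nil
      have := h5 z hzS
      have := h7 z hzS
      constructor
      · change 4 ≤ _; omega
      · change _ ≤ 5; omega
    · simp [s9]; omega

theorem F26 (hG : Good G) : Bd G 26 122 := by
  intro S hS
  have h1 := (F25 hG).avg hS
  have h2 := e2_even (G := G) S
  omega
theorem F27 (hG : Good G) : Bd G 27 130 := by
  intro S hS
  have h1 := (F26 hG).avg hS
  have h2 := e2_even (G := G) S
  omega

end
end Eng
end

section
open Finset
namespace Eng
noncomputable section
open Classical
variable {V : Type} {G : SimpleGraph V}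

theorem grp_mix {S : Finset V} {x y : V} (p : V → Prop) (hx : x ∈ S) (hy : y ∈ N G S x) (B : Finset V) (hB : ∀ v, v ∈ B ↔ (v ∈ N G S y ∧ v ≠ x) ∧ p v)
    (k1 k2 lo1 up1 lo2 up2 : ℕ) (hk1 : B.card = k1) (hk2 : dd G S y = k1 + k2 + 1)
    (h1 : ∀ v ∈ N G S y, v ≠ x → p v → lo1 + 1 ≤ dd G S v ∧ dd G S v ≤ up1 + 1)
    (h2 : ∀ v ∈ N G S y, v ≠ x → ¬ p v → lo2 + 1 ≤ dd G S v ∧ dd G S v ≤ up2 + 1) :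
    List.Forall₂ (fun v (p : ℕ × ℕ) => p.1 + 1 ≤ dd G S v ∧ dd G S v ≤ p.2 + 1) (grpP G S x p y) (List.replicate k1 (lo1, up1) ++ List.replicate k2 (lo2, up2)) := by
  have e1 : ((N G S y).erase x).filter p = B := by
    ext v
    rw [hB, Finset.mem_filter, Finset.mem_erase]
    tauto
  have e2 := Finset.card_filter_add_card_filter_not (s := (N G S y).erase x) p
  rw [e1, Finset.card_erase_of_mem (mem_N' hx hy)] at e2
  change _ + _ = dd G S y - 1 at e2
  rw [grpP]
  apply f2_app
  · apply f2_rep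
    · rw [Finset.length_toList, e1, hk1]
    · intro v hv
      rw [Finset.mem_toList, Finset.mem_filter, Finset.mem_erase] at hv
      exact h1 v hv.1.2 hv.1.1 hv.2
  · apply f2_rep
    · rw [Finset.length_toList]; omega
    · intro v hv
      rw [Finset.mem_toList, Finset.mem_filter, Finset.mem_erase] at hv
      exact h2 v hv.1.2 hv.1.1 hv.2

theorem starL {s : Spec} (h : runSpec s = true) (hG : Good G) {S : Finset V} {x y0 : V} (hx : x ∈ S) (hy0 : y0 ∈ N G S x) (p : V → Prop)
    (zs : List V) (hzn : zs.Nodup) (hz : ∀ v, v ∈ zs ↔ v ∈ Zf G S x)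
    (k1 g1 lo1 up1 : ℕ) (m : List (ℕ × ℕ)) (spz : List (ℕ × ℕ))
    (hsp : s.sp = (List.replicate k1 (List.replicate g1 (lo1, up1)) ++ [m]) ++ spz.map fun p => [p])
    (hk1 : dd G S x = k1 + 1)
    (h1 : ∀ y ∈ N G S x, y ≠ y0 → dd G S y = g1 + 1 ∧ ∀ v ∈ N G S y, v ≠ x → lo1 + 1 ≤ dd G S v ∧ dd G S v ≤ up1 + 1)
    (h2 : List.Forall₂ (fun v (p : ℕ × ℕ) => p.1 + 1 ≤ dd G S v ∧ dd G S v ≤ p.2 + 1) (grpP G S x p y0) m)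
    (hFz : List.Forall₂ (fun v (p : ℕ × ℕ) => p.1 ≤ dd G S v ∧ dd G S v ≤ p.2) zs spz)
    (bud : (s.sp.map fun l => (l.map fun p => p.2).sum).sum + dd G S x + (∑ y ∈ N G S x, dd G S y) + (k1 * g1 + m.length) ≤ e2 G S + s.bud)
    (pre : s.pre = []) (non : s.non = []) : False := by
  have e1 : ((N G S x).filter fun v => v = y0) = {y0} := by
    ext v
    rw [Finset.mem_filter, Finset.mem_singleton]
    constructor
    · exact fun h => h.2
    · rintro rfl; exact ⟨hy0, rfl⟩
  have e2 : ((N G S x).filter fun v => ¬ v = y0).card = k1 := by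
    have := Finset.card_filter_add_card_filter_not (s := N G S x) (fun v => v = y0)
    rw [e1, Finset.card_singleton] at this
    change _ = dd G S x at this
    have e3 : ((N G S x).filter fun v => ¬ v = y0).card + 1 = k1 + 1 := by rw [← hk1, ← this, add_comm]
    omega
  refine starP h hG hx p (fun v => ¬ v = y0) (fun v => v = y0) (fun v => not_not.symm) zs hzn hz _ _ spz hsp
    (f2_uni hx p _ k1 g1 lo1 up1 (by convert e2) h1) ?_ hFz ?_ (by simp [pre]) (by simp [non])
  · have e3 : ((N G S x).filter fun v => v = y0).toList = [y0] := by rw [e1, Finset.toList_singleton]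
    have e4 : List.Forall₂ (fun y l => List.Forall₂ (fun v (p : ℕ × ℕ) => p.1 + 1 ≤ dd G S v ∧ dd G S v ≤ p.2 + 1) (grpP G S x p y) l) [y0] [m] := List.Forall₂.cons h2 List.Forall₂.nil
    rw [← e3] at e4
    convert e4
  · refine le_trans (le_of_eq ?_) bud
    simp

theorem fT {S : Finset V} {x : V} {m : ℕ} {q : V → Prop} {_ : DecidablePred q} (hq : ∀ v ∈ N G S x, q v) (h : dd G S x = m) : ((N G S x).filter q).card = m := by
  rw [Finset.filter_true_of_mem hq]; exact h
theorem fF {S : Finset V} {x : V} {q : V → Prop} {_ : DecidablePred q} (hq : ∀ v ∈ N G S x, ¬ q v) : ((N G S x).filter q).card = 0 := by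
  rw [Finset.filter_false_of_mem hq]; rfl

theorem P28a0 (hG : Good G) {S : Finset V} (hS : S.card = 28) (he : e2 G S = 138) (h5 : ∀ v ∈ S, dd G S v = 4 ∨ dd G S v = 5)
    (h6 : ∀ v ∈ cls G S 4, ∀ w ∈ cls G S 4, ¬ G.Adj v w) (n4 : (cls G S 4).card = 2) : False := by
  obtain ⟨u, v, huv, e4⟩ := Finset.card_eq_two.1 n4
  have mem4 : ∀ w ∈ S, dd G S w = 4 → w = u ∨ w = v := by
    intro w hw h
    have : w ∈ cls G S 4 := mem_cls.2 ⟨hw, h⟩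
    rw [e4] at this
    simpa using this
  obtain ⟨huS, hu⟩ := mem_cls.1 (show u ∈ cls G S 4 by rw [e4]; simp)
  obtain ⟨hvS, hv⟩ := mem_cls.1 (show v ∈ cls G S 4 by rw [e4]; simp)
  have d5 : ∀ w ∈ S, w ≠ u → w ≠ v → dd G S w = 5 := by
    intro w hw h1 h2
    rcases h5 w hw with h | h
    · rcases mem4 w hw h with h | h
      · exact absurd h h1
      · exact absurd h h2
    · exact h
  have nuv : ¬ G.Adj u v := h6 u (mem_cls.2 ⟨huS, hu⟩) v (mem_cls.2 ⟨hvS, hv⟩)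
  have ncom : ∀ w ∈ S, G.Adj w u → G.Adj w v → False := by
    intro w hw h1 h2
    have := (F25 hG).path hS huS hw hvS h1 h2 huv
    have := d5 w hw (by rintro rfl; exact nadj _ h1) (by rintro rfl; exact nadj _ h2)
    omega
  have bu := ball hG huS
  rw [sum_eq (m := 5) (fun w hw => d5 w (N_sub hw) (by rintro rfl; exact nadj _ (mem_N.1 hw).2) (by rintro rfl; exact nuv (mem_N.1 hw).2))] at bu
  change dd G S u * 5 + _ + _ = _ at bu
  obtain ⟨x, hxu, hxv⟩ : ∃ x ∈ Zf G S u, x ∉ insert v (N G S v) := by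
    by_contra hcon
    push Not at hcon
    have h1 := Finset.card_le_card (fun x hx => hcon x hx : Zf G S u ⊆ insert v (N G S v))
    have h2 := Finset.card_insert_le v (N G S v)
    change _ ≤ dd G S v + 1 at h2
    omega
  rw [mem_Zf] at hxu
  rw [Finset.mem_insert, mem_N] at hxv
  push Not at hxv
  obtain ⟨hx, hxu1, hxu2, hxu3⟩ := hxu
  have hxv2 := hxv.2 hx
  have hxd := d5 x hx hxu1 hxv.1
  have dy : ∀ y ∈ N G S x, dd G S y = 5 := fun y hy => d5 y (N_sub hy) (by rintro rfl; exact hxu2 (mem_N.1 hy).2.symm) (by rintro rfl; exact hxv2 (mem_N.1 hy).2.symm)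
  have bx := ball hG hx
  have bs : ∑ y ∈ N G S x, dd G S y = 25 := by
    rw [sum_eq dy]; change dd G S x * 5 = _; omega
  have huZ : u ∈ Zf G S x := by
    rw [mem_Zf]
    refine ⟨huS, hxu1.symm, fun h => hxu2 h.symm, ?_⟩
    intro y hy h
    exact hxu3 y (mem_N.2 ⟨N_sub hy, h.symm⟩) (mem_N.1 hy).2.symm
  have : ((Zf G S x).erase u).card = 1 := by rw [Finset.card_erase_of_mem huZ]; omega
  obtain ⟨z, hz⟩ := Finset.card_eq_one.1 this
  have hzz : z ∈ (Zf G S x).erase u := by rw [hz]; simp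
  rw [Finset.mem_erase] at hzz
  have hzs : ∀ w, w ∈ [u, z] ↔ w ∈ Zf G S x := by
    intro w
    rw [← Finset.insert_erase huZ, hz]
    simp
  have hzn : [u, z].Nodup := by simp [hzz.1.symm]
  have hzS := (mem_Zf.1 hzz.2).1
  have nu : ∀ y ∈ N G S x, ∀ w ∈ N G S y, w ≠ u := by
    rintro y hy w hw rfl
    exact (mem_Zf.1 huZ).2.2.2 y hy (mem_N.1 hw).2
  by_cases hzv : z = v
  · have nv : ∀ y ∈ N G S x, ∀ w ∈ N G S y, w ≠ v := by
      rintro y hy w hw rfl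
      exact (mem_Zf.1 hzz.2).2.2.2 y hy (hzv ▸ (mem_N.1 hw).2)
    refine starU c4 hG hx (fun v => dd G S v = 5) (fun v => ¬ dd G S v = 5) (fun _ => Iff.rfl) [u, z] hzn hzs 5 4 4 4 0 0 0 0 [(4, 4), (4, 4)] rfl
      ?_ ?_ ?_ ?_ ?_ ?_ (by simp [s4]) (by simp [s4])
    · exact fT dy hxd
    · exact fF fun y hy h => h (dy y hy)
    · intro y hy h
      refine ⟨h, fun w hw _ => ?_⟩
      have := d5 w (N_sub hw) (nu y hy w hw) (nv y hy w hw)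
      omega
    · intro y hy h
      exact absurd (dy y hy) h
    · subst hzv
      exact List.Forall₂.cons (by simp [hu]) (List.Forall₂.cons (by simp [hv]) List.Forall₂.nil)
    · rw [bs]; simp [s4]; omega
  · have : v ∉ Zf G S x := by
      rw [← hzs]
      simp only [List.mem_cons, List.not_mem_nil, or_false]
      rintro (h | h)
      · exact huv h.symm
      · exact hzv h.symm
    rw [mem_Zf] at this
    push Not at this
    obtain ⟨y0, hy0, hy0v⟩ := this hvS (Ne.symm hxv.1) (fun h => hxv2 h.symm)
    refine starL c3 hG hx hy0 (fun w => w ≠ v) [u, z] hzn hzs 4 4 4 4 [(4, 4), (4, 4), (4, 4), (3, 3)] [(4, 4), (5, 5)] rfl hxd ?_ ?_ ?_ ?_ rfl rfl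
    · intro y hy hne
      refine ⟨dy y hy, fun w hw hwx => ?_⟩
      have := d5 w (N_sub hw) (nu y hy w hw) (by
        rintro rfl
        rcases hG.c4 x y w y0 (mem_N.1 hy).2 (mem_N.1 hw).2 hy0v.symm (mem_N.1 hy0).2.symm with e | e
        · exact hwx e.symm
        · exact hne e)
      omega
    · refine grp_mix (fun w => w ≠ v) hx hy0 (((N G S y0).erase x).erase v) ?_ 3 1 4 4 3 3 ?_ ?_ ?_ ?_
      · intro w
        rw [Finset.mem_erase, Finset.mem_erase]
        tauto
      · rw [Finset.card_erase_of_mem, Finset.card_erase_of_mem (mem_N' hx hy0)]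
        · change dd G S y0 - 1 - 1 = 3
          rw [dy y0 hy0]
        · exact Finset.mem_erase.2 ⟨Ne.symm hxv.1, mem_N.2 ⟨hvS, hy0v⟩⟩
      · exact dy y0 hy0
      · intro w hw _ h
        have := d5 w (N_sub hw) (nu y0 hy0 w hw) h
        omega
      · intro w hw _ h
        rw [not_not] at h
        subst h
        omega
    · have := d5 z hzS hzz.1 hzv
      exact List.Forall₂.cons (by simp [hu]) (List.Forall₂.cons (by simp [this]) List.Forall₂.nil)
    · rw [bs]; simp [s3]; omega

theorem P28a1 (hG : Good G) {S : Finset V} (hS : S.card = 28) (he : e2 G S = 138) (h5 : ∀ v ∈ S, 4 ≤ dd G S v ∧ dd G S v ≤ 4 + 2)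
    (n4 : (cls G S 4).card = 3) (n6 : (cls G S 6).card = 1)
    (h8 : ∀ x ∈ cls G S 6, dd G (cls G S 4) x = 3 ∧ dd G (cls G S 5) x = 3) : False := by
  obtain ⟨x, e6⟩ := Finset.card_eq_one.1 n6
  have hx6 : x ∈ cls G S 6 := by rw [e6]; simp
  obtain ⟨hx, hxd⟩ := mem_cls.1 hx6
  have mem6 : ∀ w ∈ S, dd G S w = 6 → w = x := by
    intro w hw h
    have : w ∈ cls G S 6 := mem_cls.2 ⟨hw, h⟩
    rw [e6] at this
    simpa using this
  obtain ⟨g4, g5⟩ := h8 x hx6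
  have adj4 : ∀ w ∈ S, dd G S w = 4 → G.Adj x w := by
    intro w hw h
    have : N G (cls G S 4) x = cls G S 4 := Finset.eq_of_subset_of_card_le N_sub (by rw [n4]; exact g4.ge)
    have h2 : w ∈ N G (cls G S 4) x := by rw [this]; exact mem_cls.2 ⟨hw, h⟩
    exact (mem_N.1 h2).2
  obtain ⟨y0, hy5, hxy⟩ := dd_ex (show 1 ≤ dd G (cls G S 5) x by omega)
  obtain ⟨hy, hyd⟩ := mem_cls.1 hy5
  obtain ⟨c1, c2, c3, c4⟩ := split3d 4 h5
  norm_num at c1 c2 c3 c4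
  have y4 : dd G (cls G S 4) y0 = 0 := dd_zero fun w hw h => hG.tri x y0 w hxy h (adj4 w (mem_cls.1 hw).1 (mem_cls.1 hw).2)
  have y6 : dd G (cls G S 6) y0 = 1 := by
    have : N G (cls G S 6) y0 = {x} := by
      ext w
      rw [mem_N, e6, Finset.mem_singleton]
      constructor
      · exact fun h => h.1
      · rintro rfl; exact ⟨rfl, hxy.symm⟩
    rw [dd, this, Finset.card_singleton]
  have b := ball hG hy
  have b1 := c3 y0
  have b2 := c4 y0
  have d5 : ∀ y ∈ N G S y0, y ≠ x → dd G S y = 5 := by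
    intro y hyn hne
    have h := h5 y (N_sub hyn)
    have h1 : dd G S y ≠ 4 := fun h => by
      have := dd_pos (mem_cls.2 ⟨N_sub hyn, h⟩) (mem_N.1 hyn).2
      omega
    have h2 : dd G S y ≠ 6 := fun h => hne (mem6 y (N_sub hyn) h)
    omega
  obtain ⟨z, hz⟩ := Finset.card_eq_one.1 (show (Zf G S y0).card = 1 by omega)
  have hzz : z ∈ Zf G S y0 := by rw [hz]; simp
  have hxN : x ∈ N G S y0 := mem_N.2 ⟨hx, hxy.symm⟩
  have zd : dd G S z = 5 := by
    rw [mem_Zf] at hzz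
    have h := h5 z hzz.1
    have h1 : dd G S z ≠ 4 := fun h => hzz.2.2.2 x hxN (adj4 z hzz.1 h)
    have h2 : dd G S z ≠ 6 := fun h => hzz.2.2.1 (by rw [mem6 z hzz.1 h]; exact hxy.symm)
    omega
  refine starL c5 hG hy hxN (fun w => dd G S w = 4) [z] (by simp) (by simp [hz]) 4 4 4 4 [(3, 3), (3, 3), (3, 3), (4, 4), (4, 4)] [(5, 5)] rfl hyd ?_ ?_ ?_ ?_ rfl rfl
  · intro y hyn hne
    refine ⟨d5 y hyn hne, fun w hw hwy => ?_⟩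
    have h := h5 w (N_sub hw)
    have h1 : dd G S w ≠ 4 := fun h => by
      rcases hG.c4 w x y0 y (adj4 w (N_sub hw) h).symm hxy (mem_N.1 hyn).2 (mem_N.1 hw).2 with e | e
      · exact hwy e
      · exact hne e.symm
    have h2 : dd G S w ≠ 6 := fun h => by
      have := mem6 w (N_sub hw) h
      subst this
      exact hG.tri w y0 y hxy (mem_N.1 hyn).2 (mem_N.1 hw).2.symm
    omega
  · refine grp_mix (fun w => dd G S w = 4) hy hxN (N G (cls G S 4) x) ?_ 3 2 3 3 4 4 g4 hxd ?_ ?_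
    · intro w
      rw [mem_N, mem_cls, mem_N]
      constructor
      · rintro ⟨⟨h1, h2⟩, h3⟩
        exact ⟨⟨⟨h1, h3⟩, by rintro rfl; omega⟩, h2⟩
      · rintro ⟨⟨⟨h1, h3⟩, -⟩, h2⟩
        exact ⟨⟨h1, h2⟩, h3⟩
    · intro w hw _ h
      omega
    · intro w hw _ h
      have h := h5 w (N_sub hw)
      have h2 : dd G S w ≠ 6 := fun h => by
        have := mem6 w (N_sub hw) h
        subst this
        exact nadj _ (mem_N.1 hw).2
      omega
  · exact List.Forall₂.cons (by simp [zd]) List.Forall₂.nil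
  · simp [s5]; omega

end
end Eng
end

section
open Finset
namespace Eng
noncomputable section
open Classical
variable {V : Type} {G : SimpleGraph V}

/-- standing facts for the (28,69) case -/
structure P28 (G : SimpleGraph V) (S : Finset V) : Prop where
  good : Good G
  card : S.card = 28
  e : e2 G S = 138
  h5 : ∀ v ∈ S, 4 ≤ dd G S v ∧ dd G S v ≤ 4 + 2
  h6 : ∀ v ∈ cls G S 4, ∀ w ∈ cls G S 4, ¬ G.Adj v w
  h8 : ∀ x ∈ cls G S 6, dd G (cls G S 4) x = 3 ∧ dd G (cls G S 5) x = 3 ∧ dd G (cls G S 6) x = 0 ∧ (Zf G S x).card = 0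

theorem P28.not6 {S : Finset V} (h : P28 G S) {x y : V} (hx : x ∈ cls G S 6) (hy : y ∈ cls G S 6) : ¬ G.Adj x y := by
  intro ha
  have := dd_pos hy ha
  have := (h.h8 x hx).2.2.1
  omega

theorem P28.common {S : Finset V} (h : P28 G S) {x v : V} (hx : x ∈ cls G S 6) (hv : v ∈ S) (hne : v ≠ x) (hna : ¬ G.Adj x v) :
    ∃ w ∈ S, G.Adj x w ∧ G.Adj w v := by
  have h1 : v ∉ Zf G S x := by rw [Finset.card_eq_zero.1 (h.h8 x hx).2.2.2]; simp
  rw [mem_Zf] at h1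
  push Not at h1
  obtain ⟨w, hw, hwv⟩ := h1 hv hne hna
  exact ⟨w, (mem_N.1 hw).1, (mem_N.1 hw).2, hwv⟩

theorem P28.key {S : Finset V} (h : P28 G S) {y : V} (hy : y ∈ cls G S 4) :
    (cls G S 6).card ≤ dd G (cls G S 6) y + ∑ w ∈ N G (cls G S 5) y, dd G (cls G S 6) w := by
  have e1 := dd_comm (G := G) (N G (cls G S 5) y) (cls G S 6)
  rw [e1, ← sum_ite_adj, ← Finset.sum_add_distrib]
  have := le_sum (A := cls G S 6) (f := fun x => (if G.Adj y x then 1 else 0) + dd G (N G (cls G S 5) y) x) (m := 1) (by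
    intro x hx
    by_cases ha : G.Adj y x
    · simp [ha]
    · obtain ⟨w, hw, h1, h2⟩ := h.common hx (mem_cls.1 hy).1 (by rintro rfl; have := (mem_cls.1 hx).2; have := (mem_cls.1 hy).2; omega) (fun h => ha h.symm)
      have h3 := h.h5 w hw
      have h4 : dd G S w ≠ 4 := fun h4 => h.h6 y hy w (mem_cls.2 ⟨hw, h4⟩) h2.symm
      have h6 : dd G S w ≠ 6 := fun h6 => h.not6 hx (mem_cls.2 ⟨hw, h6⟩) h1
      have := dd_pos (G := G) (v := x) (w := w) (A := N G (cls G S 5) y) (mem_N.2 ⟨mem_cls.2 ⟨hw, by omega⟩, h2.symm⟩) h1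
      omega)
  omega

theorem P28.counts {S : Finset V} (h : P28 G S) : (cls G S 4).card = (cls G S 6).card + 2 ∧ (cls G S 5).card + 2 * (cls G S 6).card = 26 ∧
    ∑ v ∈ cls G S 4, dd G (cls G S 6) v = (cls G S 6).card * 3 ∧ ∑ v ∈ cls G S 5, dd G (cls G S 6) v = (cls G S 6).card * 3 ∧
    ∑ v ∈ cls G S 4, dd G (cls G S 6) v * dd G (cls G S 6) v + ∑ v ∈ cls G S 5, dd G (cls G S 6) v * dd G (cls G S 6) v ≤ (cls G S 6).card * (cls G S 6).card + (cls G S 6).card * 5 := by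
  obtain ⟨c1, c2, c3, c4⟩ := split3d 4 h.h5
  norm_num at c1 c2 c3 c4
  have := h.card
  have := h.e
  have e1 := dd_comm (G := G) (cls G S 4) (cls G S 6)
  have e2' := dd_comm (G := G) (cls G S 5) (cls G S 6)
  rw [sum_eq (A := cls G S 6) fun x hx => (h.h8 x hx).1] at e1
  rw [sum_eq (A := cls G S 6) fun x hx => (h.h8 x hx).2.1] at e2'
  have p := pairs h.good (cls_sub (G := G) (S := S) (k := 6))
  rw [split3 4 h.h5 (fun v => dd G (cls G S 6) v * _), split3 4 h.h5] at p
  norm_num at p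
  rw [e1, e2', sum_eq (A := cls G S 6) fun x hx => (h.h8 x hx).2.2.1, sum_eq (A := cls G S 6) (m := 0) (fun x hx => by rw [(h.h8 x hx).2.2.1])] at p
  refine ⟨by omega, by omega, e1, e2', by omega⟩

theorem P28.nbr4 {S : Finset V} (h : P28 G S) {y : V} (hy : y ∈ cls G S 4) : dd G (cls G S 5) y + dd G (cls G S 6) y = 4 := by
  obtain ⟨c1, c2, c3, c4⟩ := split3d 4 h.h5
  norm_num at c1 c2 c3 c4
  have := c3 y
  rw [dd_zero (h.h6 y hy), (mem_cls.1 hy).2] at this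
  omega

theorem P28.a5 {S : Finset V} (h : P28 G S) (n6 : (cls G S 6).card = 5) : False := by
  obtain ⟨k1, k2, k3, k4, k5⟩ := h.counts
  let H := (cls G S 5).filter fun w => 2 ≤ dd G (cls G S 6) w
  have hH : H.card ≤ 1 := by
    have q1 := conv (cls G S 4) (dd G (cls G S 6)) 2
    have q2 : ∑ v ∈ cls G S 5, dd G (cls G S 6) v + H.card * 2 ≤ ∑ v ∈ cls G S 5, dd G (cls G S 6) v * dd G (cls G S 6) v := by
      have : H.card * 2 = ∑ v ∈ cls G S 5, if 2 ≤ dd G (cls G S 6) v then 2 else 0 := by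
        rw [← Finset.sum_filter, sum_eq (m := 2) fun _ _ => rfl]
      rw [this, ← Finset.sum_add_distrib]
      apply Finset.sum_le_sum
      intro v _
      split_ifs with hv
      · nlinarith
      · have : dd G (cls G S 6) v = 0 ∨ dd G (cls G S 6) v = 1 := by omega
        rcases this with e | e <;> rw [e] <;> omega
    rw [n6] at k1 k2 k3 k4 k5
    rw [k1] at q1
    omega
  have h1 : (cls G S 4).card * 1 ≤ ∑ y ∈ cls G S 4, dd G H y := le_sum fun y hy => by
    by_contra hcon
    have a1 := h.key hy
    have a2 := h.nbr4 hy
    have a3 := sum_le (A := N G (cls G S 5) y) (f := dd G (cls G S 6)) (m := 1) (by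
      intro w hw
      by_contra h2
      have : w ∈ H := Finset.mem_filter.2 ⟨(mem_N.1 hw).1, by omega⟩
      have := dd_pos this (mem_N.1 hw).2
      omega)
    change _ ≤ dd G (cls G S 5) y * 1 at a3
    omega
  rw [dd_comm] at h1
  have h2 := sum_le (A := H) (f := dd G (cls G S 4)) (m := 5) (by
    intro w hw
    have h3 := (mem_cls.1 (Finset.mem_filter.1 hw).1).2
    have h4 := dd_split (G := G) (cls_sub (G := G) (S := S) (k := 4)) w
    omega)
  omega

theorem P28.a4 {S : Finset V} (h : P28 G S) (n6 : (cls G S 6).card = 4) : False := by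
  have hG := h.good
  obtain ⟨k1, k2, k3, k4, k5⟩ := h.counts
  have q1 := conv (cls G S 4) (dd G (cls G S 6)) 2
  have q2 := conv (cls G S 5) (dd G (cls G S 6)) 0
  rw [n6] at k1 k2 k3 k4 k5
  have cc : ∀ y ∈ cls G S 4, dd G (cls G S 6) y = 2 := by
    have s0 : ∑ y ∈ cls G S 4, (dd G (cls G S 6) y * dd G (cls G S 6) y + 4) ≤ ∑ y ∈ cls G S 4, 4 * dd G (cls G S 6) y := by
      rw [Finset.sum_add_distrib, sum_eq (m := 4) (fun _ _ => rfl), ← Finset.mul_sum]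
      omega
    have s1 : ∀ y ∈ cls G S 4, 4 * dd G (cls G S 6) y ≤ dd G (cls G S 6) y * dd G (cls G S 6) y + 4 := by
      intro y _
      have : (4 * dd G (cls G S 6) y : ℤ) ≤ dd G (cls G S 6) y * dd G (cls G S 6) y + 4 := by nlinarith [sq_nonneg ((dd G (cls G S 6) y : ℤ) - 2)]
      exact_mod_cast this
    have s2 := (Finset.sum_eq_sum_iff_of_le s1).1 (le_antisymm (Finset.sum_le_sum s1) s0)
    intro y hy
    have s3 := s2 y hy
    have : ((dd G (cls G S 6) y : ℤ) - 2) ^ 2 = 0 := by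
      have : (4 * dd G (cls G S 6) y : ℤ) = dd G (cls G S 6) y * dd G (cls G S 6) y + 4 := by exact_mod_cast s3
      linarith
    have := pow_eq_zero_iff (two_ne_zero) |>.1 this
    omega
  have pp : ∀ w ∈ cls G S 5, dd G (cls G S 6) w ≤ 1 := by
    have s1 : ∀ w ∈ cls G S 5, dd G (cls G S 6) w ≤ dd G (cls G S 6) w * dd G (cls G S 6) w := fun w _ => Nat.le_mul_self _
    have s0 : ∑ w ∈ cls G S 5, dd G (cls G S 6) w * dd G (cls G S 6) w ≤ ∑ w ∈ cls G S 5, dd G (cls G S 6) w := by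
      rw [k1] at q1
      omega
    have s2 := (Finset.sum_eq_sum_iff_of_le s1).1 (le_antisymm (Finset.sum_le_sum s1) s0)
    intro w hw
    have := s2 w hw
    by_contra hc
    nlinarith
  have c5 : ∀ y ∈ cls G S 4, dd G (cls G S 5) y = 2 := fun y hy => by
    have := h.nbr4 hy
    have := cc y hy
    omega
  have p1 : ∀ y ∈ cls G S 4, ∀ w ∈ cls G S 5, G.Adj y w → dd G (cls G S 6) w = 1 := by
    intro y hy w hw ha
    by_contra hne
    have a1 := h.key hy
    have a2 := cc y hy
    have hwN : w ∈ N G (cls G S 5) y := mem_N.2 ⟨hw, ha⟩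
    have a3 := Finset.add_sum_erase _ (dd G (cls G S 6)) hwN
    have a4 := sum_le (A := (N G (cls G S 5) y).erase w) (f := dd G (cls G S 6)) (m := 1) (fun v hv => pp v (mem_N.1 (Finset.mem_of_mem_erase hv)).1)
    rw [Finset.card_erase_of_mem hwN] at a4
    change _ ≤ (dd G (cls G S 5) y - 1) * 1 at a4
    have a5 := c5 y hy
    have a6 := pp w hw
    omega
  have dne : ∀ {a b : V} {i j : ℕ}, a ∈ cls G S i → b ∈ cls G S j → i ≠ j → a ≠ b := by
    rintro a b i j ha hb hij rfl
    exact hij ((mem_cls.1 ha).2.symm.trans (mem_cls.1 hb).2)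
  have f1 : ∀ w ∈ cls G S 5, dd G (cls G S 4) w ≤ dd G (cls G S 6) w := by
    intro w hw
    by_contra hcon
    obtain ⟨f, hf⟩ := dd_ex (show 1 ≤ dd G (cls G S 4) w by omega)
    have b1 := p1 f hf.1 w hw hf.2.symm
    obtain ⟨x, hx, hwx⟩ := dd_ex (show 1 ≤ dd G (cls G S 6) w by omega)
    obtain ⟨f, hf, g, hg, hfg⟩ := two_of (show 2 ≤ (N G (cls G S 4) w).card by change 2 ≤ dd _ _ _; omega)
    rw [mem_N] at hf hg
    have hs : ∀ f ∈ cls G S 4, G.Adj w f → N G (cls G S 6) f ⊆ (cls G S 6).erase x := by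
      intro f hf ha v hv
      rw [Finset.mem_erase]
      refine ⟨?_, (mem_N.1 hv).1⟩
      rintro rfl
      exact hG.tri w f v ha (mem_N.1 hv).2 hwx
    have b2 := cc f hf.1
    have b3 := cc g hg.1
    have b4 := Finset.card_le_card (Finset.union_subset (hs f hf.1 hf.2) (hs g hg.1 hg.2))
    rw [Finset.card_erase_of_mem hx, n6] at b4
    have b5 := Finset.card_union_add_card_inter (N G (cls G S 6) f) (N G (cls G S 6) g)
    change _ = dd G (cls G S 6) f + dd G (cls G S 6) g at b5
    obtain ⟨v, hv⟩ := Finset.card_pos.1 (show 0 < (N G (cls G S 6) f ∩ N G (cls G S 6) g).card by omega)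
    rw [Finset.mem_inter, mem_N, mem_N] at hv
    rcases hG.c4 w f v g hf.2 hv.1.2 hv.2.2.symm hg.2.symm with e | e
    · exact dne hw hv.1.1 (by omega) e
    · exact hfg e
  have f2 : ∀ w ∈ cls G S 5, dd G (cls G S 4) w = dd G (cls G S 6) w := by
    apply (Finset.sum_eq_sum_iff_of_le f1).1
    rw [dd_comm, k4, sum_eq c5, k1]
  obtain ⟨y, hy⟩ := Finset.card_pos.1 (show 0 < (cls G S 4).card by omega)
  obtain ⟨u, v, huv, hN6⟩ := Finset.card_eq_two.1 (cc y hy)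
  obtain ⟨w1, w2, hw12, hN5⟩ := Finset.card_eq_two.1 (c5 y hy)
  have hu := mem_N.1 (show u ∈ N G (cls G S 6) y by rw [hN6]; simp)
  have hv := mem_N.1 (show v ∈ N G (cls G S 6) y by rw [hN6]; simp)
  have hw1 := mem_N.1 (show w1 ∈ N G (cls G S 5) y by rw [hN5]; simp)
  have hw2 := mem_N.1 (show w2 ∈ N G (cls G S 5) y by rw [hN5]; simp)
  have pw1 := p1 y hy w1 hw1.1 hw1.2
  have pw2 := p1 y hy w2 hw2.1 hw2.2
  obtain ⟨x1, hx1, hwx1⟩ := dd_ex (show 1 ≤ dd G (cls G S 6) w1 by omega)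
  obtain ⟨x2, hx2, hwx2⟩ := dd_ex (show 1 ≤ dd G (cls G S 6) w2 by omega)
  have x12 : x1 ≠ x2 := by
    rintro rfl
    rcases hG.c4 y w1 x1 w2 hw1.2 hwx1 hwx2.symm hw2.2.symm with e | e
    · exact dne hy hx1 (by omega) e
    · exact hw12 e
  have ny1 : ¬ G.Adj y x1 := fun ha => hG.tri y w1 x1 hw1.2 hwx1 ha
  have ny2 : ¬ G.Adj y x2 := fun ha => hG.tri y w2 x2 hw2.2 hwx2 ha
  have x1u : x1 ≠ u := by rintro rfl; exact ny1 hu.2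
  have x1v : x1 ≠ v := by rintro rfl; exact ny1 hv.2
  have x2u : x2 ≠ u := by rintro rfl; exact ny2 hu.2
  have x2v : x2 ≠ v := by rintro rfl; exact ny2 hv.2
  have hA : cls G S 6 = {u, v, x1, x2} := by
    symm
    apply Finset.eq_of_subset_of_card_le
    · intro t ht
      simp only [Finset.mem_insert, Finset.mem_singleton] at ht
      rcases ht with rfl | rfl | rfl | rfl
      exacts [hu.1, hv.1, hx1, hx2]
    · rw [n6]
      rw [Finset.card_insert_of_notMem, Finset.card_insert_of_notMem, Finset.card_pair x12]
      · simp [x1v.symm, x2v.symm]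
      · simp [huv, x1u.symm, x2u.symm]
  have w1x2 : ¬ G.Adj x2 w1 := by
    intro ha
    have := Finset.card_le_one.1 (le_of_eq pw1) x1 (mem_N.2 ⟨hx1, hwx1⟩) x2 (mem_N.2 ⟨hx2, ha.symm⟩)
    exact x12 this
  obtain ⟨t, htS, hxt, htw⟩ := h.common hx2 (mem_cls.1 hw1.1).1 (dne hw1.1 hx2 (by omega)) w1x2
  have ht6 : dd G S t ≠ 6 := fun h6 => h.not6 hx2 (mem_cls.2 ⟨htS, h6⟩) hxt
  have four : ∀ f ∈ cls G S 4, ¬ G.Adj f x1 → (G.Adj f u ∨ G.Adj f v) ∧ (¬ G.Adj f x2 → G.Adj f u ∧ G.Adj f v) := by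
    intro f hf h1
    obtain ⟨a, b, hab, hN⟩ := Finset.card_eq_two.1 (cc f hf)
    have ha := mem_N.1 (show a ∈ N G (cls G S 6) f by rw [hN]; simp)
    have hb := mem_N.1 (show b ∈ N G (cls G S 6) f by rw [hN]; simp)
    rw [hA] at ha hb
    simp only [Finset.mem_insert, Finset.mem_singleton] at ha hb
    obtain ⟨ha1, ha2⟩ := ha
    obtain ⟨hb1, hb2⟩ := hb
    rcases ha1 with rfl | rfl | rfl | rfl <;> rcases hb1 with rfl | rfl | rfl | rfl <;> tauto
  by_cases ht4 : dd G S t = 4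
  · have ht : t ∈ cls G S 4 := mem_cls.2 ⟨htS, ht4⟩
    have hne : t ≠ y := by rintro rfl; exact ny2 hxt.symm
    rcases (four t ht fun ha => hG.tri t w1 x1 htw hwx1 ha).1 with ha | ha
    · rcases hG.c4 t u y w1 ha hu.2.symm hw1.2 htw.symm with e | e
      · exact hne e
      · exact dne hu.1 hw1.1 (by omega) e
    · rcases hG.c4 t v y w1 ha hv.2.symm hw1.2 htw.symm with e | e
      · exact hne e
      · exact dne hv.1 hw1.1 (by omega) e
  · have := h.h5 t htS
    have ht : t ∈ cls G S 5 := mem_cls.2 ⟨htS, by omega⟩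
    have g1 := dd_pos hx2 hxt.symm
    obtain ⟨f, hf, htf⟩ := dd_ex (show 1 ≤ dd G (cls G S 4) t by rw [f2 t ht]; exact g1)
    have hfx1 : ¬ G.Adj f x1 := by
      intro ha
      rcases hG.c4 x1 f t w1 ha.symm htf.symm htw hwx1 with e | e
      · exact dne hx1 ht (by omega) e
      · exact dne hf hw1.1 (by omega) e
    obtain ⟨m1, m2⟩ := (four f hf hfx1).2 fun ha => hG.tri t f x2 htf ha hxt.symm
    have : f = y := by
      rcases hG.c4 f u y v m1 hu.2.symm hv.2 m2.symm with e | e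
      · exact e
      · exact absurd e huv
    subst this
    exact hG.tri t f w1 htf hw1.2 htw

theorem P28.false {S : Finset V} (h : P28 G S) : False := by
  obtain ⟨k1, k2, k3, k4, k5⟩ := h.counts
  have q0 := conv (cls G S 4) (dd G (cls G S 6)) 1
  have q1 := conv (cls G S 4) (dd G (cls G S 6)) 2
  have q2 := conv (cls G S 5) (dd G (cls G S 6)) 0
  have q3 := conv (cls G S 5) (dd G (cls G S 6)) 1
  have q4 := conv (cls G S 5) (dd G (cls G S 6)) 2
  have a5 : (cls G S 6).card ≠ 5 := h.a5
  have a4 : (cls G S 6).card ≠ 4 := h.a4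
  have a1 : (cls G S 6).card ≠ 1 := fun n6 => P28a1 h.good h.card h.e h.h5 (by omega) n6 fun x hx => ⟨(h.h8 x hx).1, (h.h8 x hx).2.1⟩
  have a0 : (cls G S 6).card ≠ 0 := fun n6 => P28a0 h.good h.card h.e (fun v hv => by
    have := h.h5 v hv
    have : dd G S v ≠ 6 := fun h6 => by
      have := Finset.card_pos.2 ⟨v, (mem_cls.2 ⟨hv, h6⟩ : v ∈ cls G S 6)⟩
      omega
    omega) h.h6 (by omega)
  generalize (cls G S 6).card = a at *
  have hn5 : (cls G S 5).card = 26 - 2 * a := by omega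
  rw [hn5] at q2 q3 q4
  rw [k1] at q0 q1
  have : a ≤ 13 := by omega
  interval_cases a <;> omega

theorem F28' (hG : Good G) {S : Finset V} (hS : S.card = 28) (he : e2 G S = 138) : False := by
  have h3 : ∀ v ∈ S, 4 ≤ dd G S v := fun v hv => by have := (F27 hG).erase hS hv; omega
  have h4 : ∀ v ∈ S, dd G S v ≤ 6 := fun v hv => by
    have := deg_mul hG (m := 4) h3 hv
    omega
  have h5 : ∀ v ∈ S, 4 ≤ dd G S v ∧ dd G S v ≤ 4 + 2 := fun v hv => ⟨h3 v hv, h4 v hv⟩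
  obtain ⟨c1, c2, c3, c4⟩ := split3d 4 h5
  norm_num at c1 c2 c3 c4
  refine P28.false (G := G) (S := S) ⟨hG, hS, he, h5, ?_, ?_⟩
  · intro v hv w hw ha
    have := (F26 hG).pair hS (mem_cls.1 hv).1 (mem_cls.1 hw).1 ha
    rw [(mem_cls.1 hv).2, (mem_cls.1 hw).2] at this
    omega
  · intro x hx
    obtain ⟨hxS, hxd⟩ := mem_cls.1 hx
    have b := ball hG hxS
    have b1 := c3 x
    have b2 := c4 x
    have : dd G (cls G S 4) x ≤ 3 := by
      by_contra hcon
      obtain ⟨T, hT, hTc⟩ := Finset.exists_subset_card_eq (show 4 ≤ (N G (cls G S 4) x).card by change 4 ≤ dd _ _ _; omega)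
      have d := del_star hxS (T := T) (fun v hv => mem_N.2 ⟨(mem_cls.1 (mem_N.1 (hT hv)).1).1, (mem_N.1 (hT hv)).2⟩)
      rw [sum_eq (A := T) (m := 4) fun v hv => (mem_cls.1 (mem_N.1 (hT hv)).1).2] at d
      have := F23 hG _ (show (S \ insert x T).card = 23 by omega)
      omega
    omega

theorem del_edge (hG : Good G) {S : Finset V} {u v : V} (hu : u ∈ S) (hv : v ∈ S) (ha : G.Adj u v) : ∃ G' : SimpleGraph V, Good G' ∧ e2 G' S + 2 = e2 G S := by
  refine ⟨G.deleteEdges {s(u, v)}, ?_, ?_⟩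
  · have hle : ∀ a b, (G.deleteEdges {s(u, v)}).Adj a b → G.Adj a b := fun a b h => (SimpleGraph.deleteEdges_le _) h
    exact ⟨fun a b c h1 h2 h3 => hG.tri a b c (hle _ _ h1) (hle _ _ h2) (hle _ _ h3), fun a b c d h1 h2 h3 h4 => hG.c4 a b c d (hle _ _ h1) (hle _ _ h2) (hle _ _ h3) (hle _ _ h4)⟩
  · have e1 : e2 (G.deleteEdges {s(u, v)}) (S.erase u) = e2 G (S.erase u) := by
      apply Finset.sum_congr rfl
      intro a haS
      rw [dd, dd]
      congr 1
      ext b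
      rw [mem_N, mem_N, SimpleGraph.deleteEdges_adj]
      rw [Finset.mem_erase] at haS
      constructor
      · rintro ⟨h1, h2, -⟩; exact ⟨h1, h2⟩
      · rintro ⟨h1, h2⟩
        refine ⟨h1, h2, ?_⟩
        rw [Set.mem_singleton_iff, Sym2.eq_iff]
        rintro (h | h)
        · exact haS.1 h.1
        · exact (Finset.mem_erase.1 h1).1 h.2
    have e3 : dd (G.deleteEdges {s(u, v)}) S u + 1 = dd G S u := by
      have hvN : v ∈ N G S u := mem_N.2 ⟨hv, ha⟩
      rw [dd, dd, ← Finset.card_erase_add_one hvN]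
      congr 2
      ext b
      rw [mem_N, Finset.mem_erase, mem_N, SimpleGraph.deleteEdges_adj, Set.mem_singleton_iff, Sym2.eq_iff]
      constructor
      · rintro ⟨h1, h2, h3⟩
        exact ⟨fun h => h3 (Or.inl ⟨rfl, h⟩), h1, h2⟩
      · rintro ⟨h1, h2, h3⟩
        refine ⟨h2, h3, ?_⟩
        rintro (h | h)
        · exact h1 h.2
        · exact ha.ne h.1
    rw [e2_erase hu, e1, e2_erase (G := G) hu]
    omega

theorem F28 (hG : Good G) : Bd G 28 136 := by
  intro S hS
  by_contra hc
  have h1 := (F27 hG).avg hS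
  have h2 := e2_even (G := G) S
  by_cases h : e2 G S = 138
  · exact F28' hG hS h
  · have : ∃ u ∈ S, 1 ≤ dd G S u := by
      by_contra hcon
      push Not at hcon
      have : ∑ v ∈ S, dd G S v ≤ S.card * 0 := sum_le fun v hv => by have := hcon v hv; omega
      change e2 G S ≤ _ at this
      omega
    obtain ⟨u, hu, hd⟩ := this
    obtain ⟨v, hv, ha⟩ := dd_ex hd
    obtain ⟨G', hG', he⟩ := del_edge hG hu hv ha
    exact F28' hG' hS (by omega)

end
end Eng
end

section
open Finset
namespace Eng
noncomputable section
open Classical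
variable {V : Type} {G : SimpleGraph V}

theorem zf_of (hG : Good G) {R : Finset V} {a b z : V} (hb : b ∈ R) (hab : a ≠ b) (hz : z ∉ R) (h1 : G.Adj z a) (h2 : G.Adj z b) : b ∈ Zf G R a := by
  rw [mem_Zf]
  refine ⟨hb, hab.symm, fun h => hG.tri z a b h1 h h2, ?_⟩
  intro y hy hyb
  rw [mem_N] at hy
  rcases hG.c4 a z b y h1.symm h2 hyb.symm hy.2.symm with e | e
  · exact hab e
  · exact hz (e ▸ hy.1)

theorem D7star (hG : Good G) {S : Finset V} (hS : S.card = 29) (h4 : ∀ v ∈ S, 4 ≤ dd G S v) {x : V} (hx : x ∈ S) (hd : dd G S x = 7) :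
    Zf G S x = ∅ ∧ ∀ y ∈ N G S x, dd G S y = 4 := by
  have h1 := ball hG hx
  have h2 := le_sum (A := N G S x) (f := dd G S) (m := 4) fun v hv => h4 v (mem_N.1 hv).1
  change dd G S x * 4 ≤ _ at h2
  refine ⟨Finset.card_eq_zero.1 (by omega), ?_⟩
  intro y hy
  have h3 := Finset.sum_erase_add (N G S x) (dd G S) hy
  have h5 := le_sum (A := (N G S x).erase y) (f := dd G S) (m := 4) fun v hv => h4 v (mem_N.1 (Finset.mem_of_mem_erase hv)).1
  rw [Finset.card_erase_of_mem hy] at h5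
  change (dd G S x - 1) * 4 ≤ _ at h5
  have := h4 y (mem_N.1 hy).1
  rw [hd] at h5
  omega

theorem D7 (hG : Good G) {S : Finset V} (hS : S.card = 29) (he : e2 G S = 144) (h4 : ∀ v ∈ S, 4 ≤ dd G S v) {x : V} (hx : x ∈ S) : dd G S x ≠ 7 := by
  intro hd
  obtain ⟨hZ, hA⟩ := D7star hG hS h4 hx hd
  obtain ⟨A, hAe⟩ : ∃ A, A = N G S x := ⟨_, rfl⟩
  have mA : ∀ v, v ∈ A ↔ v ∈ S ∧ G.Adj x v := fun v => by rw [hAe, mem_N]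
  have cA : A.card = 7 := by rw [hAe]; exact hd
  obtain ⟨L, hLe⟩ : ∃ L, L = S \ insert x A := ⟨_, rfl⟩
  have mL : ∀ v, v ∈ L ↔ v ∈ S ∧ v ≠ x ∧ ¬ G.Adj x v := fun v => by
    rw [hLe, Finset.mem_sdiff, Finset.mem_insert, mA]; tauto
  have d := del_star hx (show A ⊆ N G S x by rw [hAe])
  rw [← hLe, cA, hd, hS, he] at d
  rw [← hAe] at hA
  rw [sum_eq hA, cA] at d
  have cL : L.card = 21 := by omega
  have eL : e2 G L = 88 := by have := F21 hG L cL; omega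
  have hsub : insert x A ⊆ S := Finset.insert_subset hx fun v hv => ((mA v).1 hv).1
  have par : ∀ v ∈ L, ∃ y ∈ A, G.Adj y v ∧ ∀ u ∈ A, G.Adj u v → u = y := by
    intro v hv
    have hv' := (mL v).1 hv
    have h1 : v ∉ Zf G S x := by rw [hZ]; simp
    rw [mem_Zf] at h1
    push Not at h1
    obtain ⟨y, hy, hyv⟩ := h1 hv'.1 hv'.2.1 hv'.2.2
    refine ⟨y, by rw [hAe]; exact hy, hyv, ?_⟩
    intro u hu huv
    rcases hG.c4 x y v u (mem_N.1 hy).2 hyv huv.symm ((mA u).1 hu).2.symm with e | e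
    · exact absurd e.symm hv'.2.1
    · exact e.symm
  have dA : ∀ v ∈ L, dd G A v = 1 := by
    intro v hv
    obtain ⟨y, hy, hyv, hu⟩ := par v hv
    rw [dd, Finset.card_eq_one]
    refine ⟨y, ?_⟩
    ext u
    rw [mem_N, Finset.mem_singleton]
    exact ⟨fun h => hu u h.1 h.2.symm, fun h => h ▸ ⟨hy, hyv.symm⟩⟩
  have dL : ∀ v ∈ L, dd G S v = dd G L v + 1 := by
    intro v hv
    have h1 := dd_split (G := G) hsub v
    rw [← hLe] at h1
    have h2 : dd G (insert x A) v = dd G A v := by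
      rw [dd, dd]; congr 1; ext u
      rw [mem_N, mem_N, Finset.mem_insert]
      constructor
      · rintro ⟨rfl | h, h'⟩
        · exact absurd h'.symm ((mL v).1 hv).2.2
        · exact ⟨h, h'⟩
      · exact fun h => ⟨Or.inr h.1, h.2⟩
    rw [h1, h2, dA v hv]
  have hLS : ∀ v ∈ L, v ∈ S := fun v hv => ((mL v).1 hv).1
  obtain ⟨C, hCe⟩ : ∃ C, C = L.filter fun v => dd G L v = 3 := ⟨_, rfl⟩
  have mC : ∀ v, v ∈ C ↔ v ∈ L ∧ dd G L v = 3 := fun v => by rw [hCe, Finset.mem_filter]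
  have hCL : C ⊆ L := fun v hv => ((mC v).1 hv).1
  have cC : C.card ≤ 2 := by
    by_contra hcon
    obtain ⟨T, hT, cT⟩ := Finset.exists_subset_card_eq (show 3 ≤ C.card by omega)
    have h1 := e2_sdiff (G := G) (hT.trans hCL)
    rw [sum_eq fun v hv => ((mC v).1 (hT hv)).2, cT, eL] at h1
    have h2 := F18 hG (L \ T) (by rw [Finset.card_sdiff_of_subset (hT.trans hCL), cL, cT])
    omega
  have up : ∀ v ∈ L, dd G L v ≤ 5 := by
    intro v hv
    by_contra hcon
    have h1 := deg_mul hG h4 (hLS v hv)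
    have h2 := dL v hv
    obtain ⟨-, h3⟩ := D7star hG hS h4 (hLS v hv) (by omega)
    have h5 : N G L v ⊆ C := by
      intro u hu
      rw [mem_N] at hu
      have := h3 u (mem_N.2 ⟨hLS u hu.1, hu.2⟩)
      have := dL u hu.1
      exact (mC u).2 ⟨hu.1, by omega⟩
    have := Finset.card_le_card h5
    change dd G L v ≤ _ at this
    omega
  have six : ∀ v ∈ L, dd G L v = 5 → 1 ≤ dd G C v := by
    intro v hv h5
    by_contra hcon
    obtain ⟨y, hy, hyv, hu⟩ := par v hv
    have hyN : y ∈ N G S v := mem_N.2 ⟨((mA y).1 hy).1, hyv.symm⟩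
    have h1 := ball hG (hLS v hv)
    have h2 := Finset.sum_erase_add (N G S v) (dd G S) hyN
    have h3 := le_sum (A := (N G S v).erase y) (f := dd G S) (m := 5) (by
      intro u huu
      rw [Finset.mem_erase, mem_N] at huu
      have huL : u ∈ L := (mL u).2 ⟨huu.2.1, by
        rintro rfl
        exact ((mL v).1 hv).2.2 huu.2.2.symm, fun h => huu.1 (hu u ((mA u).2 ⟨huu.2.1, h⟩) huu.2.2.symm)⟩
      have h6 := dL u huL
      have h7 := h4 u huu.2.1
      have h8 : dd G L u ≠ 3 := fun h => by
        have := dd_pos ((mC u).2 ⟨huL, h⟩) huu.2.2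
        omega
      omega)
    rw [Finset.card_erase_of_mem hyN] at h3
    change (dd G S v - 1) * 5 ≤ _ at h3
    have := hA y hy
    have := dL v hv
    rw [this, h5] at h3
    omega
  have pw : ∀ v ∈ L, dd G L v + (if v ∈ C then 1 else 0) ≤ 4 + dd G C v := by
    intro v hv
    have h1 := up v hv
    have h2 := six v hv
    have h3 := mC v
    split_ifs with h
    · have := (h3.1 h).2; omega
    · by_cases h5 : dd G L v = 5
      · have := h2 h5; omega
      · omega
  have sC : ∑ v ∈ L, (if v ∈ C then 1 else 0) = C.card := by
    rw [← Finset.sum_filter, Finset.sum_const, smul_eq_mul, mul_one]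
    congr 1; ext v; rw [Finset.mem_filter]; exact ⟨fun h => h.2, fun h => ⟨hCL h, h⟩⟩
  have s1 : ∑ v ∈ L, (dd G L v + (if v ∈ C then 1 else 0)) = 88 + C.card := by
    rw [Finset.sum_add_distrib, sC]; change e2 G L + _ = _; rw [eL]
  have s2 : ∑ v ∈ L, (4 + dd G C v) = 84 + C.card * 3 := by
    rw [Finset.sum_add_distrib, sum_eq (m := 4) (fun _ _ => rfl), cL, dd_comm, sum_eq fun v hv => ((mC v).1 hv).2]
  have s3 := Finset.sum_le_sum pw
  rw [s1, s2] at s3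
  have C2 : C.card = 2 := by omega
  have eq := (Finset.sum_eq_sum_iff_of_le pw).1 (by rw [s1, s2, C2])
  obtain ⟨R, hRe⟩ : ∃ R, R = L \ C := ⟨_, rfl⟩
  have cR : R.card = 19 := by rw [hRe, Finset.card_sdiff_of_subset hCL, cL, C2]
  have mR : ∀ v, v ∈ R ↔ v ∈ L ∧ v ∉ C := fun v => by rw [hRe, Finset.mem_sdiff]
  have dR : ∀ v ∈ R, dd G R v = 4 := by
    intro v hv
    have h1 := dd_split (G := G) hCL v
    rw [← hRe] at h1
    have h2 := eq v ((mR v).1 hv).1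
    rw [if_neg ((mR v).1 hv).2] at h2
    omega
  have zR : ∀ v ∈ R, (Zf G R v).card = 2 := by
    intro v hv
    have h1 := ball hG hv
    rw [sum_eq fun u hu => dR u (mem_N.1 hu).1] at h1
    change dd G R v * 4 + 1 + _ = _ at h1
    rw [dR v hv, cR] at h1
    omega
  obtain ⟨c, hc⟩ := Finset.card_pos.1 (show 0 < C.card by omega)
  have hcL := hCL hc
  have dcC : dd G C c = 0 := by
    have h1 := eq c hcL
    rw [if_pos hc, ((mC c).1 hc).2] at h1
    omega
  have NcR : ∀ u ∈ N G L c, u ∈ R := by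
    intro u hu
    rw [mem_N] at hu
    refine (mR u).2 ⟨hu.1, fun h => ?_⟩
    have := dd_pos h hu.2
    omega
  have cA' : c ∉ A := fun h => ((mL c).1 hcL).2.2 ((mA c).1 h).2
  have ex : ∃ r ∈ N G L c, ∃ y ∈ A, G.Adj y r ∧ dd G C y = 0 := by
    by_contra hcon
    push Not at hcon
    obtain ⟨B, hB⟩ : ∃ B, B = A.filter fun y => 1 ≤ dd G C y := ⟨_, rfl⟩
    have h1 : B.card * 1 ≤ ∑ y ∈ B, dd G C y := le_sum fun y hy => by rw [hB] at hy; exact (Finset.mem_filter.1 hy).2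
    have h2 : ∑ y ∈ B, dd G C y ≤ ∑ y ∈ A, dd G C y := Finset.sum_le_sum_of_subset (by rw [hB]; exact Finset.filter_subset _ _)
    rw [dd_comm A, sum_eq fun v hv => dA v (hCL hv), C2] at h2
    have h3 := le_sum (A := N G L c) (f := dd G B) (m := 1) (by
      intro r hr
      obtain ⟨y, hy, hyr, -⟩ := par r (mem_N.1 hr).1
      refine dd_pos (w := y) ?_ hyr.symm
      rw [hB, Finset.mem_filter]
      have := hcon r hr y hy hyr
      exact ⟨hy, by omega⟩)
    rw [dd_comm] at h3
    have h5 := sum_le (A := B) (f := dd G (N G L c)) (m := 1) (by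
      intro y hy
      by_contra h6
      obtain ⟨a, ha, b, hb, hab⟩ := two_of (show 2 ≤ (N G (N G L c) y).card by change 2 ≤ dd G (N G L c) y; omega)
      rw [mem_N, mem_N] at ha hb
      rcases hG.c4 y a c b ha.2 ha.1.2.symm hb.1.2 hb.2.symm with e | e
      · rw [hB] at hy
        exact cA' (e ▸ (Finset.mem_filter.1 hy).1)
      · exact hab e)
    change dd G L c * 1 ≤ _ at h3
    rw [((mC c).1 hc).2] at h3
    omega
  obtain ⟨r, hr, y, hy, hyr, hy0⟩ := ex
  have hrR := NcR r hr
  have hrL := ((mR r).1 hrR).1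
  have hyN : x ∈ N G S y := mem_N.2 ⟨hx, ((mA y).1 hy).2.symm⟩
  have hrN : r ∈ (N G S y).erase x := Finset.mem_erase.2 ⟨((mL r).1 hrL).2.1, mem_N.2 ⟨hLS r hrL, hyr⟩⟩
  have ct : 0 < (((N G S y).erase x).erase r).card := by
    rw [Finset.card_erase_of_mem hrN, Finset.card_erase_of_mem hyN]
    have : (N G S y).card = 4 := hA y hy
    omega
  obtain ⟨t, ht⟩ := Finset.card_pos.1 ct
  rw [Finset.mem_erase, Finset.mem_erase, mem_N] at ht
  obtain ⟨ht1, ht2, ht3, ht4⟩ := ht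
  have htL : t ∈ L := (mL t).2 ⟨ht3, ht2, fun h => hG.tri x y t ((mA y).1 hy).2 ht4 h⟩
  have htR : t ∈ R := (mR t).2 ⟨htL, fun h => by have := dd_pos h ht4; omega⟩
  have hyR : y ∉ R := fun h => ((mL y).1 ((mR y).1 h).1).2.2 ((mA y).1 hy).2
  have hcR : c ∉ R := fun h => ((mR c).1 h).2 hc
  have sub : (N G L c).erase r ⊆ Zf G R r := by
    intro u hu
    rw [Finset.mem_erase] at hu
    exact zf_of hG (NcR u hu.2) hu.1.symm hcR (mem_N.1 hr).2 (mem_N.1 hu.2).2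
  have eqq := Finset.eq_of_subset_of_card_le sub (by
    rw [zR r hrR, Finset.card_erase_of_mem hr]
    have : (N G L c).card = 3 := ((mC c).1 hc).2
    omega)
  have htZ := zf_of hG htR ht1.symm hyR hyr ht4
  rw [← eqq, Finset.mem_erase, mem_N] at htZ
  rcases hG.c4 y r c t hyr (mem_N.1 hr).2.symm htZ.2.2 ht4.symm with e | e
  · exact cA' (e ▸ hy)
  · exact ht1 e.symm

theorem D6 (hG : Good G) {S : Finset V} (hS : S.card = 29) (he : e2 G S = 144) (h5 : ∀ v ∈ S, 4 ≤ dd G S v ∧ dd G S v ≤ 4 + 2)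
    (hk : ∀ x ∈ cls G S 6, 3 ≤ dd G (cls G S 4) x) : (cls G S 6).card = 0 := by
  obtain ⟨c1, c2, c3, c4⟩ := split3d 4 h5
  norm_num at c1 c2 c3 c4
  have hk4 : ∀ x ∈ cls G S 6, dd G (cls G S 4) x ≤ 4 := by
    intro x hx
    by_contra hcon
    obtain ⟨T, hT, cT⟩ := Finset.exists_subset_card_eq (show 5 ≤ (N G (cls G S 4) x).card by change 5 ≤ dd G (cls G S 4) x; omega)
    have hT' : ∀ v ∈ T, v ∈ cls G S 4 ∧ G.Adj x v := fun v hv => mem_N.1 (hT hv)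
    obtain ⟨d1, d2⟩ := del_star (mem_cls.1 hx).1 (show T ⊆ N G S x from fun v hv => mem_N.2 ⟨(mem_cls.1 (hT' v hv).1).1, (hT' v hv).2⟩)
    rw [sum_eq fun v hv => (mem_cls.1 (hT' v hv).1).2, cT, (mem_cls.1 hx).2] at d1
    have := F23 hG _ (show (S \ insert x T).card = 23 by omega)
    omega
  have hs : ∀ x ∈ cls G S 6, dd G (cls G S 6) x + 2 ≤ dd G (cls G S 4) x ∧ dd G (cls G S 4) x + dd G (cls G S 5) x + dd G (cls G S 6) x = 6 := by
    intro x hx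
    have a1 := ball hG (mem_cls.1 hx).1
    have a2 := c3 x
    have a3 := c4 x
    have a4 := hk x hx
    have a5 := hk4 x hx
    rw [(mem_cls.1 hx).2] at a2
    omega
  have e1 := dd_comm (G := G) (cls G S 4) (cls G S 6)
  have e2' := dd_comm (G := G) (cls G S 5) (cls G S 6)
  have p := pairs hG (cls_sub (G := G) (S := S) (k := 6))
  rw [split3 4 h5 (fun v => dd G (cls G S 6) v * _), split3 4 h5] at p
  norm_num at p
  rw [show e2 G (cls G S 6) = ∑ x ∈ cls G S 6, dd G (cls G S 6) x from rfl] at p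
  have l1 := le_sum hk
  have l2 := sum_le hk4
  have l3 : ∑ x ∈ cls G S 6, (dd G (cls G S 6) x + 2) ≤ ∑ x ∈ cls G S 6, dd G (cls G S 4) x := Finset.sum_le_sum fun x hx => (hs x hx).1
  have l4 := sum_eq (A := cls G S 6) fun x hx => (hs x hx).2
  rw [Finset.sum_add_distrib, sum_eq (m := 2) (fun _ _ => rfl)] at l3
  rw [Finset.sum_add_distrib, Finset.sum_add_distrib] at l4
  rw [← e1] at l1 l2 l3 l4
  rw [← e2'] at l4
  have q4 := fun m => conv (cls G S 4) (dd G (cls G S 6)) m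
  have q5 := fun m => conv (cls G S 5) (dd G (cls G S 6)) m
  have q6 := fun m => conv (cls G S 6) (dd G (cls G S 6)) m
  have n4 : (cls G S 4).card = (cls G S 6).card + 1 := by omega
  have n5 : (cls G S 5).card = 28 - 2 * (cls G S 6).card := by omega
  rw [n4] at q4
  rw [n5] at q5
  have hle : (cls G S 6).card ≤ 14 := by omega
  have ev := e2_even (G := G) (cls G S 6)
  rw [show e2 G (cls G S 6) = ∑ x ∈ cls G S 6, dd G (cls G S 6) x from rfl] at ev
  clear c1 c2 c3 c4 hs hk hk4 e1 e2' n4 n5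
  revert p l1 l2 l3 l4 q4 q5 q6 hle ev
  generalize (cls G S 6).card = a
  generalize ∑ x ∈ cls G S 6, dd G (cls G S 6) x = s
  generalize ∑ x ∈ cls G S 5, dd G (cls G S 6) x = t
  generalize ∑ x ∈ cls G S 4, dd G (cls G S 6) x = k
  generalize ∑ x ∈ cls G S 6, dd G (cls G S 6) x * dd G (cls G S 6) x = ss
  generalize ∑ x ∈ cls G S 5, dd G (cls G S 6) x * dd G (cls G S 6) x = tt
  generalize ∑ x ∈ cls G S 4, dd G (cls G S 6) x * dd G (cls G S 6) x = kk
  intro p l1 l2 l3 l4 q4 q5 q6 hle ev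
  have u0 := q4 0
  have u1 := q4 1
  have u2 := q4 2
  have u3 := q4 3
  have v0 := q5 0
  have v1 := q5 1
  have v2 := q5 2
  have v3 := q5 3
  have w0 := q6 0
  have w1 := q6 1
  clear q4 q5 q6
  interval_cases a <;> omega

end
end Eng
end

section
open Finset
namespace Eng
noncomputable section
open Classical
variable {V : Type} {G : SimpleGraph V}

theorem match_step {Z : Finset V} {m : ℕ} (h : ∀ z ∈ Z, dd G Z z = 1) (hc : Z.card = m + 2) :
    ∃ a b : V, ∃ Z' : Finset V, a ∈ Z ∧ b ∈ Z ∧ a ≠ b ∧ G.Adj a b ∧ (∀ v, v ∈ Z ↔ v = a ∨ v = b ∨ v ∈ Z') ∧ a ∉ Z' ∧ b ∉ Z' ∧ Z'.card = m ∧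
      (∀ z ∈ Z', dd G Z' z = 1) ∧ (∀ u ∈ Z', ¬ G.Adj a u) ∧ (∀ u ∈ Z', ¬ G.Adj b u) := by
  obtain ⟨a, ha⟩ := Finset.card_pos.1 (show 0 < Z.card by omega)
  obtain ⟨b, hb, hab⟩ := dd_ex (le_of_eq (h a ha).symm)
  have uniq : ∀ c ∈ Z, ∀ u ∈ Z, ∀ v ∈ Z, G.Adj c u → G.Adj c v → u = v := by
    intro c hc u hu v hv h1 h2
    have h3 := h c hc
    rw [dd, Finset.card_eq_one] at h3
    obtain ⟨d, hd⟩ := h3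
    have e1 : u ∈ N G Z c := mem_N.2 ⟨hu, h1⟩
    have e2 : v ∈ N G Z c := mem_N.2 ⟨hv, h2⟩
    rw [hd, Finset.mem_singleton] at e1 e2
    rw [e1, e2]
  have hbe : b ∈ Z.erase a := Finset.mem_erase.2 ⟨hab.ne', hb⟩
  have na : ∀ u ∈ (Z.erase a).erase b, ¬ G.Adj a u := by
    intro u hu hau
    rw [Finset.mem_erase, Finset.mem_erase] at hu
    exact hu.1 (uniq a ha u hu.2.2 b hb hau hab)
  have nb : ∀ u ∈ (Z.erase a).erase b, ¬ G.Adj b u := by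
    intro u hu hau
    rw [Finset.mem_erase, Finset.mem_erase] at hu
    exact hu.2.1 (uniq b hb u hu.2.2 a ha hau hab.symm)
  refine ⟨a, b, (Z.erase a).erase b, ha, hb, hab.ne, hab, ?_, by simp, by simp, ?_, ?_, na, nb⟩
  · intro v
    rw [Finset.mem_erase, Finset.mem_erase]
    constructor
    · intro hv; tauto
    · rintro (rfl | rfl | h)
      · exact ha
      · exact hb
      · exact h.2.2
  · rw [Finset.card_erase_of_mem hbe, Finset.card_erase_of_mem ha, hc]; rfl
  · intro z hz
    have hz' := hz
    rw [Finset.mem_erase, Finset.mem_erase] at hz'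
    rw [← h z hz'.2.2, dd, dd]
    congr 1
    ext u
    rw [mem_N, mem_N, Finset.mem_erase, Finset.mem_erase]
    constructor
    · exact fun h => ⟨h.1.2.2, h.2⟩
    · rintro ⟨h1, h2⟩
      refine ⟨⟨?_, ?_, h1⟩, h2⟩
      · rintro rfl; exact nb z hz h2.symm
      · rintro rfl; exact na z hz h2.symm

theorem zf_symm {S : Finset V} {x w : V} (hw : w ∈ S) (h : x ∈ Zf G S w) : w ∈ Zf G S x := by
  rw [mem_Zf] at h ⊢
  refine ⟨hw, h.2.1.symm, fun h' => h.2.2.1 h'.symm, fun y hy hyw => ?_⟩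
  rw [mem_N] at hy
  exact h.2.2.2 y (mem_N.2 ⟨hy.1, hyw.symm⟩) hy.2.symm

theorem D5 (hG : Good G) {S : Finset V} (hS : S.card = 29) (he : e2 G S = 144) (h5 : ∀ v ∈ S, 4 ≤ dd G S v ∧ dd G S v ≤ 5) : False := by
  obtain ⟨c1', c2', -, -⟩ := split3d (G := G) (S := S) 4 fun v hv => ⟨(h5 v hv).1, by have := h5 v hv; omega⟩
  obtain ⟨d1, -⟩ := cls0 (G := G) (S := S) (k := 6) (fun v hv => by have := h5 v hv; omega)
  norm_num at c1' c2'
  obtain ⟨w, hw⟩ := Finset.card_eq_one.1 (show (cls G S 4).card = 1 by omega)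
  have hw4 : w ∈ cls G S 4 := by rw [hw]; simp
  have hwS := (mem_cls.1 hw4).1
  have hwd := (mem_cls.1 hw4).2
  have d5 : ∀ v ∈ S, v ≠ w → dd G S v = 5 := by
    intro v hv hne
    have := h5 v hv
    have : dd G S v ≠ 4 := fun h => hne (by
      have : v ∈ cls G S 4 := mem_cls.2 ⟨hv, h⟩
      rw [hw] at this
      exact Finset.mem_singleton.1 this)
    omega
  have dw : ∀ y ∈ N G S w, dd G S y = 5 := fun y hy => d5 y (N_sub hy) (mem_N.1 hy).2.ne'
  have bw : ∑ y ∈ N G S w, dd G S y = 20 := by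
    rw [sum_eq dw]; change dd G S w * 5 = _; rw [hwd]
  have cZ : (Zf G S w).card = 8 := by
    have := ball hG hwS
    omega
  have fx : ∀ x ∈ Zf G S w, x ∈ S ∧ dd G S x = 5 ∧ (∀ y ∈ N G S x, dd G S y = 5) ∧ ∑ y ∈ N G S x, dd G S y = 25 ∧ (Zf G S x).card = 3 ∧ w ∈ Zf G S x := by
    intro x hx
    have hx' := mem_Zf.1 hx
    have a1 := d5 x hx'.1 hx'.2.1
    have a2 : ∀ y ∈ N G S x, dd G S y = 5 := fun y hy => d5 y (N_sub hy) (by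
      rintro rfl
      exact hx'.2.2.1 (mem_N.1 hy).2.symm)
    have a3 : ∑ y ∈ N G S x, dd G S y = 25 := by
      rw [sum_eq a2]; change dd G S x * 5 = _; rw [a1]
    have := ball hG hx'.1
    exact ⟨hx'.1, a1, a2, a3, by omega, zf_symm hwS hx⟩
  by_cases hcase : ∃ x ∈ Zf G S w, ∃ z ∈ Zf G S x, G.Adj w z
  · obtain ⟨x, hx, z, hz, hwz⟩ := hcase
    obtain ⟨hxS, hxd, dy, bs, cx, hwx⟩ := fx x hx
    have hze : z ∈ (Zf G S x).erase w := Finset.mem_erase.2 ⟨hwz.ne', hz⟩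
    obtain ⟨z', hz'⟩ := Finset.card_eq_one.1 (show (((Zf G S x).erase w).erase z).card = 1 by
      rw [Finset.card_erase_of_mem hze, Finset.card_erase_of_mem hwx, cx])
    have mz' : z' ∈ ((Zf G S x).erase w).erase z := by rw [hz']; simp
    have hzs : ∀ v, v ∈ [w, z, z'] ↔ v ∈ Zf G S x := by
      intro v
      rw [← Finset.insert_erase hwx, ← Finset.insert_erase hze, hz']
      simp
    rw [Finset.mem_erase, Finset.mem_erase] at mz'
    have hzn : [w, z, z'].Nodup := by simp [hwz.ne, mz'.1.symm, mz'.2.1.symm]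
    have nw : ∀ y ∈ N G S x, ∀ u ∈ N G S y, u ≠ w := by
      rintro y hy u hu rfl
      exact (mem_Zf.1 hwx).2.2.2 y hy (mem_N.1 hu).2
    refine starU c2 hG hxS (fun v => dd G S v = 5) (fun v => ¬ dd G S v = 5) (fun _ => Iff.rfl) [w, z, z'] hzn hzs 5 4 4 4 0 0 0 0 [(4, 4), (5, 5), (5, 5)] rfl
      ?_ ?_ ?_ ?_ ?_ ?_ ?_ (by simp [s2])
    · exact fT dy hxd
    · exact fF fun y hy h => h (dy y hy)
    · intro y hy h
      refine ⟨h, fun u hu _ => ?_⟩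
      have := d5 u (N_sub hu) (nw y hy u hu)
      omega
    · intro y hy h
      exact absurd (dy y hy) h
    · have e1 := d5 z (mem_Zf.1 hz).1 hwz.ne'
      have e3 := d5 z' (mem_Zf.1 mz'.2.2).1 mz'.2.1
      exact List.Forall₂.cons (by simp [hwd]) (List.Forall₂.cons (by simp [e1]) (List.Forall₂.cons (by simp [e3]) List.Forall₂.nil))
    · rw [bs]; simp [s2]; omega
    · intro e he
      simp only [s2, List.mem_cons, List.not_mem_nil, or_false] at he
      subst he
      refine ⟨by norm_num, by norm_num, ?_⟩
      intro a b ha hb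
      norm_num at ha hb
      rw [← ha, ← hb]
      exact hwz
  · push Not at hcase
    have d1 : ∀ x ∈ Zf G S w, dd G (Zf G S w) x = 1 := by
      intro x hx
      obtain ⟨hxS, hxd, dy, bs, cx, hwx⟩ := fx x hx
      have hx' := mem_Zf.1 hx
      have l1 : ∑ u ∈ N G S w, dd G (N G S x) u = (N G S w).card * 1 := sum_eq (by
        intro u hu
        have hu' := mem_N.1 hu
        have a1 : u ∉ Zf G S x := fun h => hcase x hx u h hu'.2
        rw [mem_Zf] at a1
        push Not at a1
        obtain ⟨y, hy, hyu⟩ := a1 hu'.1 (by rintro rfl; exact hx'.2.2.1 hu'.2) (fun h => hx'.2.2.2 u hu h.symm)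
        apply le_antisymm
        · by_contra h6
          obtain ⟨a, ha, b, hb, hab⟩ := two_of (show 2 ≤ (N G (N G S x) u).card by change 2 ≤ dd G (N G S x) u; omega)
          rw [mem_N, mem_N] at ha hb
          rcases hG.c4 u a x b ha.2 ha.1.2.symm hb.1.2 hb.2.symm with e | e
          · exact hx'.2.2.1 (e ▸ hu'.2)
          · exact hab e
        · exact dd_pos hy hyu.symm)
      rw [dd_comm] at l1
      have l2 : ∑ y ∈ N G S x, (dd G (N G S w) y + (if y ∈ Zf G S w then 1 else 0)) = (N G S x).card * 1 := sum_eq (by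
        intro y hy
        have hy' := mem_N.1 hy
        split_ifs with h
        · rw [dd_zero fun u hu ha => (mem_Zf.1 h).2.2.2 u hu ha.symm]
        · rw [mem_Zf] at h
          push Not at h
          obtain ⟨u, hu, huy⟩ := h hy'.1 (by rintro rfl; exact hx'.2.2.1 hy'.2.symm) (fun h => hx'.2.2.2 y (mem_N.2 ⟨hy'.1, h⟩) hy'.2.symm)
          apply le_antisymm
          · by_contra h6
            obtain ⟨a, ha, b, hb, hab⟩ := two_of (show 2 ≤ (N G (N G S w) y).card by change 2 ≤ dd G (N G S w) y; omega)
            rw [mem_N, mem_N] at ha hb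
            rcases hG.c4 y a w b ha.2 ha.1.2.symm hb.1.2 hb.2.symm with e | e
            · exact hx'.2.2.1 (e ▸ hy'.2.symm)
            · exact hab e
          · have := dd_pos hu huy.symm
            omega)
      have l3 : ∑ y ∈ N G S x, (if y ∈ Zf G S w then 1 else 0) = dd G (Zf G S w) x := by
        rw [← Finset.sum_filter, Finset.sum_const, smul_eq_mul, mul_one, dd]
        congr 1
        ext v
        rw [Finset.mem_filter, mem_N, mem_N]
        exact ⟨fun h => ⟨h.2, h.1.2⟩, fun h => ⟨⟨(mem_Zf.1 h.1).1, h.2⟩, h.1⟩⟩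
      rw [Finset.sum_add_distrib, l3, l1] at l2
      change dd G S w * 1 + _ = dd G S x * 1 at l2
      omega
    have dZ : ∀ v ∈ Zf G S w, dd G S v = 5 := fun v hv => (fx v hv).2.1
    have hmZ : ∀ v, v ∈ Zf G S w ↔ v ∈ Zf G S w := fun _ => Iff.rfl
    obtain ⟨a1, b1, Z1, ma1, mb1, ne1, ad1, i1, na1, nb1, k1, q1, p1, r1⟩ := match_step d1 (m := 6) cZ
    obtain ⟨a2, b2, Z2, ma2, mb2, ne2, ad2, i2, na2, nb2, k2, q2, p2, r2⟩ := match_step q1 (m := 4) k1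
    obtain ⟨a3, b3, Z3, ma3, mb3, ne3, ad3, i3, na3, nb3, k3, q3, p3, r3⟩ := match_step q2 (m := 2) k2
    obtain ⟨a4, b4, Z4, ma4, mb4, ne4, ad4, i4, na4, nb4, k4, q4, p4, r4⟩ := match_step q3 (m := 0) k3
    have e4 := Finset.card_eq_zero.1 k4
    have s21 : ∀ v ∈ Z2, v ∈ Z1 := fun v hv => (i2 v).2 (Or.inr (Or.inr hv))
    have s32 : ∀ v ∈ Z3, v ∈ Z2 := fun v hv => (i3 v).2 (Or.inr (Or.inr hv))
    have s10 : ∀ v ∈ Z1, v ∈ Zf G S w := fun v hv => (i1 v).2 (Or.inr (Or.inr hv))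
    have ma3' := s21 _ ma3
    have mb3' := s21 _ mb3
    have ma4' := s32 _ ma4
    have mb4' := s32 _ mb4
    have ma4'' := s21 _ ma4'
    have mb4'' := s21 _ mb4'
    have nn : ∀ {u v : V} {Z : Finset V}, u ∉ Z → v ∈ Z → u ≠ v := fun h1 h2 h => h1 (h ▸ h2)
    have hzs : ∀ v, v ∈ [a1, b1, a2, b2, a3, b3, a4, b4] ↔ v ∈ Zf G S w := by
      intro v
      rw [i1, i2, i3, i4, e4]
      simp
    have hzn : [a1, b1, a2, b2, a3, b3, a4, b4].Nodup := by
      simp only [List.nodup_cons, List.mem_cons, List.not_mem_nil, or_false, not_or, not_false_eq_true, List.nodup_nil, and_true]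
      refine ⟨⟨ne1, nn na1 ma2, nn na1 mb2, nn na1 ma3', nn na1 mb3', nn na1 ma4'', nn na1 mb4''⟩, ⟨nn nb1 ma2, nn nb1 mb2, nn nb1 ma3', nn nb1 mb3', nn nb1 ma4'', nn nb1 mb4''⟩,
        ⟨ne2, nn na2 ma3, nn na2 mb3, nn na2 ma4', nn na2 mb4'⟩, ⟨nn nb2 ma3, nn nb2 mb3, nn nb2 ma4', nn nb2 mb4'⟩, ⟨ne3, nn na3 ma4, nn na3 mb4⟩, ⟨nn nb3 ma4, nn nb3 mb4⟩, ne4⟩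
    have hd : ∀ v ∈ Zf G S w, 5 ≤ dd G S v ∧ dd G S v ≤ 5 := fun v hv => by have := dZ v hv; omega
    refine starU c1 hG hwS (fun v => dd G S v = 5) (fun v => ¬ dd G S v = 5) (fun _ => Iff.rfl) [a1, b1, a2, b2, a3, b3, a4, b4] hzn hzs 4 4 4 4 0 0 0 0 (List.replicate 8 (5, 5)) rfl
      ?_ ?_ ?_ ?_ ?_ ?_ ?_ ?_
    · exact fT dw hwd
    · exact fF fun y hy h => h (dw y hy)
    · intro y hy h
      refine ⟨h, fun u hu hne => ?_⟩
      have := d5 u (N_sub hu) hne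
      omega
    · intro y hy h
      exact absurd (dw y hy) h
    · exact f2_rep rfl fun v hv => hd v ((hzs v).1 hv)
    · rw [bw]; simp [s1]; omega
    · intro e he
      simp only [s1, List.mem_cons, List.not_mem_nil, or_false] at he
      rcases he with rfl | rfl | rfl | rfl
      all_goals
        refine ⟨by norm_num, by norm_num, ?_⟩
        intro a b ha hb
        norm_num at ha hb
        rw [← ha, ← hb]
        assumption
    · intro e he
      simp only [s1, List.mem_cons, List.not_mem_nil, or_false] at he
      rcases he with rfl | rfl | rfl | rfl | rfl | rfl | rfl | rfl | rfl | rfl | rfl | rfl | rfl | rfl | rfl | rfl | rfl | rfl | rfl | rfl | rfl | rfl | rfl | rfl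
      all_goals
        refine ⟨by norm_num, by norm_num, ?_⟩
        intro a b ha hb
        norm_num at ha hb
        rw [← ha, ← hb]
        first
          | exact p1 _ ‹_›
          | exact r1 _ ‹_›
          | exact p2 _ ‹_›
          | exact r2 _ ‹_›
          | exact p3 _ ‹_›
          | exact r3 _ ‹_›

end
end Eng
end

section
namespace Eng
open Finset Classical

theorem good_of {V : Type} {G : SimpleGraph V} (hg : ∀ ⦃u : V⦄ (w : G.Walk u u), w.IsCycle → 5 ≤ w.length) : Good G := by
  refine ⟨?_, ?_⟩
  · intro a b c h1 h2 h3
    have := hg (SimpleGraph.Walk.cons h1 (SimpleGraph.Walk.cons h2 (SimpleGraph.Walk.cons h3.symm SimpleGraph.Walk.nil))) (by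
      rw [SimpleGraph.Walk.cons_isCycle_iff]
      simp [SimpleGraph.Walk.cons_isPath_iff, h1.ne, h2.ne, h3.ne, h1.ne', h2.ne', h3.ne'])
    simp at this
  · intro a b c d h1 h2 h3 h4
    by_contra hcon
    push Not at hcon
    have := hg (SimpleGraph.Walk.cons h1 (SimpleGraph.Walk.cons h2 (SimpleGraph.Walk.cons h3 (SimpleGraph.Walk.cons h4 SimpleGraph.Walk.nil)))) (by
      rw [SimpleGraph.Walk.cons_isCycle_iff]
      simp [SimpleGraph.Walk.cons_isPath_iff, h1.ne, h2.ne, h3.ne, h4.ne, h1.ne', h2.ne', h3.ne', h4.ne', hcon.1, hcon.2, hcon.1.symm, hcon.2.symm])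
    simp at this

theorem deg_dd (G : SimpleGraph (Fin 29)) [DecidableRel G.Adj] (v : Fin 29) : dd G Finset.univ v = G.degree v := by
  rw [dd, ← SimpleGraph.card_neighborFinset_eq_degree]
  congr 1
  ext u
  rw [mem_N, SimpleGraph.mem_neighborFinset]
  simp

theorem final (G : SimpleGraph (Fin 29)) [DecidableRel G.Adj] (hG : Good G) (he : G.edgeFinset.card = 72) :
    (∀ v, 4 ≤ G.degree v) ∧ (∀ v, G.degree v ≤ 6) ∧ (∃ v, G.degree v = 4) ∧
    ∃ x, G.degree x = 6 ∧ dd G (cls G Finset.univ 4) x ≤ 2 := by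
  have hS : (Finset.univ : Finset (Fin 29)).card = 29 := by simp
  have h2 : e2 G Finset.univ = 144 := by
    have := G.sum_degrees_eq_twice_card_edges
    rw [he] at this
    rw [e2, Finset.sum_congr rfl fun v _ => deg_dd G v, this]
  have h4 : ∀ v ∈ (Finset.univ : Finset (Fin 29)), 4 ≤ dd G Finset.univ v := fun v hv => by
    have := (F28 hG).erase hS hv
    omega
  have h6 : ∀ v ∈ (Finset.univ : Finset (Fin 29)), dd G Finset.univ v ≤ 4 + 2 := fun v hv => by
    have := deg_mul hG h4 hv
    have := D7 hG hS h2 h4 hv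
    omega
  refine ⟨fun v => by rw [← deg_dd]; exact h4 v (Finset.mem_univ v), fun v => by rw [← deg_dd]; exact h6 v (Finset.mem_univ v), ?_, ?_⟩
  · by_contra hcon
    push Not at hcon
    have := le_sum (A := (Finset.univ : Finset (Fin 29))) (f := dd G Finset.univ) (m := 5) (fun v hv => by
      have a := h4 v hv
      have b := hcon v
      rw [← deg_dd] at b
      omega)
    change _ ≤ e2 G Finset.univ at this
    omega
  · by_contra hcon
    push Not at hcon
    have h0 := D6 hG hS h2 (fun v hv => ⟨h4 v hv, h6 v hv⟩) (fun x hx => by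
      have := hcon x (by rw [← deg_dd]; exact (mem_cls.1 hx).2)
      omega)
    refine D5 hG hS h2 fun v hv => ⟨h4 v hv, ?_⟩
    have a := h6 v hv
    have : dd G Finset.univ v ≠ 6 := fun h => by
      have := Finset.card_pos.2 ⟨v, mem_cls.2 ⟨hv, h⟩⟩
      omega
    omega

theorem star_of (G : SimpleGraph (Fin 29)) [DecidableRel G.Adj] (h4 : ∀ v, 4 ≤ G.degree v) {x : Fin 29} (hx : G.degree x = 6) (h : dd G (cls G Finset.univ 4) x ≤ 2) :
    ∃ y : Fin 6 → Fin 29, Function.Injective y ∧ (∀ i, G.Adj x (y i)) ∧ ∀ i, (![4, 4, 4, 4, 3, 3] : Fin 6 → ℕ) i + 1 ≤ G.degree (y i) := by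
  obtain ⟨A, hA⟩ : ∃ A, A = (G.neighborFinset x).filter fun v => 5 ≤ G.degree v := ⟨_, rfl⟩
  have cA : 4 ≤ A.card := by
    have e1 := Finset.card_filter_add_card_filter_not (s := G.neighborFinset x) (fun v => 5 ≤ G.degree v)
    have e2 : ((G.neighborFinset x).filter fun v => ¬ 5 ≤ G.degree v).card ≤ dd G (cls G Finset.univ 4) x := by
      apply Finset.card_le_card
      intro v hv
      rw [Finset.mem_filter, SimpleGraph.mem_neighborFinset] at hv
      rw [mem_N, mem_cls, deg_dd]
      have := h4 v
      exact ⟨⟨Finset.mem_univ v, by omega⟩, hv.1⟩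
    rw [SimpleGraph.card_neighborFinset_eq_degree, hx, ← hA] at e1
    omega
  obtain ⟨B, hBA, cB⟩ := Finset.exists_subset_card_eq cA
  have hBN : B ⊆ G.neighborFinset x := hBA.trans (by rw [hA]; exact Finset.filter_subset _ _)
  obtain ⟨C, hC⟩ : ∃ C, C = G.neighborFinset x \ B := ⟨_, rfl⟩
  have cC : C.card = 2 := by
    rw [hC, Finset.card_sdiff_of_subset hBN, SimpleGraph.card_neighborFinset_eq_degree, hx, cB]
  let f := B.equivFinOfCardEq cB
  let g := C.equivFinOfCardEq cC
  let y : Fin (4 + 2) → Fin 29 := Fin.append (fun i => (f.symm i : Fin 29)) (fun i => (g.symm i : Fin 29))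
  have y1 : ∀ i : Fin 4, y (Fin.castAdd 2 i) = f.symm i := fun i => Fin.append_left _ _ i
  have y2 : ∀ i : Fin 2, y (Fin.natAdd 4 i) = g.symm i := fun i => Fin.append_right _ _ i
  have mB : ∀ i, (f.symm i : Fin 29) ∈ B := fun i => (f.symm i).2
  have mC : ∀ i, (g.symm i : Fin 29) ∈ C := fun i => (g.symm i).2
  have hCB : ∀ v ∈ C, v ∈ G.neighborFinset x ∧ v ∉ B := fun v hv => by rw [hC] at hv; exact Finset.mem_sdiff.1 hv
  refine ⟨y, ?_, ?_, ?_⟩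
  · intro i j
    refine Fin.addCases (m := 4) (n := 2) (fun i => ?_) (fun i => ?_) i <;> refine Fin.addCases (m := 4) (n := 2) (fun j => ?_) (fun j => ?_) j
    · rw [y1, y1]; intro h
      rw [f.symm.injective (Subtype.ext h)]
    · rw [y1, y2]; intro h
      exact absurd (h ▸ mB i) (hCB _ (mC j)).2
    · rw [y1, y2]; intro h
      exact absurd (h ▸ mB j) (hCB _ (mC i)).2
    · rw [y2, y2]; intro h
      rw [g.symm.injective (Subtype.ext h)]
  · intro i
    refine Fin.addCases (m := 4) (n := 2) (fun i => ?_) (fun i => ?_) i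
    · rw [y1]; exact (SimpleGraph.mem_neighborFinset _ _ _).1 (hBN (mB i))
    · rw [y2]; exact (SimpleGraph.mem_neighborFinset _ _ _).1 (hCB _ (mC i)).1
  · intro i
    refine Fin.addCases (m := 4) (n := 2) (fun i => ?_) (fun i => ?_) i
    · rw [y1]
      have := hBA (mB i)
      rw [hA, Finset.mem_filter] at this
      refine le_trans (le_of_eq ?_) this.2
      fin_cases i <;> rfl
    · rw [y2]
      refine le_trans (le_of_eq ?_) (h4 _)
      fin_cases i <;> rfl

theorem minmax (G : SimpleGraph (Fin 29)) [DecidableRel G.Adj] (h4 : ∀ v, 4 ≤ G.degree v) (h6 : ∀ v, G.degree v ≤ 6) (e4 : ∃ v, G.degree v = 4) (e6 : ∃ v, G.degree v = 6) :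
    (G.minDegree, G.maxDegree) = (4, 6) := by
  obtain ⟨a, ha⟩ := e4
  obtain ⟨b, hb⟩ := e6
  have h1 := G.minDegree_le_degree a
  have h2 := G.degree_le_maxDegree b
  have h3 := G.le_minDegree_of_forall_le_degree 4 h4
  have h5 := G.maxDegree_le_of_forall_degree_le 6 h6
  rw [Prod.mk.injEq]
  omega

end Eng
end

theorem stmt16 (G : SimpleGraph (Fin 29)) [DecidableRel G.Adj]
    (hg : GirthAtLeast5 G) (he : G.edgeFinset.card = 72) :
    (G.minDegree, G.maxDegree) = (4, 6) ∧ HasEmbeddedStar G 6 ![4, 4, 4, 4, 3, 3] := by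
  have hG : Eng.Good G := Eng.good_of hg
  obtain ⟨h4, h6, e4, x, hx, hk⟩ := Eng.final G hG he
  obtain ⟨y, y1, y2, y3⟩ := Eng.star_of G h4 hx hk
  exact ⟨Eng.minmax G h4 h6 e4 ⟨x, hx⟩, x, y, hx, y1, y2, y3⟩
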